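/- Let d ≥ 2, Lu = −u_t + a^{jk}(t, x′)D_{jk}u, where the coefficients depend only on (t, x′) and tr a = a^{11} + a^{22} depends only on t. Then there exists a constant N = N(δ), independent of the dimension d, such that for any u ∈ C₀^∞(ℝ^{d+1}) and any λ ≥ 0, λ‖u‖_{L₂(ℝ^{d+1})} + √λ‖Du‖_{L₂(ℝ^{d+1})} + ‖D²u‖_{L₂(ℝ^{d+1})} + ‖u_t‖_{L₂(ℝ^{d+1})} ≤ N‖Lu − λu‖_{L₂(ℝ^{d+1})}. -/

import Mathlib

open MeasureTheory Real Set Filter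
open scoped ENNReal

noncomputable section

/-- First-order partial derivative of `u : ℝ × ℝ^d → ℝ` in the `j`-th space coordinate. -/
def pd {d : ℕ} (j : Fin d) (u : ℝ × (Fin d → ℝ) → ℝ) : ℝ × (Fin d → ℝ) → ℝ :=
  fun p => deriv (fun s => u (p.1, Function.update p.2 j s)) (p.2 j)

/-- Second-order partial derivative `D_{jk} u` in the space coordinates. -/
def pd2 {d : ℕ} (j k : Fin d) (u : ℝ × (Fin d → ℝ) → ℝ) : ℝ × (Fin d → ℝ) → ℝ :=
  pd j (pd k u)

/-- Time derivative `u_t`. -/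
def pt {d : ℕ} (u : ℝ × (Fin d → ℝ) → ℝ) : ℝ × (Fin d → ℝ) → ℝ :=
  fun p => deriv (fun s => u (s, p.2)) p.1

/-- Spatial gradient `Du`, as a Euclidean-space valued function. -/
def sgrad {d : ℕ} (u : ℝ × (Fin d → ℝ) → ℝ) (p : ℝ × (Fin d → ℝ)) :
    EuclideanSpace ℝ (Fin d) :=
  (WithLp.equiv 2 (Fin d → ℝ)).symm fun j => pd j u p

/-- Spatial Hessian `D²u`, as a Euclidean-space valued function (Frobenius norm). -/
def shess {d : ℕ} (u : ℝ × (Fin d → ℝ) → ℝ) (p : ℝ × (Fin d → ℝ)) :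
    EuclideanSpace ℝ (Fin d × Fin d) :=
  (WithLp.equiv 2 (Fin d × Fin d → ℝ)).symm fun jk => pd2 jk.1 jk.2 u p

/-- The half space `ℝ^{d+1}_T = (-∞, T) × ℝ^d`, with `T ∈ (-∞, +∞]` an extended real. -/
def halfSpace (d : ℕ) (T : EReal) : Set (ℝ × (Fin d → ℝ)) := {p | (p.1 : EReal) < T}

/-- `u ∈ W^{1,2}_p(μ)` : `u`, `u_t`, `Du`, `D²u` all belong to `L_p(μ)`. -/
def MemW12 {d : ℕ} (p : ℝ≥0∞) (μ : Measure (ℝ × (Fin d → ℝ)))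
    (u : ℝ × (Fin d → ℝ) → ℝ) : Prop :=
  MemLp u p μ ∧ MemLp (pt u) p μ ∧ MemLp (sgrad u) p μ ∧ MemLp (shess u) p μ

/-- The parabolic operator `Lu = -u_t + a^{jk} D_{jk} u + b^j D_j u + c u`. -/
def parOp {d : ℕ} (a : ℝ × (Fin d → ℝ) → Fin d → Fin d → ℝ)
    (b : ℝ × (Fin d → ℝ) → Fin d → ℝ) (c : ℝ × (Fin d → ℝ) → ℝ)
    (u : ℝ × (Fin d → ℝ) → ℝ) : ℝ × (Fin d → ℝ) → ℝ :=
  fun p => -(pt u p) + (∑ j, ∑ k, a p j k * pd2 j k u p)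
    + (∑ j, b p j * pd j u p) + c p * u p

/-- Symmetry and uniform ellipticity with constant `δ`:
`a^{jk} = a^{kj}` and `δ|ξ|² ≤ a^{jk} ξ^j ξ^k ≤ δ⁻¹ |ξ|²`. -/
def Elliptic {d : ℕ} (δ : ℝ) (a : ℝ × (Fin d → ℝ) → Fin d → Fin d → ℝ) : Prop :=
  ∀ p, (∀ j k, a p j k = a p k j) ∧
    ∀ ξ : Fin d → ℝ,
      δ * (∑ j, ξ j ^ 2) ≤ ∑ j, ∑ k, a p j k * ξ j * ξ k ∧
      ∑ j, ∑ k, a p j k * ξ j * ξ k ≤ δ⁻¹ * (∑ j, ξ j ^ 2)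

/-- `tr a = a^{11} + a^{22}`. -/
def trA {d : ℕ} (hd : 2 ≤ d) (a : ℝ × (Fin d → ℝ) → Fin d → Fin d → ℝ)
    (p : ℝ × (Fin d → ℝ)) : ℝ :=
  a p ⟨0, by omega⟩ ⟨0, by omega⟩ + a p ⟨1, by omega⟩ ⟨1, by omega⟩

set_option linter.unusedSectionVars false
set_option linter.unusedVariables false
set_option linter.unusedSimpArgs false



abbrev E3 := ℝ × ℝ × ℝ

section basics
variable {V : Type*} [NormedAddCommGroup V] [NormedSpace ℝ V]

def dv (v : V) (u : V → ℝ) : V → ℝ := fun p => fderiv ℝ u p v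

def Tst (u : V → ℝ) : Prop := ContDiff ℝ (⊤ : ℕ∞) u ∧ HasCompactSupport u

/-- bounded measurable -/
@[fun_prop]
def BM [MeasurableSpace V] (f : V → ℝ) : Prop := Measurable f ∧ ∃ M, ∀ p, |f p| ≤ M

/-- bounded measurable with compact support -/
@[fun_prop]
def BC [MeasurableSpace V] (f : V → ℝ) : Prop := BM f ∧ HasCompactSupport f

lemma Tst.contDiff {u : V → ℝ} (h : Tst u) : ContDiff ℝ (⊤ : ℕ∞) u := h.1
lemma Tst.diff {u : V → ℝ} (h : Tst u) : Differentiable ℝ u := h.1.differentiable (by simp)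
lemma Tst.cont {u : V → ℝ} (h : Tst u) : Continuous u := h.1.continuous

lemma contDiff_dv {u : V → ℝ} (h : ContDiff ℝ (⊤ : ℕ∞) u) (v : V) :
    ContDiff ℝ (⊤ : ℕ∞) (dv v u) :=
  (h.fderiv_right (m := (⊤ : ℕ∞)) (by simp)).clm_apply contDiff_const

lemma Tst.dv {u : V → ℝ} (h : Tst u) (v : V) : Tst (dv v u) :=
  ⟨contDiff_dv h.1 v, h.2.fderiv_apply ℝ v⟩

lemma Tst.add {u w : V → ℝ} (h : Tst u) (h' : Tst w) : Tst (fun p => u p + w p) :=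
  ⟨h.1.add h'.1, h.2.add h'.2⟩
lemma Tst.sub {u w : V → ℝ} (h : Tst u) (h' : Tst w) : Tst (fun p => u p - w p) :=
  ⟨h.1.sub h'.1, h.2.sub h'.2⟩
lemma Tst.mul {u w : V → ℝ} (h : Tst u) (h' : Tst w) : Tst (fun p => u p * w p) :=
  ⟨h.1.mul h'.1, h.2.mul_right⟩
lemma Tst.smul {c w : V → ℝ} (h : ContDiff ℝ (⊤ : ℕ∞) c) (h' : Tst w) :
    Tst (fun p => c p * w p) :=
  ⟨h.mul h'.1, h'.2.mul_left⟩
lemma Tst.neg {u : V → ℝ} (h : Tst u) : Tst (fun p => - u p) :=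
  ⟨h.1.neg, h.2.neg⟩
lemma Tst.cmul {w : V → ℝ} (h' : Tst w) (c : ℝ) :
    Tst (fun p => c * w p) := Tst.smul (c := fun _ => c) contDiff_const h'

lemma dv_add {u w : V → ℝ} (hu : Differentiable ℝ u) (hw : Differentiable ℝ w) (v : V) :
    dv v (fun p => u p + w p) = fun p => dv v u p + dv v w p := by
  funext p; simp only [dv]; rw [fderiv_fun_add (hu p) (hw p)]; rfl
lemma dv_sub {u w : V → ℝ} (hu : Differentiable ℝ u) (hw : Differentiable ℝ w) (v : V) :
    dv v (fun p => u p - w p) = fun p => dv v u p - dv v w p := by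
  funext p; simp only [dv]; rw [fderiv_fun_sub (hu p) (hw p)]; rfl
lemma dv_neg {u : V → ℝ} (v : V) :
    dv v (fun p => - u p) = fun p => - dv v u p := by
  funext p; simp only [dv]; rw [fderiv_fun_neg]; rfl
lemma dv_mul {u w : V → ℝ} (hu : Differentiable ℝ u) (hw : Differentiable ℝ w) (v : V) :
    dv v (fun p => u p * w p) = fun p => dv v u p * w p + u p * dv v w p := by
  funext p; simp only [dv]; rw [fderiv_fun_mul (hu p) (hw p)]
  simp; ring
lemma dv_cmul {u : V → ℝ} (hu : Differentiable ℝ u) (c : ℝ) (v : V) :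
    dv v (fun p => c * u p) = fun p => c * dv v u p := by
  funext p; simp only [dv]; rw [fderiv_const_mul (hu p)]; simp

lemma dv_comm {u : V → ℝ} (h : ContDiff ℝ (⊤ : ℕ∞) u) (v w : V) :
    dv v (dv w u) = dv w (dv v u) := by
  have hd : Differentiable ℝ (fderiv ℝ u) :=
    (h.fderiv_right (m := (⊤ : ℕ∞)) (by simp)).differentiable (by simp)
  have key : ∀ (a b : V) p, dv a (dv b u) p = fderiv ℝ (fderiv ℝ u) p a b := by
    intro a b p
    change fderiv ℝ (fun y => fderiv ℝ u y b) p a = _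
    rw [fderiv_clm_apply (hd p) (differentiableAt_const b)]
    simp
  funext p
  rw [key, key]
  have := (h.contDiffAt (x := p)).isSymmSndFDerivAt
    (by simp only [minSmoothness_of_isRCLikeNormedField]; exact WithTop.coe_le_coe.2 (le_top : (2 : ℕ∞) ≤ ⊤))
  exact this v w

lemma hasLineDerivAt_dv {u : V → ℝ} (h : Differentiable ℝ u) (v p : V) :
    HasLineDerivAt ℝ u (dv v u p) p v := (h p).hasFDerivAt.hasLineDerivAt v

end basics

section meas
variable {V : Type*} [NormedAddCommGroup V] [NormedSpace ℝ V]
  [MeasurableSpace V]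

@[fun_prop]
lemma BM.meas {f : V → ℝ} (h : BM f) : Measurable f := h.1
@[fun_prop]
lemma BM.const (c : ℝ) : BM (fun _ : V => c) := ⟨measurable_const, |c|, fun _ => le_rfl⟩
@[fun_prop]
lemma BM.add {f g : V → ℝ} (hf : BM f) (hg : BM g) : BM (fun p => f p + g p) := by
  obtain ⟨h1, M, hM⟩ := hf
  obtain ⟨h2, M', hM'⟩ := hg
  exact ⟨h1.add h2, M + M', fun p => (abs_add_le _ _).trans (add_le_add (hM p) (hM' p))⟩
@[fun_prop]
lemma BM.neg {f : V → ℝ} (hf : BM f) : BM (fun p => - f p) := by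
  obtain ⟨h1, M, hM⟩ := hf
  exact ⟨h1.neg, M, fun p => by simpa using hM p⟩
@[fun_prop]
lemma BM.sub {f g : V → ℝ} (hf : BM f) (hg : BM g) : BM (fun p => f p - g p) := by
  simpa [sub_eq_add_neg] using hf.add hg.neg
@[fun_prop]
lemma BM.mul {f g : V → ℝ} (hf : BM f) (hg : BM g) : BM (fun p => f p * g p) := by
  obtain ⟨h1, M, hM⟩ := hf
  obtain ⟨h2, M', hM'⟩ := hg
  refine ⟨h1.mul h2, M * M', fun p => ?_⟩
  rw [abs_mul]
  exact mul_le_mul (hM p) (hM' p) (abs_nonneg _) ((abs_nonneg _).trans (hM p))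
@[fun_prop]
lemma BM.pow {f : V → ℝ} (hf : BM f) (n : ℕ) : BM (fun p => f p ^ n) := by
  obtain ⟨h1, M, hM⟩ := hf
  refine ⟨h1.pow_const n, M ^ n, fun p => ?_⟩
  rw [abs_pow]
  exact pow_le_pow_left₀ (abs_nonneg _) (hM p) n

@[fun_prop]
lemma BC.zero : BC (fun _ : V => 0) := ⟨BM.const 0, HasCompactSupport.zero⟩
lemma BC.bm {f : V → ℝ} (h : BC f) : BM f := h.1
@[fun_prop]
lemma BC.add {f g : V → ℝ} (hf : BC f) (hg : BC g) : BC (fun p => f p + g p) :=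
  ⟨hf.1.add hg.1, hf.2.add hg.2⟩
@[fun_prop]
lemma BC.sub {f g : V → ℝ} (hf : BC f) (hg : BC g) : BC (fun p => f p - g p) :=
  ⟨hf.1.sub hg.1, hf.2.sub hg.2⟩
@[fun_prop]
lemma BC.neg {f : V → ℝ} (hf : BC f) : BC (fun p => - f p) :=
  ⟨hf.1.neg, hf.2.neg⟩
@[fun_prop]
lemma BC.lmul {f g : V → ℝ} (hf : BM f) (hg : BC g) : BC (fun p => f p * g p) :=
  ⟨hf.mul hg.1, hg.2.mul_left⟩
@[fun_prop]
lemma BC.rmul {f g : V → ℝ} (hf : BC f) (hg : BM g) : BC (fun p => f p * g p) :=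
  ⟨hf.1.mul hg, hf.2.mul_right⟩
@[fun_prop]
lemma BC.sq {f : V → ℝ} (hf : BC f) : BC (fun p => f p ^ 2) := by
  simpa [pow_two] using BC.lmul hf.1 hf

variable [BorelSpace V]
lemma BC.of_cont {f : V → ℝ} (h : Continuous f) (hc : HasCompactSupport f) : BC f := by
  obtain ⟨C, hC⟩ := h.bounded_above_of_compact_support hc
  exact ⟨⟨h.measurable, C, hC⟩, hc⟩

lemma Tst.bc {f : V → ℝ} (h : Tst f) : BC f := BC.of_cont h.cont h.2

variable {μ : Measure V} [IsFiniteMeasureOnCompacts μ]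

lemma BC.int {f : V → ℝ} (h : BC f) : Integrable f μ := by
  obtain ⟨⟨h1, M, hM⟩, h2⟩ := h
  rw [← integrableOn_iff_integrable_of_support_subset (subset_tsupport f)]
  have : IsFiniteMeasure (μ.restrict (tsupport f)) := ⟨by
    rw [Measure.restrict_apply_univ]; exact h2.measure_lt_top⟩
  exact Integrable.of_bound h1.aestronglyMeasurable M (Filter.Eventually.of_forall hM)

lemma BC.memLp {f : V → ℝ} (h : BC f) : MemLp f 2 μ := by
  rw [memLp_two_iff_integrable_sq h.1.1.aestronglyMeasurable]
  exact h.sq.int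

end meas

section ibp
variable {V : Type*} [NormedAddCommGroup V] [NormedSpace ℝ V] [FiniteDimensional ℝ V]
  [MeasurableSpace V] [BorelSpace V] {μ : Measure V} [μ.IsAddHaarMeasure]

lemma ibp {c c' F F' : V → ℝ} {v : V} (hc : BM c) (hc' : BM c') (hF : BC F) (hF' : BC F')
    (h1 : ∀ p, HasLineDerivAt ℝ c (c' p) p v) (h2 : ∀ p, HasLineDerivAt ℝ F (F' p) p v) :
    ∫ p, (c p * F' p + c' p * F p) ∂μ = 0 := by
  have := integral_bilinear_hasLineDerivAt_right_eq_neg_left_of_integrable (μ := μ)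
    (B := ContinuousLinearMap.mul ℝ ℝ) (f := c) (f' := c') (g := F) (g' := F') (v := v)
    (BC.int (by simp only [ContinuousLinearMap.mul_apply']; fun_prop)) 
    (BC.int (by simp only [ContinuousLinearMap.mul_apply']; fun_prop))
    (BC.int (by simp only [ContinuousLinearMap.mul_apply']; fun_prop))
    (fun x _ => h1 x) (fun x _ => h2 x)
  simp only [ContinuousLinearMap.mul_apply'] at this
  rw [integral_add (BC.int (by fun_prop)) (BC.int (by fun_prop)), this]
  simp
end ibp




instance volE2_haar : (volume : Measure (ℝ × ℝ)).IsAddHaarMeasure :=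
  Measure.prod.instIsAddHaarMeasure (volume : Measure ℝ) (volume : Measure ℝ)
instance volE3_haar : (volume : Measure E3).IsAddHaarMeasure :=
  Measure.prod.instIsAddHaarMeasure (volume : Measure ℝ) (volume : Measure (ℝ × ℝ))

def ee0 : E3 := (1, 0, 0)
def ee1 : E3 := (0, 1, 0)
def ee2 : E3 := (0, 0, 1)

structure Coef (δ : ℝ) (a b c : E3 → ℝ) : Prop where
  ma : Measurable a
  mb : Measurable b
  mc : Measurable c
  lo : ∀ p x y, δ * (x ^ 2 + y ^ 2) ≤ a p * x ^ 2 + 2 * b p * x * y + c p * y ^ 2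
  hi : ∀ p x y, a p * x ^ 2 + 2 * b p * x * y + c p * y ^ 2 ≤ δ⁻¹ * (x ^ 2 + y ^ 2)
  tr : ∀ t x y x' y', a (t, x, y) + c (t, x, y) = a (t, x', y') + c (t, x', y')

def TInv (m : E3 → ℝ) : Prop := ∀ (p v : E3) (s : ℝ), v.1 = 0 → m (p + s • v) = m p

structure Wt (θ θ' : E3 → ℝ) : Prop where
  bm : BM θ
  bm' : BM θ'
  line0 : ∀ p, HasLineDerivAt ℝ θ (θ' p) p ee0
  inv : TInv θ
  pos : ∀ t, 0 ≤ θ t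
  le : ∀ t, θ t ≤ 1
  dle : ∀ t, θ' t ≤ 0

def Pop (a b c : E3 → ℝ) (κ : ℝ) (w : E3 → ℝ) : E3 → ℝ := fun p =>
  - dv ee0 w p + (a p * dv ee1 (dv ee1 w) p + 2 * b p * dv ee1 (dv ee2 w) p
    + c p * dv ee2 (dv ee2 w) p) - κ * w p

namespace Coef
variable {δ : ℝ} {a b c : E3 → ℝ}
lemma a_lo (h : Coef δ a b c) (p) : δ ≤ a p := by have := h.lo p 1 0; simpa using this
lemma c_lo (h : Coef δ a b c) (p) : δ ≤ c p := by have := h.lo p 0 1; simpa using this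
lemma a_hi (h : Coef δ a b c) (p) : a p ≤ δ⁻¹ := by have := h.hi p 1 0; simpa using this
lemma c_hi (h : Coef δ a b c) (p) : c p ≤ δ⁻¹ := by have := h.hi p 0 1; simpa using this
lemma b_hi (hδ : 0 < δ) (h : Coef δ a b c) (p) : |b p| ≤ δ⁻¹ := by
  have h1 := h.hi p 1 1
  have h2 := h.hi p 1 (-1)
  have h3 := h.lo p 1 1
  have h4 := h.lo p 1 (-1)
  have := inv_pos.2 hδ
  rw [abs_le]
  constructor <;> nlinarith
lemma bma (hδ : 0 < δ) (h : Coef δ a b c) : BM a :=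
  ⟨h.ma, δ⁻¹, fun p => abs_le.2 ⟨by have := h.a_lo p; have := inv_pos.2 hδ; linarith, h.a_hi p⟩⟩
lemma bmc (hδ : 0 < δ) (h : Coef δ a b c) : BM c :=
  ⟨h.mc, δ⁻¹, fun p => abs_le.2 ⟨by have := h.c_lo p; have := inv_pos.2 hδ; linarith, h.c_hi p⟩⟩
lemma bmb (hδ : 0 < δ) (h : Coef δ a b c) : BM b := ⟨h.mb, δ⁻¹, fun p => h.b_hi hδ p⟩
/-- Cordes-type bound -/
lemma cordes (hδ : 0 < δ) (h : Coef δ a b c) (p) :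
    ((a p - c p) / 2) ^ 2 + b p ^ 2 ≤ ((1 - δ ^ 2) * ((a p + c p) / 2)) ^ 2 := by
  set A := (a p + c p) / 2
  have hA : A ≤ δ⁻¹ := by have := h.a_hi p; have := h.c_hi p; simp only [A]; linarith
  have hA' : δ ≤ A := by have := h.a_lo p; have := h.c_lo p; simp only [A]; linarith
  have h1 : ((a p - c p) / 2) ^ 2 + b p ^ 2 ≤ (A - δ) ^ 2 := by
    -- determinant of a - δ is nonneg
    have hq : ∀ x y : ℝ, 0 ≤ (a p - δ) * x ^ 2 + 2 * b p * x * y + (c p - δ) * y ^ 2 := by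
      intro x y; have := h.lo p x y; linarith
    have hdet : b p ^ 2 ≤ (a p - δ) * (c p - δ) := by
      have h1 := h.a_lo p
      have h2 := h.c_lo p
      rcases eq_or_lt_of_le h1 with h0 | h0
      · have hx := fun x => hq x 1
        simp only [← h0, sub_self, zero_mul, zero_add] at hx ⊢
        by_contra hb
        have hb0 : b p ≠ 0 := by intro hb0; simp [hb0] at hb
        have := hx (-(c p - δ + 1) / (2 * b p))
        have e : 2 * b p * (-(c p - δ + 1) / (2 * b p)) * 1 = -(c p - δ + 1) := by
          field_simp
        rw [e] at this; linarith
      · have := hq (-b p) (a p - δ)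
        have h3 : 0 ≤ (a p - δ) * ((a p - δ) * (c p - δ) - b p ^ 2) := by nlinarith
        have := nonneg_of_mul_nonneg_right h3 (by linarith)
        linarith
    simp only [A]; nlinarith
  refine h1.trans ?_
  have : δ ^ 2 * A ≤ δ := by
    calc δ ^ 2 * A ≤ δ ^ 2 * δ⁻¹ := by gcongr
      _ = δ := by field_simp
  apply pow_le_pow_left₀ (by linarith)
  linarith
end Coef

lemma hasLineDerivAt_const_along {f : E3 → ℝ} {v : E3} (h : ∀ (p : E3) (s : ℝ), f (p + s • v) = f p) (p : E3) :
    HasLineDerivAt ℝ f 0 p v := by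
  unfold HasLineDerivAt
  simp only [h]
  exact hasDerivAt_const _ _

lemma wt_mk {θ θ' : ℝ → ℝ} (hd : ∀ t, HasDerivAt θ (θ' t) t) (pos : ∀ t, 0 ≤ θ t)
    (le : ∀ t, θ t ≤ 1) (dle : ∀ t, θ' t ≤ 0) (cont : Continuous θ') (bdd : ∃ M, ∀ t, |θ' t| ≤ M) :
    Wt (fun p => θ p.1) (fun p => θ' p.1) where
  bm := by
    refine ⟨?_, 1, fun p => abs_le.2 ⟨by have := pos p.1; linarith, le p.1⟩⟩
    have : Continuous θ := continuous_iff_continuousAt.2 fun t => (hd t).continuousAt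
    exact this.measurable.comp measurable_fst
  bm' := ⟨cont.measurable.comp measurable_fst, bdd.imp fun M hM p => hM p.1⟩
  line0 := by
    intro p
    unfold HasLineDerivAt
    have h1 : HasDerivAt (fun s : ℝ => p.1 + s) 1 0 := by simpa using (hasDerivAt_id (0:ℝ)).const_add p.1
    have := HasDerivAt.comp (0 : ℝ) (by simpa using hd p.1) h1
    simpa [ee0, Function.comp_def] using this
  inv := by intro p v s hv; simp [hv]
  pos p := pos p.1
  le p := le p.1
  dle p := dle p.1

lemma wt_one : Wt (fun _ => 1) (fun _ => 0) :=
  wt_mk (fun t => hasDerivAt_const _ _) (fun _ => zero_le_one) (fun _ => le_rfl) (fun _ => le_rfl)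
    continuous_const ⟨0, by simp⟩

/-- null lagrangian in `x` -/
lemma null_x {m : E3 → ℝ} (hm : BM m) (hi : TInv m) {v : E3} (hv : v.1 = 0) {F : E3 → ℝ}
    (hF : Tst F) : ∫ p : E3, m p * dv v F p = 0 := by
  have := ibp (μ := (volume : Measure E3)) (c := m) (c' := fun _ => 0)
    (F := F) (F' := dv v F) (v := v) hm (by fun_prop) hF.bc (hF.dv v).bc
    (fun p => hasLineDerivAt_const_along (by intro p s; exact hi p v s hv) p)
    (fun p => hasLineDerivAt_dv hF.diff v p)
  simpa using this

lemma null_t {θ θ' : E3 → ℝ} (h : Wt θ θ') {F : E3 → ℝ}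
    (hF : Tst F) : ∫ p : E3, (θ p * dv ee0 F p + θ' p * F p) = 0 :=
  ibp (μ := (volume : Measure E3)) h.bm h.bm' hF.bc (hF.dv ee0).bc h.line0
    (fun p => hasLineDerivAt_dv hF.diff _ p)

def trt (a c : E3 → ℝ) : E3 → ℝ := fun p => (a p + c p) / 2

def N1 (δ : ℝ) : ℝ := 2 + (8 * δ⁻¹ ^ 2 + 1) * (δ⁻¹ ^ 6) + δ⁻¹ ^ 3

/-- the pointwise inequality behind the a priori estimate -/
lemma pointwise1 {δ a b c κ w wt w1 w2 w11 w12 w22 : ℝ} (hδ : 0 < δ) (hδ1 : δ ≤ 1) (hκ : 0 ≤ κ)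
    (ha : δ ≤ (a + c) / 2) (hcor : ((a - c) / 2) ^ 2 + b ^ 2 ≤ ((1 - δ ^ 2) * ((a + c) / 2)) ^ 2)
    (ha' : |a| ≤ δ⁻¹) (hb' : |b| ≤ δ⁻¹) (hc' : |c| ≤ δ⁻¹) :
    δ ^ 3 / 2 * (w11 + w22) ^ 2 + κ * (w1 ^ 2 + w2 ^ 2) ≤
      δ⁻¹ ^ 3 / 2 * (-wt + (a * w11 + 2 * b * w12 + c * w22) - κ * w) ^ 2
      + wt * (w11 + w22) - 2 * (1 - δ ^ 2) * ((a + c) / 2) * (w11 * w22 - w12 ^ 2)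
      + κ * (w * (w11 + w22) + (w1 ^ 2 + w2 ^ 2)) := by
  set A := (a + c) / 2 with hA
  set B := (a - c) / 2 with hB
  set f := (-wt + (a * w11 + 2 * b * w12 + c * w22) - κ * w) with hf
  set p := w11 + w22 with hp
  set q := w11 - w22 with hq
  have hε : 0 ≤ 1 - δ ^ 2 := by nlinarith
  -- a:W = A p + B q + 2 b w12
  have e1 : a * w11 + 2 * b * w12 + c * w22 = A * p + (B * q + 2 * b * w12) := by
    rw [hA, hB, hp, hq]; ring
  -- |B q + 2 b w12| |p| ≤ (1-δ²) A (p² - 2 det)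
  have e2 : -(B * q + 2 * b * w12) * p ≤ (1 - δ ^ 2) * A * (p ^ 2 / 2 + (q ^ 2 / 2 + 2 * w12 ^ 2)) := by
    have h1 : (B * q + 2 * b * w12) ^ 2 ≤ ((1 - δ ^ 2) * A) ^ 2 * (q ^ 2 + (2 * w12) ^ 2) := by
      have : (B * q + 2 * b * w12) ^ 2 ≤ (B ^ 2 + b ^ 2) * (q ^ 2 + (2 * w12) ^ 2) := by
        nlinarith [sq_nonneg (B * (2 * w12) - b * q)]
      refine this.trans ?_
      gcongr
    have hK : 0 ≤ (1 - δ ^ 2) * A := mul_nonneg hε (by linarith)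
    set K := (1 - δ ^ 2) * A
    set S := B * q + 2 * b * w12
    have h2 : (-S * p) ^ 2 ≤ (K * (p ^ 2 / 2 + (q ^ 2 / 2 + 2 * w12 ^ 2))) ^ 2 := by
      have : (-S * p) ^ 2 ≤ K ^ 2 * (q ^ 2 + (2 * w12) ^ 2) * p ^ 2 := by
        have := mul_le_mul_of_nonneg_right h1 (sq_nonneg p)
        calc (-S * p) ^ 2 = S ^ 2 * p ^ 2 := by ring
          _ ≤ _ := this
      refine this.trans ?_
      have h3 : (q ^ 2 + (2 * w12) ^ 2) * p ^ 2 ≤ (p ^ 2 / 2 + (q ^ 2 / 2 + 2 * w12 ^ 2)) ^ 2 := by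
        nlinarith [sq_nonneg (p ^ 2 - (q ^ 2 + (2 * w12) ^ 2))]
      calc _ = K ^ 2 * ((q ^ 2 + (2 * w12) ^ 2) * p ^ 2) := by ring
        _ ≤ K ^ 2 * (p ^ 2 / 2 + (q ^ 2 / 2 + 2 * w12 ^ 2)) ^ 2 := by gcongr
        _ = _ := by ring
    exact le_of_abs_le (abs_le_of_sq_le_sq h2 (by positivity))
  have e3 : q ^ 2 / 2 + 2 * w12 ^ 2 = p ^ 2 / 2 - 2 * (w11 * w22 - w12 ^ 2) := by
    rw [hp, hq]; ring
  have e4 : f * p = -wt * p + A * p ^ 2 + (B * q + 2 * b * w12) * p - κ * w * p := by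
    rw [hf, e1]; ring
  have e5 : f * p ≤ δ⁻¹ ^ 3 / 2 * f ^ 2 + δ ^ 3 / 2 * p ^ 2 := by
    have h1 : δ⁻¹ ^ 3 * δ ^ 3 = 1 := by field_simp
    have h2 : 0 < δ ^ 3 := by positivity
    have h3 : 0 ≤ δ⁻¹ ^ 3 * (f - δ ^ 3 * p) ^ 2 := by positivity
    have h4 : δ⁻¹ ^ 3 * (f - δ ^ 3 * p) ^ 2 = δ⁻¹ ^ 3 * f ^ 2 - 2 * (δ⁻¹ ^ 3 * δ ^ 3) * f * p
      + (δ⁻¹ ^ 3 * δ ^ 3) * δ ^ 3 * p ^ 2 := by ring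
    rw [h1] at h4
    linarith
  have e6 : δ ^ 3 * p ^ 2 ≤ δ ^ 2 * A * p ^ 2 := by
    have : δ ^ 3 = δ ^ 2 * δ := by ring
    rw [this]; gcongr
  rw [e3] at e2
  clear_value f p q A B
  clear hA hB hf hp hq e1 e3 hcor ha' hb' hc' hε
  linarith

lemma pointwise2 {δ a b c κ w wt w11 w12 w22 : ℝ} (hδ : 0 < δ)
    (ha' : |a| ≤ δ⁻¹) (hb' : |b| ≤ δ⁻¹) (hc' : |c| ≤ δ⁻¹) :
    wt ^ 2 + κ ^ 2 * w ^ 2 + κ * (2 * (wt * w)) ≤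
      2 * (-wt + (a * w11 + 2 * b * w12 + c * w22) - κ * w) ^ 2
      + 8 * δ⁻¹ ^ 2 * (w11 ^ 2 + 2 * w12 ^ 2 + w22 ^ 2) := by
  set f := (-wt + (a * w11 + 2 * b * w12 + c * w22) - κ * w) with hf
  set S := a * w11 + 2 * b * w12 + c * w22
  have h1 : wt ^ 2 + κ ^ 2 * w ^ 2 + κ * (2 * (wt * w)) = (S - f) ^ 2 := by rw [hf]; ring
  rw [h1]
  have h2 : S ^ 2 ≤ 4 * δ⁻¹ ^ 2 * (w11 ^ 2 + 2 * w12 ^ 2 + w22 ^ 2) := by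
    have ha2 : a ^ 2 ≤ δ⁻¹ ^ 2 := sq_le_sq' (by linarith [abs_le.1 ha']) (abs_le.1 ha').2
    have hb2 : b ^ 2 ≤ δ⁻¹ ^ 2 := sq_le_sq' (by linarith [abs_le.1 hb']) (abs_le.1 hb').2
    have hc2 : c ^ 2 ≤ δ⁻¹ ^ 2 := sq_le_sq' (by linarith [abs_le.1 hc']) (abs_le.1 hc').2
    have : S ^ 2 ≤ (a ^ 2 + 2 * b ^ 2 + c ^ 2) * (w11 ^ 2 + 2 * w12 ^ 2 + w22 ^ 2) := by
      simp only [S]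
      nlinarith [sq_nonneg (a * w12 - b * w11), sq_nonneg (a * w22 - c * w11),
        sq_nonneg (b * w22 - c * w12)]
    refine this.trans ?_
    have : a ^ 2 + 2 * b ^ 2 + c ^ 2 ≤ 4 * δ⁻¹ ^ 2 := by linarith
    gcongr
  nlinarith [sq_nonneg (S + f)]



lemma int_lin4 {V : Type*} [MeasurableSpace V] {μ : Measure V} {A B C D : V → ℝ} (a b c d : ℝ)
    (hA : Integrable A μ)
    (hB : Integrable B μ) (hC : Integrable C μ) (hD : Integrable D μ) :
    ∫ p, (a * A p + b * B p + c * C p + d * D p) ∂μ =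
      a * (∫ p, A p ∂μ) + b * (∫ p, B p ∂μ) + c * (∫ p, C p ∂μ) + d * (∫ p, D p ∂μ) := by
  have h1 : Integrable (fun p => a * A p) μ := hA.const_mul a
  have h2 : Integrable (fun p => b * B p) μ := hB.const_mul b
  have h3 : Integrable (fun p => c * C p) μ := hC.const_mul c
  have h4 : Integrable (fun p => d * D p) μ := hD.const_mul d
  have h12 : Integrable (fun p => a * A p + b * B p) μ := h1.add h2
  have h123 : Integrable (fun p => a * A p + b * B p + c * C p) μ := h12.add h3
  rw [integral_add h123 h4, integral_add h12 h3, integral_add h1 h2]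
  simp only [integral_const_mul]

lemma det_int {m : E3 → ℝ} (hm : BM m) (hi : TInv m) {w : E3 → ℝ} (hw : Tst w) :
    ∫ p : E3, m p * (dv ee1 (dv ee1 w) p * dv ee2 (dv ee2 w) p - dv ee1 (dv ee2 w) p ^ 2) = 0 := by
  have h1 := null_x hm hi (v := ee1) rfl ((hw.dv ee1).mul ((hw.dv ee2).dv ee2))
  have h2 := null_x hm hi (v := ee2) rfl ((hw.dv ee1).mul ((hw.dv ee2).dv ee1))
  have b1 := (((hw.dv ee1).mul ((hw.dv ee2).dv ee2)).dv ee1).bc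
  have b2 := (((hw.dv ee1).mul ((hw.dv ee2).dv ee1)).dv ee2).bc
  have h3 : ∫ p : E3, (m p * dv ee1 (fun p => dv ee1 w p * dv ee2 (dv ee2 w) p) p
      - m p * dv ee2 (fun p => dv ee1 w p * dv ee1 (dv ee2 w) p) p) = 0 := by
    rw [integral_sub (BC.int (by fun_prop)) (BC.int (by fun_prop)), h1, h2, sub_zero]
  rw [← h3]
  congr 1
  funext p
  rw [dv_mul (hw.dv _).diff ((hw.dv _).dv _).diff, dv_mul (hw.dv _).diff ((hw.dv _).dv _).diff,
    dv_comm hw.1 ee2 ee1, dv_comm (hw.dv ee2).1 ee2 ee1]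
  ring

lemma green_int {m : E3 → ℝ} (hm : BM m) (hi : TInv m) {w : E3 → ℝ} (hw : Tst w) :
    ∫ p : E3, m p * (w p * (dv ee1 (dv ee1 w) p + dv ee2 (dv ee2 w) p)
      + (dv ee1 w p ^ 2 + dv ee2 w p ^ 2)) = 0 := by
  have h1 := null_x hm hi (v := ee1) rfl (hw.mul (hw.dv ee1))
  have h2 := null_x hm hi (v := ee2) rfl (hw.mul (hw.dv ee2))
  have b1 := ((hw.mul (hw.dv ee1)).dv ee1).bc
  have b2 := ((hw.mul (hw.dv ee2)).dv ee2).bc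
  have h3 : ∫ p : E3, (m p * dv ee1 (fun p => w p * dv ee1 w p) p
      + m p * dv ee2 (fun p => w p * dv ee2 w p) p) = 0 := by
    rw [integral_add (BC.int (by fun_prop)) (BC.int (by fun_prop)), h1, h2, add_zero]
  rw [← h3]
  congr 1
  funext p
  rw [dv_mul hw.diff (hw.dv _).diff, dv_mul hw.diff (hw.dv _).diff]
  ring

lemma time1_int {θ θ' : E3 → ℝ} (h : Wt θ θ') {w : E3 → ℝ} (hw : Tst w) :
    0 ≤ ∫ p : E3, θ p * (2 * (dv ee0 w p * w p)) := by
  have h1 := null_t h (hw.mul hw)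
  have b1 := ((hw.mul hw).dv ee0).bc
  have b2 := (hw.mul hw).bc
  have m1 := h.bm
  have m2 := h.bm'
  rw [integral_add (BC.int (by fun_prop)) (BC.int (by fun_prop))] at h1
  have h2 : ∫ p : E3, θ' p * (w p * w p) ≤ 0 :=
    integral_nonpos fun p => mul_nonpos_of_nonpos_of_nonneg (h.dle _) (mul_self_nonneg _)
  have h3 : ∫ p : E3, θ p * (2 * (dv ee0 w p * w p)) =
      ∫ p : E3, θ p * dv ee0 (fun p => w p * w p) p := by
    congr 1; funext p
    rw [dv_mul hw.diff hw.diff]; ring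
  linarith

lemma time2_int {θ θ' : E3 → ℝ} (h : Wt θ θ') {w : E3 → ℝ} (hw : Tst w) :
    ∫ p : E3, θ p * (dv ee0 w p * (dv ee1 (dv ee1 w) p + dv ee2 (dv ee2 w) p)) ≤ 0 := by
  have h0 := time1_int h (hw.dv ee1)
  have h0' := time1_int h (hw.dv ee2)
  have h1 := null_x h.bm h.inv (v := ee1) rfl ((hw.dv ee0).mul (hw.dv ee1))
  have h2 := null_x h.bm h.inv (v := ee2) rfl ((hw.dv ee0).mul (hw.dv ee2))
  have b1 := (((hw.dv ee0).mul (hw.dv ee1)).dv ee1).bc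
  have b2 := (((hw.dv ee0).mul (hw.dv ee2)).dv ee2).bc
  have b3 := ((hw.dv ee1).dv ee0).bc
  have b4 := ((hw.dv ee2).dv ee0).bc
  have b5 := (hw.dv ee1).bc
  have b6 := (hw.dv ee2).bc
  have b3' := b3.bm
  have b4' := b4.bm
  have m1 := h.bm
  have h3 := int_lin4 (μ := volume) (A := fun p : E3 => θ p * dv ee1 (fun p => dv ee0 w p * dv ee1 w p) p)
    (B := fun p : E3 => θ p * dv ee2 (fun p => dv ee0 w p * dv ee2 w p) p)
    (C := fun p : E3 => θ p * (2 * (dv ee0 (dv ee1 w) p * dv ee1 w p)))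
    (D := fun p : E3 => θ p * (2 * (dv ee0 (dv ee2 w) p * dv ee2 w p))) 1 1 (-1/2) (-1/2)
    (BC.int (by fun_prop)) (BC.int (by fun_prop)) (BC.int (by fun_prop)) (BC.int (by fun_prop))
  rw [h1, h2] at h3
  have h4 : ∫ p : E3, θ p * (dv ee0 w p * (dv ee1 (dv ee1 w) p + dv ee2 (dv ee2 w) p)) =
    ∫ p : E3, (1 * (θ p * dv ee1 (fun p => dv ee0 w p * dv ee1 w p) p)
    + 1 * (θ p * dv ee2 (fun p => dv ee0 w p * dv ee2 w p) p)
    + (-1/2) * (θ p * (2 * (dv ee0 (dv ee1 w) p * dv ee1 w p)))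
    + (-1/2) * (θ p * (2 * (dv ee0 (dv ee2 w) p * dv ee2 w p)))) := by
    congr 1; funext p
    rw [dv_mul (hw.dv _).diff (hw.dv _).diff, dv_mul (hw.dv _).diff (hw.dv _).diff,
      dv_comm hw.1 ee1 ee0, dv_comm hw.1 ee2 ee0]
    ring
  rw [h4, h3]
  linarith

def Jq (κ : ℝ) (w : E3 → ℝ) : E3 → ℝ := fun p =>
  dv ee0 w p ^ 2 + κ ^ 2 * w p ^ 2 + κ * (dv ee1 w p ^ 2 + dv ee2 w p ^ 2)
    + (dv ee1 (dv ee1 w) p ^ 2 + 2 * dv ee1 (dv ee2 w) p ^ 2 + dv ee2 (dv ee2 w) p ^ 2)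

lemma bc_Pop {δ : ℝ} {a b c : E3 → ℝ} (hδ : 0 < δ) (hA : Coef δ a b c) (κ : ℝ)
    {w : E3 → ℝ} (hw : Tst w) : BC (Pop a b c κ w) := by
  have m1 := hA.bma hδ
  have m2 := hA.bmb hδ
  have m3 := hA.bmc hδ
  have b1 := hw.bc
  have b2 := (hw.dv ee0).bc
  have b3 := ((hw.dv ee1).dv ee1).bc
  have b4 := ((hw.dv ee2).dv ee1).bc
  have b5 := ((hw.dv ee2).dv ee2).bc
  unfold Pop
  fun_prop

theorem apriori {δ : ℝ} {a b c : E3 → ℝ} {θ θ' : E3 → ℝ} (hδ : 0 < δ) (hδ1 : δ ≤ 1)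
    (hA : Coef δ a b c) (h : Wt θ θ') {κ : ℝ} (hκ : 0 ≤ κ) {w : E3 → ℝ} (hw : Tst w) :
    ∫ p : E3, θ p * Jq κ w p ≤ N1 δ * ∫ p : E3, θ p * Pop a b c κ w p ^ 2 := by
  have m1 := h.bm
  have m2 := hA.bma hδ
  have m3 := hA.bmb hδ
  have m4 := hA.bmc hδ
  have c1 := hw.bc
  have c2 := (hw.dv ee0).bc
  have c3 := ((hw.dv ee1).dv ee1).bc
  have c4 := ((hw.dv ee2).dv ee1).bc
  have c5 := ((hw.dv ee2).dv ee2).bc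
  have c6 := (hw.dv ee1).bc
  have c7 := (hw.dv ee2).bc
  have d1 := c1.bm
  have d2 := c2.bm
  have d3 := c3.bm
  have d5 := c5.bm
  have cP := bc_Pop hδ hA κ hw
  have htr : ∀ p : E3, (a p + c p) / 2 = trt a c p := fun p => rfl
  have m5 : BM (trt a c) := by
    have : trt a c = fun p => (a p + c p) * (1/2) := by
      funext p; rw [← htr]; ring
    rw [this]; fun_prop
  have hti : TInv (trt a c) := by
    intro p v s hv
    have hp : ∀ p : E3, trt a c p = (a (p.1, 0, 0) + c (p.1, 0, 0)) / 2 := fun p => by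
      simp only [trt]; rw [show p = (p.1, p.2.1, p.2.2) from rfl, hA.tr p.1 p.2.1 p.2.2 0 0]
    rw [hp, hp p]; simp [hv]
  have hdet := det_int (m := fun p => θ p * trt a c p) (by fun_prop)
    (by intro p v s hv; simp only [h.inv p v s hv, hti p v s hv]) hw
  have hdet2 := det_int (m := θ) h.bm h.inv hw
  have hgr := green_int h.bm h.inv hw
  have ht1 := time1_int h hw
  have ht2 := time2_int h hw
  -- names
  set X := ∫ p : E3, θ p * (dv ee1 (dv ee1 w) p + dv ee2 (dv ee2 w) p) ^ 2 with hX
  set Dd := ∫ p : E3, θ p * (dv ee1 w p ^ 2 + dv ee2 w p ^ 2) with hDd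
  set W := ∫ p : E3, θ p * (dv ee1 (dv ee1 w) p ^ 2 + 2 * dv ee1 (dv ee2 w) p ^ 2
    + dv ee2 (dv ee2 w) p ^ 2) with hW
  set F := ∫ p : E3, θ p * Pop a b c κ w p ^ 2 with hF
  set S := ∫ p : E3, θ p * (dv ee0 w p ^ 2 + κ ^ 2 * w p ^ 2) with hS
  have hF0 : 0 ≤ F := integral_nonneg fun p => mul_nonneg (h.pos _) (sq_nonneg _)
  have hX0 : 0 ≤ X := integral_nonneg fun p => mul_nonneg (h.pos _) (sq_nonneg _)
  have hD0 : 0 ≤ Dd := integral_nonneg fun p => mul_nonneg (h.pos _) (by positivity)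
  have eW : W = X := by
    have := int_lin4 (μ := volume) (A := fun p : E3 => θ p * (dv ee1 (dv ee1 w) p + dv ee2 (dv ee2 w) p) ^ 2)
      (B := fun p : E3 => θ p * (dv ee1 (dv ee1 w) p * dv ee2 (dv ee2 w) p - dv ee1 (dv ee2 w) p ^ 2))
      (C := fun _ => 0) (D := fun _ => 0) 1 (-2) 0 0 (BC.int (by fun_prop)) (BC.int (by fun_prop))
      (by simp) (by simp)
    rw [hdet2] at this
    simp only [mul_zero, integral_zero, add_zero, one_mul] at this
    rw [hX, ← this, hW]
    congr 1; funext p; ring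
  have eJ : ∫ p : E3, θ p * Jq κ w p = S + κ * Dd + W := by
    have := int_lin4 (μ := volume) (A := fun p : E3 => θ p * (dv ee0 w p ^ 2 + κ ^ 2 * w p ^ 2))
      (B := fun p : E3 => θ p * (dv ee1 w p ^ 2 + dv ee2 w p ^ 2))
      (C := fun p : E3 => θ p * (dv ee1 (dv ee1 w) p ^ 2 + 2 * dv ee1 (dv ee2 w) p ^ 2
        + dv ee2 (dv ee2 w) p ^ 2)) (D := fun _ => 0) 1 κ 1 0 (BC.int (by fun_prop))
      (BC.int (by fun_prop)) (BC.int (by fun_prop)) (by simp)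
    simp only [mul_zero, integral_zero, add_zero, one_mul] at this
    rw [← this]
    congr 1; funext p; simp only [Jq]; ring
  have i1 : δ ^ 3 / 2 * X + κ * Dd ≤ δ⁻¹ ^ 3 / 2 * F := by
    have l1 := int_lin4 (μ := volume) (A := fun p : E3 => θ p * (dv ee1 (dv ee1 w) p + dv ee2 (dv ee2 w) p) ^ 2)
      (B := fun p : E3 => θ p * (dv ee1 w p ^ 2 + dv ee2 w p ^ 2)) (C := fun _ => 0)
      (D := fun _ => 0) (δ ^ 3 / 2) κ 0 0 (BC.int (by fun_prop)) (BC.int (by fun_prop))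
      (by simp) (by simp)
    have l2 := int_lin4 (μ := volume) (A := fun p : E3 => θ p * Pop a b c κ w p ^ 2)
      (B := fun p : E3 => θ p * (dv ee0 w p * (dv ee1 (dv ee1 w) p + dv ee2 (dv ee2 w) p)))
      (C := fun p : E3 => (θ p * trt a c p) *
        (dv ee1 (dv ee1 w) p * dv ee2 (dv ee2 w) p - dv ee1 (dv ee2 w) p ^ 2))
      (D := fun p : E3 => θ p * (w p * (dv ee1 (dv ee1 w) p + dv ee2 (dv ee2 w) p)
      + (dv ee1 w p ^ 2 + dv ee2 w p ^ 2))) (δ⁻¹ ^ 3 / 2) 1 (-2 * (1 - δ ^ 2)) κ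
      (BC.int (by fun_prop)) (BC.int (by fun_prop)) (BC.int (by fun_prop)) (BC.int (by fun_prop))
    rw [hdet, hgr] at l2
    have := integral_mono (μ := volume) (BC.int (by fun_prop)) (BC.int (by fun_prop))
      (show (fun p : E3 => δ ^ 3 / 2 * (θ p * (dv ee1 (dv ee1 w) p + dv ee2 (dv ee2 w) p) ^ 2)
        + κ * (θ p * (dv ee1 w p ^ 2 + dv ee2 w p ^ 2)) + 0 * 0 + 0 * 0) ≤
        fun p : E3 => δ⁻¹ ^ 3 / 2 * (θ p * Pop a b c κ w p ^ 2)
        + 1 * (θ p * (dv ee0 w p * (dv ee1 (dv ee1 w) p + dv ee2 (dv ee2 w) p)))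
        + (-2 * (1 - δ ^ 2)) * ((θ p * trt a c p) *
        (dv ee1 (dv ee1 w) p * dv ee2 (dv ee2 w) p - dv ee1 (dv ee2 w) p ^ 2))
        + κ * (θ p * (w p * (dv ee1 (dv ee1 w) p + dv ee2 (dv ee2 w) p)
        + (dv ee1 w p ^ 2 + dv ee2 w p ^ 2))) from ?_)
    · rw [l1, l2] at this
      simp only [integral_zero, mul_zero, add_zero] at this
      linarith
    · intro p
      have := mul_le_mul_of_nonneg_left (pointwise1 (δ := δ) (a := a p) (b := b p) (c := c p)
        (κ := κ) (w := w p)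
        (wt := dv ee0 w p) (w1 := dv ee1 w p) (w2 := dv ee2 w p) (w11 := dv ee1 (dv ee1 w) p)
        (w12 := dv ee1 (dv ee2 w) p) (w22 := dv ee2 (dv ee2 w) p) hδ hδ1 hκ
        (by have := hA.a_lo p; have := hA.c_lo p; linarith) (hA.cordes hδ p)
        (abs_le.2 ⟨by have := hA.a_lo p; have := inv_pos.2 hδ; linarith, hA.a_hi p⟩) (hA.b_hi hδ p)
        (abs_le.2 ⟨by have := hA.c_lo p; have := inv_pos.2 hδ; linarith, hA.c_hi p⟩)) (h.pos p)
      rw [htr] at this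
      simp only [Pop]
      linarith
  have i2 : S ≤ 2 * F + 8 * δ⁻¹ ^ 2 * W := by
    have l1 := int_lin4 (μ := volume) (A := fun p : E3 => θ p * (dv ee0 w p ^ 2 + κ ^ 2 * w p ^ 2))
      (B := fun p : E3 => θ p * (2 * (dv ee0 w p * w p))) (C := fun _ => 0)
      (D := fun _ => 0) 1 κ 0 0 (BC.int (by fun_prop)) (BC.int (by fun_prop))
      (by simp) (by simp)
    have l2 := int_lin4 (μ := volume) (A := fun p : E3 => θ p * Pop a b c κ w p ^ 2)
      (B := fun p : E3 => θ p * (dv ee1 (dv ee1 w) p ^ 2 + 2 * dv ee1 (dv ee2 w) p ^ 2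
        + dv ee2 (dv ee2 w) p ^ 2)) (C := fun _ => 0)
      (D := fun _ => 0) 2 (8 * δ⁻¹ ^ 2) 0 0 (BC.int (by fun_prop)) (BC.int (by fun_prop))
      (by simp) (by simp)
    have := integral_mono (μ := volume) (BC.int (by fun_prop)) (BC.int (by fun_prop))
      (show (fun p : E3 => 1 * (θ p * (dv ee0 w p ^ 2 + κ ^ 2 * w p ^ 2))
        + κ * (θ p * (2 * (dv ee0 w p * w p))) + 0 * 0 + 0 * 0) ≤
        fun p : E3 => 2 * (θ p * Pop a b c κ w p ^ 2) + 8 * δ⁻¹ ^ 2 *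
        (θ p * (dv ee1 (dv ee1 w) p ^ 2 + 2 * dv ee1 (dv ee2 w) p ^ 2
        + dv ee2 (dv ee2 w) p ^ 2)) + 0 * 0 + 0 * 0 from ?_)
    · rw [l1, l2] at this
      simp only [integral_zero, mul_zero, add_zero] at this
      have := mul_nonneg hκ ht1
      linarith
    · intro p
      have := mul_le_mul_of_nonneg_left (pointwise2 (δ := δ) (a := a p) (b := b p) (c := c p)
        (κ := κ) (w := w p)
        (wt := dv ee0 w p) (w11 := dv ee1 (dv ee1 w) p)
        (w12 := dv ee1 (dv ee2 w) p) (w22 := dv ee2 (dv ee2 w) p) hδ 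
        (abs_le.2 ⟨by have := hA.a_lo p; have := inv_pos.2 hδ; linarith, hA.a_hi p⟩) (hA.b_hi hδ p)
        (abs_le.2 ⟨by have := hA.c_lo p; have := inv_pos.2 hδ; linarith, hA.c_hi p⟩)) (h.pos p)
      simp only [Pop]
      linarith
  have i3 : X ≤ δ⁻¹ ^ 6 * F := by
    have h1 : δ ^ 3 / 2 * X ≤ δ⁻¹ ^ 3 / 2 * F := by have := mul_nonneg hκ hD0; linarith
    have h2 := mul_le_mul_of_nonneg_left h1 (show 0 ≤ 2 * δ⁻¹ ^ 3 by positivity)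
    have e1 : 2 * δ⁻¹ ^ 3 * (δ ^ 3 / 2 * X) = X := by field_simp
    have e2 : 2 * δ⁻¹ ^ 3 * (δ⁻¹ ^ 3 / 2 * F) = δ⁻¹ ^ 6 * F := by ring
    linarith
  have i4 : κ * Dd ≤ δ⁻¹ ^ 3 * F := by
    have : 0 ≤ δ ^ 3 / 2 * X := by positivity
    have : 0 ≤ δ⁻¹ ^ 3 / 2 * F := by positivity
    linarith
  rw [eJ, eW]
  rw [eW] at i2
  have i5 := mul_le_mul_of_nonneg_left i3 (show 0 ≤ 8 * δ⁻¹ ^ 2 + 1 by positivity)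
  simp only [N1]
  linarith



def ph (ε s : ℝ) : ℝ := (max s 0) ^ 2 / (max s 0 + ε)
def ph' (ε s : ℝ) : ℝ := ((max s 0) ^ 2 + 2 * (max s 0) * ε) / (max s 0 + ε) ^ 2

lemma ph_cont {ε : ℝ} (hε : 0 < ε) : Continuous (ph ε) := by
  unfold ph
  refine Continuous.div (by fun_prop) (by fun_prop) fun s => ?_
  have := le_max_right s 0
  positivity
lemma ph'_cont {ε : ℝ} (hε : 0 < ε) : Continuous (ph' ε) := by
  unfold ph'
  refine Continuous.div (by fun_prop) (by fun_prop) fun s => ?_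
  have := le_max_right s 0
  positivity
lemma ph_deriv {ε : ℝ} (hε : 0 < ε) (s : ℝ) : HasDerivAt (ph ε) (ph' ε s) s := by
  rcases lt_trichotomy s 0 with h | h | h
  · have : ph' ε s = 0 := by simp [ph', max_eq_right h.le]
    rw [this]
    refine (hasDerivAt_const s (0 : ℝ)).congr_of_eventuallyEq ?_
    filter_upwards [gt_mem_nhds h] with x hx
    simp [ph, max_eq_right hx.le]
  · subst h
    have : ph' ε 0 = 0 := by simp [ph']
    rw [this]
    have h0 : ph ε 0 = 0 := by simp [ph]
    rw [hasDerivAt_iff_isLittleO]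
    simp only [h0, sub_zero, smul_eq_mul, mul_zero]
    have h1 : (fun x : ℝ => ph ε x) =O[nhds 0] fun x => x ^ 2 := by
      refine Asymptotics.IsBigO.of_bound (1 / ε) (Eventually.of_forall fun x => ?_)
      have h2 := le_max_right x 0
      have h3 : (max x 0) ^ 2 ≤ x ^ 2 := by
        rcases le_total x 0 with h | h
        · rw [max_eq_right h]; nlinarith [sq_nonneg x]
        · rw [max_eq_left h]
      rw [Real.norm_of_nonneg (r := ph ε x) (by unfold ph; positivity), Real.norm_of_nonneg (r := x ^ 2) (by positivity), ph,
        div_le_iff₀ (by positivity)]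
      have : 1 / ε * x ^ 2 * (max x 0 + ε) = x ^ 2 + x ^ 2 * max x 0 / ε := by field_simp; ring
      rw [this]
      have : 0 ≤ x ^ 2 * max x 0 / ε := by positivity
      linarith
    refine h1.trans_isLittleO ?_
    have := Asymptotics.isLittleO_pow_id (𝕜 := ℝ) (n := 2) (by norm_num)
    simpa using this
  · have h1 : HasDerivAt (fun x : ℝ => x ^ 2 / (x + ε)) ((2 * s * (s + ε) - s ^ 2 * 1) / (s + ε) ^ 2) s := by
      have := (hasDerivAt_pow 2 s).div ((hasDerivAt_id s).add_const ε) (by simp; positivity)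
      simpa [Pi.div_def] using this
    have h2 : ph' ε s = (2 * s * (s + ε) - s ^ 2 * 1) / (s + ε) ^ 2 := by
      simp only [ph', max_eq_left h.le]; ring
    rw [h2]
    refine h1.congr_of_eventuallyEq ?_
    filter_upwards [lt_mem_nhds h] with x hx
    simp [ph, max_eq_left hx.le]

lemma ph_nn {ε : ℝ} (hε : 0 < ε) (s : ℝ) : 0 ≤ ph ε s := by
  have := le_max_right s 0
  unfold ph; positivity
lemma ph'_nn {ε : ℝ} (hε : 0 < ε) (s : ℝ) : 0 ≤ ph' ε s := by
  have := le_max_right s 0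
  unfold ph'; positivity
lemma ph_le {ε : ℝ} (hε : 0 < ε) (s : ℝ) : ph ε s ≤ max s 0 := by
  have := le_max_right s 0
  unfold ph; rw [div_le_iff₀ (by positivity)]; nlinarith
lemma s_ph {ε : ℝ} (s : ℝ) : s * ph ε s = max s 0 * ph ε s := by
  rcases le_total s 0 with h | h
  · simp [ph, max_eq_right h]
  · rw [max_eq_left h]
lemma ph_sq {ε : ℝ} (hε : 0 < ε) (s : ℝ) : ph ε s ^ 2 ≤ s * ph ε s := by
  rw [s_ph, pow_two]; exact mul_le_mul_of_nonneg_right (ph_le hε s) (ph_nn hε s)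
lemma ph_sq' {ε : ℝ} (hε : 0 < ε) (s : ℝ) : ph ε s ^ 2 ≤ ph' ε s * (s * ph ε s) := by
  rw [s_ph]
  have := le_max_right s 0
  unfold ph ph'
  set r := max s 0
  have e : (r ^ 2 + 2 * r * ε) / (r + ε) ^ 2 * (r * (r ^ 2 / (r + ε))) - (r ^ 2 / (r + ε)) ^ 2
    = r ^ 4 * ε / (r + ε) ^ 3 := by field_simp; ring
  have : 0 ≤ r ^ 4 * ε / (r + ε) ^ 3 := by positivity
  linarith

structure SCoef (δ C : ℝ) (a b c a1 b1 b2 c2 : E3 → ℝ) : Prop extends Coef δ a b c where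
  ma1 : BM a1
  mb1 : BM b1
  mb2 : BM b2
  mc2 : BM c2
  la1 : ∀ p, HasLineDerivAt ℝ a (a1 p) p ee1
  lb1 : ∀ p, HasLineDerivAt ℝ b (b1 p) p ee1
  lb2 : ∀ p, HasLineDerivAt ℝ b (b2 p) p ee2
  lc2 : ∀ p, HasLineDerivAt ℝ c (c2 p) p ee2
  hC1 : ∀ p, |a1 p + b2 p| ≤ C
  hC2 : ∀ p, |b1 p + c2 p| ≤ C

lemma amgm_aux {δ C φ φ' ψ A y : ℝ} (hδ : 0 < δ) (hA : |A| ≤ C) (hφ' : 0 ≤ φ') (hψ : 0 ≤ ψ)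
    (h : φ ^ 2 ≤ φ' * ψ) : -(φ * (A * y)) ≤ δ * (φ' * y ^ 2) + C ^ 2 / (4 * δ) * ψ := by
  have h1 : A ^ 2 ≤ C ^ 2 := sq_le_sq' (by linarith [abs_le.1 hA]) (abs_le.1 hA).2
  refine le_of_abs_le (abs_le_of_sq_le_sq ?_ (by positivity))
  have e : (δ * (φ' * y ^ 2) + C ^ 2 / (4 * δ) * ψ) ^ 2 =
    (δ * (φ' * y ^ 2) - C ^ 2 / (4 * δ) * ψ) ^ 2 + (φ' * ψ) * (C ^ 2) * y ^ 2 := by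
    field_simp; ring
  have : (-(φ * (A * y))) ^ 2 ≤ (φ' * ψ) * (C ^ 2) * y ^ 2 := by
    calc (-(φ * (A * y))) ^ 2 = φ ^ 2 * A ^ 2 * y ^ 2 := by ring
      _ ≤ _ := by gcongr
  rw [e]
  have := sq_nonneg (δ * (φ' * y ^ 2) - C ^ 2 / (4 * δ) * ψ)
  linarith

theorem maxp_eps {δ C K ε : ℝ} {a b c a1 b1 b2 c2 : E3 → ℝ} (hδ : 0 < δ)
    (hA : SCoef δ C a b c a1 b1 b2 c2) (hK : C ^ 2 / (2 * δ) + 1 ≤ K) (hε : 0 < ε)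
    {y e : E3 → ℝ} (hy : Tst y) (he : BC e) (hP : ∀ p, - e p ≤ Pop a b c K y p) :
    ∫ p, y p * ph ε (y p) ≤ ∫ p, e p ^ 2 := by
  have ma := hA.bma hδ
  have mb := hA.bmb hδ
  have mc := hA.bmc hδ
  have ma1 := hA.ma1
  have mb1 := hA.mb1
  have mb2 := hA.mb2
  have mc2 := hA.mc2
  have cy := hy.bc
  have cy0 := (hy.dv ee0).bc
  have cy1 := (hy.dv ee1).bc
  have cy2 := (hy.dv ee2).bc
  have my1 := cy1.bm
  have my2 := cy2.bm
  have cy11 := ((hy.dv ee1).dv ee1).bc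
  have cy12 := ((hy.dv ee2).dv ee1).bc
  have cy22 := ((hy.dv ee2).dv ee2).bc
  have hld : ∀ v p, HasLineDerivAt ℝ (fun p => ph ε (y p)) (ph' ε (y p) * dv v y p) p v := by
    intro v p
    have h1 := hasLineDerivAt_dv hy.diff v p
    unfold HasLineDerivAt at h1 ⊢
    have h2 : HasDerivAt (ph ε) (ph' ε (y p)) (y (p + (0 : ℝ) • v)) := by
      simpa using ph_deriv hε (y p)
    exact h2.comp (0 : ℝ) h1
  obtain ⟨f, hf⟩ : ∃ f : E3 → ℝ, f = fun p => ph ε (y p) := ⟨_, rfl⟩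
  obtain ⟨f', hf'⟩ : ∃ f' : E3 → ℝ, f' = fun p => ph' ε (y p) := ⟨_, rfl⟩
  have cf : BC f := by
    rw [hf]; exact BC.of_cont ((ph_cont hε).comp hy.cont) (hy.2.comp_left (g := ph ε) (by simp [ph]))
  have cf' : BC f' := by
    rw [hf']; exact BC.of_cont ((ph'_cont hε).comp hy.cont) (hy.2.comp_left (g := ph' ε) (by simp [ph']))
  have mf := cf.bm
  have mf' := cf'.bm
  have hld' : ∀ v p, HasLineDerivAt ℝ f (f' p * dv v y p) p v := by
    intro v p; rw [hf, hf']; exact hld v p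
  have hpr : ∀ v v' p, HasLineDerivAt ℝ (fun p => f p * dv v' y p)
      (f' p * dv v y p * dv v' y p + f p * dv v (dv v' y) p) p v := by
    intro v v' p
    have h1 := hld' v p
    have h2 := hasLineDerivAt_dv (hy.dv v').diff v p
    unfold HasLineDerivAt at h1 h2 ⊢
    have := h1.fun_mul h2
    simpa using this
  have i1 := ibp (μ := (volume : Measure E3)) (c := a) (c' := a1) (v := ee1) ma ma1
    (by fun_prop) (by fun_prop) hA.la1 (hpr ee1 ee1)
  have i2 := ibp (μ := (volume : Measure E3)) (c := b) (c' := b1) (v := ee1) mb mb1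
    (by fun_prop) (by fun_prop) hA.lb1 (hpr ee1 ee2)
  have i3 := ibp (μ := (volume : Measure E3)) (c := b) (c' := b2) (v := ee2) mb mb2
    (by fun_prop) (by rw [dv_comm hy.1 ee2 ee1]; fun_prop) hA.lb2 (hpr ee2 ee1)
  have i4 := ibp (μ := (volume : Measure E3)) (c := c) (c' := c2) (v := ee2) mc mc2
    (by fun_prop) (by fun_prop) hA.lc2 (hpr ee2 ee2)
  have i5 : ∫ p, f p * dv ee0 y p = 0 := by
    have hΦ : ∀ x, HasDerivAt (fun s => ∫ r in (0 : ℝ)..s, ph ε r) (ph ε x) x := fun x =>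
      intervalIntegral.integral_hasDerivAt_right ((ph_cont hε).intervalIntegrable _ _)
        ((ph_cont hε).stronglyMeasurableAtFilter _ _) (ph_cont hε).continuousAt
    obtain ⟨Φ, hΦ0, hΦ⟩ : ∃ Φ : ℝ → ℝ, Φ 0 = 0 ∧ ∀ x, HasDerivAt Φ (ph ε x) x :=
      ⟨_, by simp, hΦ⟩
    have hcΦ : Continuous Φ := continuous_iff_continuousAt.2 fun x => (hΦ x).continuousAt
    have cF : BC (fun p => Φ (y p)) := BC.of_cont (hcΦ.comp hy.cont) (hy.2.comp_left (g := Φ) hΦ0)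
    have hl : ∀ p, HasLineDerivAt ℝ (fun p => Φ (y p)) (f p * dv ee0 y p) p ee0 := by
      intro p
      rw [hf]
      have h1 := hasLineDerivAt_dv hy.diff ee0 p
      unfold HasLineDerivAt at h1 ⊢
      have h2 : HasDerivAt Φ (ph ε (y p)) (y (p + (0 : ℝ) • ee0)) := by
        simpa using hΦ (y p)
      exact h2.comp (0 : ℝ) h1
    have := ibp (μ := (volume : Measure E3)) (c := fun _ => 1) (c' := fun _ => 0) (v := ee0)
      (by fun_prop) (by fun_prop) cF (by fun_prop) 
      (fun p => hasLineDerivAt_const_along (by intro p s; rfl) p) hl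
    simpa using this
  have l1 := int_lin4 (μ := (volume : Measure E3)) 1 1 1 1 (BC.int (by fun_prop) : Integrable (fun p => a p * (f' p * dv ee1 y p * dv ee1 y p + f p * dv ee1 (dv ee1 y) p) + a1 p * (f p * dv ee1 y p)) volume)
    (BC.int (by fun_prop) : Integrable (fun p => b p * (f' p * dv ee1 y p * dv ee2 y p + f p * dv ee1 (dv ee2 y) p) + b1 p * (f p * dv ee2 y p)) volume)
    (BC.int (by rw [dv_comm hy.1 ee2 ee1]; fun_prop) : Integrable (fun p => b p * (f' p * dv ee2 y p * dv ee1 y p + f p * dv ee2 (dv ee1 y) p) + b2 p * (f p * dv ee1 y p)) volume)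
    (BC.int (by fun_prop) : Integrable (fun p => c p * (f' p * dv ee2 y p * dv ee2 y p + f p * dv ee2 (dv ee2 y) p) + c2 p * (f p * dv ee2 y p)) volume)
  rw [i1, i2, i3, i4] at l1
  obtain ⟨S, hS⟩ : ∃ S : E3 → ℝ, S = fun p => 1 * (a p * (f' p * dv ee1 y p * dv ee1 y p + f p * dv ee1 (dv ee1 y) p) + a1 p * (f p * dv ee1 y p))
    + 1 * (b p * (f' p * dv ee1 y p * dv ee2 y p + f p * dv ee1 (dv ee2 y) p) + b1 p * (f p * dv ee2 y p))
    + 1 * (b p * (f' p * dv ee2 y p * dv ee1 y p + f p * dv ee2 (dv ee1 y) p) + b2 p * (f p * dv ee1 y p))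
    + 1 * (c p * (f' p * dv ee2 y p * dv ee2 y p + f p * dv ee2 (dv ee2 y) p) + c2 p * (f p * dv ee2 y p)) := ⟨_, rfl⟩
  have cS : BC S := by rw [hS, dv_comm hy.1 ee2 ee1]; fun_prop
  have iS : ∫ p, S p = 0 := by rw [hS]; simpa using l1
  have l2 := int_lin4 (μ := (volume : Measure E3)) 1 (-2) 2 0 (BC.int (by fun_prop) : Integrable (fun p => e p ^ 2) volume)
    (BC.int (by fun_prop) : Integrable (fun p => f p * dv ee0 y p) volume) 
    (BC.int cS) (BC.int BC.zero)
  rw [i5, iS] at l2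
  have hfin := integral_mono (μ := (volume : Measure E3)) (f := fun p => y p * f p)
    (g := fun p => 1 * e p ^ 2 + (-2) * (f p * dv ee0 y p) + 2 * S p + 0 * 0)
    (BC.int (by fun_prop)) (BC.int (by fun_prop)) (by
      intro p
      have hf0 : 0 ≤ f p := by rw [hf]; exact ph_nn hε _
      have hf0' : 0 ≤ f' p := by rw [hf']; exact ph'_nn hε _
      have hsq : f p ^ 2 ≤ y p * f p := by rw [hf]; exact ph_sq hε _
      have hyf : 0 ≤ y p * f p := (sq_nonneg _).trans hsq
      have hsq' : f p ^ 2 ≤ f' p * (y p * f p) := by rw [hf, hf']; exact ph_sq' hε _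
      have g1 := amgm_aux (y := dv ee1 y p) hδ (hA.hC1 p) hf0' hyf hsq'
      have g2 := amgm_aux (y := dv ee2 y p) hδ (hA.hC2 p) hf0' hyf hsq'
      have g3 := mul_le_mul_of_nonneg_left (hP p) hf0
      have g4 := mul_le_mul_of_nonneg_left (hA.lo p (dv ee1 y p) (dv ee2 y p)) hf0'
      have g5 := mul_le_mul_of_nonneg_right hK hyf
      have g6 := sq_nonneg (f p - e p)
      have e1 : C ^ 2 / (2 * δ) = 2 * (C ^ 2 / (4 * δ)) := by field_simp; ring
      rw [e1] at g5
      simp only [Pop] at g3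
      simp only [hS]
      rw [dv_comm hy.1 ee2 ee1]
      generalize C ^ 2 / (4 * δ) = M at *
      clear hS l1 l2 iS cS hf hf' hpr hld hld'
      linarith)
  rw [l2] at hfin
  rw [hf] at hfin
  simpa using hfin

theorem maxp {δ C K : ℝ} {a b c a1 b1 b2 c2 : E3 → ℝ} (hδ : 0 < δ)
    (hA : SCoef δ C a b c a1 b1 b2 c2) (hK : C ^ 2 / (2 * δ) + 1 ≤ K)
    {y e : E3 → ℝ} (hy : Tst y) (he : BC e) (hP : ∀ p, - e p ≤ Pop a b c K y p) :
    ∫ p, (max (y p) 0) ^ 2 ≤ ∫ p, e p ^ 2 := by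
  have hlim : Tendsto (fun n : ℕ => ∫ p, y p * ph (1 / ((n : ℝ) + 1)) (y p)) atTop
      (nhds (∫ p, (max (y p) 0) ^ 2)) := by
    have hpos : ∀ n : ℕ, (0 : ℝ) < 1 / ((n : ℝ) + 1) := fun n => by positivity
    refine tendsto_integral_of_dominated_convergence (fun p => y p ^ 2)
      (fun n => (hy.cont.mul ((ph_cont (hpos n)).comp hy.cont)).aestronglyMeasurable)
      (BC.int hy.bc.sq) (fun n => Eventually.of_forall fun p => ?_)
      (Eventually.of_forall fun p => ?_)
    · rw [norm_mul, Real.norm_of_nonneg (ph_nn (hpos n) _), Real.norm_eq_abs, ← sq_abs, pow_two]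
      refine mul_le_mul_of_nonneg_left ((ph_le (hpos n) _).trans ?_) (abs_nonneg _)
      exact max_le (le_abs_self _) (abs_nonneg _)
    · simp only [s_ph]
      have h0 : Tendsto (fun n : ℕ => 1 / ((n : ℝ) + 1)) atTop (nhds 0) :=
        tendsto_one_div_add_atTop_nhds_zero_nat
      rcases eq_or_lt_of_le (le_max_right (y p) 0) with h | h
      · simp [ph, ← h]
      · unfold ph
        have h1 : Tendsto (fun n : ℕ => max (y p) 0 * (max (y p) 0 ^ 2 / (max (y p) 0 + 1 / ((n : ℝ) + 1)))) atTop
          (nhds (max (y p) 0 * (max (y p) 0 ^ 2 / (max (y p) 0 + 0)))) :=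
          (tendsto_const_nhds.div (tendsto_const_nhds.add h0) (by simpa using h.ne')).const_mul _
        convert h1 using 2
        field_simp
        simp
  exact le_of_tendsto' hlim fun n => maxp_eps hδ hA hK (by positivity) hy he hP



def Cv (h g : E3 → ℝ) : E3 → ℝ := fun x => ∫ y, h y * g (x - y)

lemma Cv_eq (h g : E3 → ℝ) : Cv h g = convolution h g (ContinuousLinearMap.mul ℝ ℝ) volume := by
  funext x; simp [Cv, convolution_def]

lemma Cv_fderiv {h g : E3 → ℝ} (hh : LocallyIntegrable h volume) (hg : Tst g) (v p : E3) :
    HasLineDerivAt ℝ (Cv h g) (Cv h (dv v g) p) p v := by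
  have h1 := hg.2.hasFDerivAt_convolution_right (ContinuousLinearMap.mul ℝ ℝ) hh
    (hg.1.of_le (by exact_mod_cast le_top)) p
  rw [Cv_eq, Cv_eq]
  have h2 := h1.hasLineDerivAt v
  rw [convolution_precompR_apply _ hh (hg.2.fderiv ℝ) (hg.1.continuous_fderiv (by simp))] at h2
  exact h2

lemma Cv_cont {h g : E3 → ℝ} (hh : LocallyIntegrable h volume) (hg : Tst g) :
    Continuous (Cv h g) := by
  rw [Cv_eq]; exact hg.2.continuous_convolution_right _ hh hg.cont

lemma Tst.refl {g : E3 → ℝ} (hg : Tst g) (x : E3) : Tst (fun y => g (x - y)) :=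
  ⟨hg.1.comp (contDiff_const.sub contDiff_id),
    hg.2.comp_homeomorph (Homeomorph.subLeft x)⟩

lemma dv_refl {g : E3 → ℝ} (hg : Differentiable ℝ g) (x v : E3) :
    dv v (fun y => g (x - y)) = fun y => - dv v g (x - y) := by
  funext y
  have h1 : HasFDerivAt (fun y : E3 => x - y) (-(ContinuousLinearMap.id ℝ E3)) y := by
    simpa using (hasFDerivAt_id y).const_sub x
  have := ((hg (x - y)).hasFDerivAt.comp y h1).fderiv
  simp only [dv]
  change fderiv ℝ (g ∘ fun y => x - y) y v = _
  rw [this]; simp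

lemma snd_test {f g : ℝ → ℝ} {r : ℝ} (hf : ∀ s, HasDerivAt f (g s) s) (hg : HasDerivAt g r 0)
    (hmax : ∀ s, f s ≤ f 0) : g 0 = 0 ∧ r ≤ 0 := by
  have hlm : IsLocalMax f 0 := Eventually.of_forall hmax
  have h0 : g 0 = 0 := hlm.hasDerivAt_eq_zero (hf 0)
  refine ⟨h0, ?_⟩
  by_contra hr
  push Not at hr
  have e1 : deriv f = g := funext fun s => (hf s).deriv
  have hlmin := isLocalMin_of_deriv_deriv_pos (f := f) (x₀ := 0) (by rw [e1, hg.deriv]; exact hr)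
    (by rw [e1, h0]) (hf 0).continuousAt
  have heq : f =ᶠ[nhds 0] fun _ => f 0 := by
    filter_upwards [hlmin] with s hs
    exact le_antisymm (hmax s) hs
  have h2 : deriv f =ᶠ[nhds 0] deriv (fun _ => f 0) := heq.deriv
  have h3 := h2.deriv_eq
  rw [e1, hg.deriv] at h3
  simp at h3
  linarith

lemma line_shift {H H' : E3 → ℝ} {v : E3} (h : ∀ p, HasLineDerivAt ℝ H (H' p) p v) (p : E3) (s : ℝ) :
    HasDerivAt (fun r : ℝ => H (p + r • v)) (H' (p + s • v)) s := by
  have h1 := h (p + s • v)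
  unfold HasLineDerivAt at h1
  have h2 : HasDerivAt (fun r : ℝ => r - s) 1 s := (hasDerivAt_id s).sub_const s
  have h3 : HasDerivAt (fun t : ℝ => H (p + s • v + t • v)) (H' (p + s • v)) (s - s) := by
    simpa using h1
  have := HasDerivAt.comp (h := fun r : ℝ => r - s) s h3 h2
  simp only [mul_one] at this
  refine this.congr_of_eventuallyEq (Eventually.of_forall fun r => ?_)
  change H (p + r • v) = H (p + s • v + (r - s) • v)
  congr 1
  module

/-- no bounded solutions of the backward heat equation with positive killing -/
lemma heat_le {H H0 H1 H2 H11 H22 : E3 → ℝ} {κ M : ℝ} (hκ : 0 < κ) (hc : Continuous H)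
    (hM : ∀ p, H p ≤ M)
    (h0 : ∀ p, HasLineDerivAt ℝ H (H0 p) p ee0)
    (h1 : ∀ p, HasLineDerivAt ℝ H (H1 p) p ee1)
    (h2 : ∀ p, HasLineDerivAt ℝ H (H2 p) p ee2)
    (h11 : ∀ p, HasLineDerivAt ℝ H1 (H11 p) p ee1)
    (h22 : ∀ p, HasLineDerivAt ℝ H2 (H22 p) p ee2)
    (heq : ∀ p, H0 p + (H11 p + H22 p) - κ * H p = 0) (p0 : E3) : H p0 ≤ 0 := by
  by_contra hpos
  push Not at hpos
  set A : ℝ := (1 / κ + 4) / κ with hA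
  have hA0 : 0 < A := by positivity
  set q : E3 → ℝ := fun p => A + p.1 ^ 2 + p.2.1 ^ 2 + p.2.2 ^ 2 with hq
  have hq0 : ∀ p, 0 < q p := fun p => by simp only [hq]; positivity
  set ε : ℝ := H p0 / (2 * q p0) with hε
  have hε0 : 0 < ε := div_pos hpos (by have := hq0 p0; positivity)
  have hG0 : 0 < H p0 - ε * q p0 := by
    have : ε * q p0 = H p0 / 2 := by rw [hε]; have := (hq0 p0).ne'; field_simp
    rw [this]; linarith
  have hGc : Continuous (fun p => H p - ε * q p) := by
    simp only [hq]; fun_prop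
  obtain ⟨x, hx⟩ := hGc.exists_forall_ge' p0 (by
    have ht : Tendsto (fun p : E3 => ε * ‖p‖) (cocompact E3) atTop :=
      (tendsto_norm_cocompact_atTop).const_mul_atTop hε0
    filter_upwards [ht.eventually_ge_atTop (M + ε + 0 )] with p hp
    have h3 : ‖p‖ ^ 2 ≤ p.1 ^ 2 + p.2.1 ^ 2 + p.2.2 ^ 2 := by
      have : ‖p‖ = max |p.1| (max |p.2.1| |p.2.2|) := rfl
      rw [this, ← sq_abs p.1, ← sq_abs p.2.1, ← sq_abs p.2.2]
      rcases max_cases |p.1| (max |p.2.1| |p.2.2|) with h | h <;> 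
      rcases max_cases |p.2.1| |p.2.2| with h' | h' <;> rw [h.1] <;> try rw [h'.1]
      all_goals nlinarith [sq_nonneg |p.1|, sq_nonneg |p.2.1|, sq_nonneg |p.2.2|]
    have h4 : 2 * ‖p‖ - 1 ≤ q p := by
      simp only [hq]; nlinarith [sq_nonneg (‖p‖ - 1)]
    have h5 := mul_le_mul_of_nonneg_left h4 hε0.le
    have h6 := hM p
    have h7 : 0 ≤ M := hpos.le.trans (hM p0)
    nlinarith)
  have hG1 : 0 < H x - ε * q x := lt_of_lt_of_le hG0 (hx p0)
  -- derivatives at x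
  have d0 : H0 x - ε * (2 * x.1) = 0 := by
    have hf : HasDerivAt (fun s : ℝ => H (x + s • ee0) - ε * q (x + s • ee0))
        (H0 x - ε * (2 * x.1)) 0 := by
      have e1 : HasDerivAt (fun s : ℝ => q (x + s • ee0)) (2 * x.1) 0 := by
        have : HasDerivAt (fun s : ℝ => A + (x.1 + s) ^ 2 + x.2.1 ^ 2 + x.2.2 ^ 2) (2 * x.1) 0 := by
          have := (((((hasDerivAt_id (0 : ℝ)).const_add x.1).pow 2).const_add A).add_const (x.2.1 ^ 2)).add_const (x.2.2 ^ 2)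
          simpa using this
        simpa [hq, ee0] using this
      have := (line_shift h0 x 0).fun_sub (e1.const_mul ε)
      simpa using this
    exact IsLocalMax.hasDerivAt_eq_zero (f := fun s : ℝ => H (x + s • ee0) - ε * q (x + s • ee0)) (a := 0)
      (Eventually.of_forall fun s => by simpa using hx (x + s • ee0)) hf
  have d1 : H11 x - ε * 2 ≤ 0 := by
    have e1 : ∀ s : ℝ, HasDerivAt (fun s : ℝ => q (x + s • ee1)) (2 * (x.2.1 + s)) s := by
      intro s
      have : HasDerivAt (fun s : ℝ => A + x.1 ^ 2 + (x.2.1 + s) ^ 2 + x.2.2 ^ 2) (2 * (x.2.1 + s)) s := by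
        have := ((((hasDerivAt_id s).const_add x.2.1).pow 2).const_add (A + x.1 ^ 2)).add_const (x.2.2 ^ 2)
        simpa using this
      simpa [hq, ee1] using this
    refine (snd_test (f := fun s : ℝ => H (x + s • ee1) - ε * q (x + s • ee1))
      (g := fun s => H1 (x + s • ee1) - ε * (2 * (x.2.1 + s)))
      (fun s => (line_shift h1 x s).sub ((e1 s).const_mul ε)) ?_ 
      (fun s => by simpa using hx (x + s • ee1))).2
    have := ((((hasDerivAt_id (0 : ℝ)).const_add x.2.1).const_mul 2).const_mul ε)
    have := (line_shift h11 x 0).fun_sub this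
    simpa using this
  have d2 : H22 x - ε * 2 ≤ 0 := by
    have e1 : ∀ s : ℝ, HasDerivAt (fun s : ℝ => q (x + s • ee2)) (2 * (x.2.2 + s)) s := by
      intro s
      have : HasDerivAt (fun s : ℝ => A + x.1 ^ 2 + x.2.1 ^ 2 + (x.2.2 + s) ^ 2) (2 * (x.2.2 + s)) s := by
        have := ((((hasDerivAt_id s).const_add x.2.2).pow 2).const_add (A + x.1 ^ 2 + x.2.1 ^ 2))
        simpa using this
      simpa [hq, ee2] using this
    refine (snd_test (f := fun s : ℝ => H (x + s • ee2) - ε * q (x + s • ee2))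
      (g := fun s => H2 (x + s • ee2) - ε * (2 * (x.2.2 + s)))
      (fun s => (line_shift h2 x s).sub ((e1 s).const_mul ε)) ?_ 
      (fun s => by simpa using hx (x + s • ee2))).2
    have := ((((hasDerivAt_id (0 : ℝ)).const_add x.2.2).const_mul 2).const_mul ε)
    have := (line_shift h22 x 0).fun_sub this
    simpa using this
  have e := heq x
  have f1 : κ * (ε * q x) < ε * (2 * x.1 + 4) := by
    have := mul_lt_mul_of_pos_left (show ε * q x < H x by linarith) hκ
    linarith
  have f2 : 2 * x.1 + 4 ≤ κ * q x := by
    have e1 : κ * A = 1 / κ + 4 := by rw [hA]; field_simp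
    have e2 : κ * x.1 ^ 2 - 2 * x.1 + 1 / κ = κ * (x.1 - 1 / κ) ^ 2 := by field_simp; ring
    have : 0 ≤ κ * (x.1 - 1 / κ) ^ 2 := by positivity
    have : 0 ≤ κ * (x.2.1 ^ 2 + x.2.2 ^ 2) := by positivity
    simp only [hq]
    nlinarith
  have := mul_le_mul_of_nonneg_left f2 hε0.le
  linarith

theorem heat_dense {κ : ℝ} (hκ : 0 < κ) {h : E3 → ℝ} (hh : MemLp h 2 volume)
    (horth : ∀ φ, Tst φ → ∫ y, h y * Pop (fun _ => 1) (fun _ => 0) (fun _ => 1) κ φ y = 0) :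
    h =ᵐ[volume] 0 := by
  have hl : LocallyIntegrable h volume := hh.locallyIntegrable (by norm_num)
  have hsq : Integrable (fun y => h y ^ 2) volume := hh.integrable_sq
  have key : ∀ g, Tst g → ∀ x, Cv h g x ≤ 0 := by
    intro g hg x
    have hint : ∀ g, Tst g → ∀ x, Integrable (fun y => h y * g (x - y)) volume := fun g hg x =>
      hh.integrable_mul (hg.refl x).bc.memLp
    refine heat_le (M := ((∫ y, h y ^ 2) + ∫ y, g y ^ 2)) hκ (Cv_cont hl hg) ?_ (Cv_fderiv hl hg ee0) (Cv_fderiv hl hg ee1)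
      (Cv_fderiv hl hg ee2) (Cv_fderiv hl (hg.dv ee1) ee1) (Cv_fderiv hl (hg.dv ee2) ee2) ?_ x
    · intro x
      have e1 : ∫ y, g y ^ 2 = ∫ y, g (x - y) ^ 2 :=
        (integral_sub_left_eq_self (fun y => g y ^ 2) volume x).symm
      rw [e1, ← integral_add hsq (hg.refl x).bc.sq.int]
      refine integral_mono (hint g hg x) (hsq.add (hg.refl x).bc.sq.int) fun y => ?_
      simp only
      nlinarith [sq_nonneg (h y - g (x - y)), sq_nonneg (h y + g (x - y))]
    · intro x
      simp only [Cv]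
      have := int_lin4 (μ := volume) 1 1 1 (-κ) (hint _ (hg.dv ee0) x) (hint _ ((hg.dv ee1).dv ee1) x)
        (hint _ ((hg.dv ee2).dv ee2) x) (hint _ hg x)
      refine Eq.trans (b := ∫ y, h y * Pop (fun _ => 1) (fun _ => 0) (fun _ => 1) κ (fun y => g (x - y)) y) ?_ (horth _ (hg.refl x))
      refine Eq.trans ?_ (this.symm.trans ?_)
      · ring
      congr 1
      funext y
      simp only [Pop]
      simp only [dv_refl hg.diff, dv_neg, dv_refl (hg.dv _).diff]
      ring
  have key2 : ∀ g, Tst g → ∫ y, g y • h y = 0 := by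
    intro g hg
    have h1 := key _ (hg.refl 0) 0
    have h2 := key _ (hg.refl 0).neg 0
    simp only [Cv, zero_sub, neg_neg, mul_neg] at h1 h2
    rw [integral_neg] at h2
    have : ∫ y, g y • h y = ∫ y, h y * g y := by congr 1; funext y; simp [mul_comm]
    rw [this]; linarith
  exact ae_eq_zero_of_integral_contDiff_smul_eq_zero hl fun g hg hc => key2 g ⟨hg, hc⟩



lemma dense_step {V H : Type*} [AddCommGroup V] [Module ℝ V] [NormedAddCommGroup H]
    [InnerProductSpace ℝ H] [CompleteSpace H] (A B : V →ₗ[ℝ] H) 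
    (h : ∀ φ, ‖A φ - B φ‖ ≤ 1 / 2 * ‖A φ‖) (hA : DenseRange A) : DenseRange B := by
  have hB : (LinearMap.range B)ᗮ = ⊥ := by
    rw [Submodule.eq_bot_iff]
    intro x hx
    have h1 : ∀ y : H, inner ℝ y x ≤ 1 / 2 * ‖y‖ * ‖x‖ := by
      have hcl : IsClosed {y : H | inner ℝ y x ≤ 1 / 2 * ‖y‖ * ‖x‖} :=
        isClosed_le (by fun_prop) (by fun_prop)
      intro y
      refine hA.induction_on (p := fun y => inner ℝ y x ≤ 1 / 2 * ‖y‖ * ‖x‖) y hcl fun φ => ?_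
      have h2 : inner ℝ (B φ) x = 0 := hx (B φ) ⟨φ, rfl⟩
      have h3 : inner ℝ (A φ) x = inner ℝ (A φ - B φ) x := by rw [inner_sub_left, h2, sub_zero]
      rw [h3]
      exact (real_inner_le_norm _ _).trans (mul_le_mul_of_nonneg_right (h φ) (norm_nonneg _))
    have h4 := h1 x
    rw [real_inner_self_eq_norm_sq] at h4
    have : ‖x‖ ^ 2 ≤ 0 := by nlinarith
    have : ‖x‖ = 0 := by nlinarith [sq_nonneg ‖x‖, norm_nonneg x]
    exact norm_eq_zero.1 this
  have := (Submodule.topologicalClosure_eq_top_iff (K := LinearMap.range B)).2 hB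
  rw [← Submodule.dense_iff_topologicalClosure_eq_top] at this
  exact this

def TV : Submodule ℝ (E3 → ℝ) where
  carrier := {u | Tst u}
  add_mem' h h' := Tst.add h h'
  zero_mem' := ⟨contDiff_const, HasCompactSupport.zero⟩
  smul_mem' c u h := Tst.cmul h c

lemma Pop_add {a b c : E3 → ℝ} {κ : ℝ} {u w : E3 → ℝ} (hu : Tst u) (hw : Tst w) :
    Pop a b c κ (fun p => u p + w p) = fun p => Pop a b c κ u p + Pop a b c κ w p := by
  funext p
  simp only [Pop, dv_add hu.diff hw.diff, dv_add (hu.dv _).diff (hw.dv _).diff]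
  ring
lemma Pop_sub {a b c : E3 → ℝ} {κ : ℝ} {u w : E3 → ℝ} (hu : Tst u) (hw : Tst w) :
    Pop a b c κ (fun p => u p - w p) = fun p => Pop a b c κ u p - Pop a b c κ w p := by
  funext p
  simp only [Pop, dv_sub hu.diff hw.diff, dv_sub (hu.dv _).diff (hw.dv _).diff]
  ring
lemma Pop_cmul {a b c : E3 → ℝ} {κ : ℝ} {u : E3 → ℝ} (hu : Tst u) (r : ℝ) :
    Pop a b c κ (fun p => r * u p) = fun p => r * Pop a b c κ u p := by
  funext p
  simp only [Pop, dv_cmul hu.diff, dv_cmul (hu.dv _).diff]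
  ring

def PL {δ : ℝ} {a b c : E3 → ℝ} (hδ : 0 < δ) (hA : Coef δ a b c) (κ : ℝ) :
    TV →ₗ[ℝ] Lp ℝ 2 (volume : Measure E3) where
  toFun φ := (bc_Pop hδ hA κ φ.2).memLp.toLp (Pop a b c κ φ.1)
  map_add' u w := by
    rw [← MemLp.toLp_add]
    congr 1
    exact Pop_add u.2 w.2
  map_smul' r u := by
    rw [RingHom.id_apply, ← MemLp.toLp_const_smul]
    congr 1
    exact Pop_cmul u.2 r

lemma norm_toLp_sq {f : E3 → ℝ} (hf : MemLp f 2 (volume : Measure E3)) : ‖hf.toLp f‖ ^ 2 = ∫ p, f p ^ 2 := by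
  rw [← real_inner_self_eq_norm_sq, L2.inner_def]
  refine integral_congr_ae ?_
  filter_upwards [hf.coeFn_toLp] with p hp
  simp [hp, pow_two]

def ca (s : ℝ) (a : E3 → ℝ) : E3 → ℝ := fun p => (1 - s) + s * a p
def cb (s : ℝ) (a : E3 → ℝ) : E3 → ℝ := fun p => s * a p

lemma Coef.interp {δ s : ℝ} {a b c : E3 → ℝ} (hδ : 0 < δ) (hδ1 : δ ≤ 1) (hA : Coef δ a b c)
    (h0 : 0 ≤ s) (h1 : s ≤ 1) : Coef δ (ca s a) (cb s b) (ca s c) where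
  ma := by unfold ca; exact (hA.ma.const_mul s).const_add _
  mb := by unfold cb; exact (hA.mb.const_mul s)
  mc := by unfold ca; exact (hA.mc.const_mul s).const_add _
  lo p x y := by
    have h2 := mul_le_mul_of_nonneg_left (hA.lo p x y) h0
    have h3 : (1 - s) * (δ * (x ^ 2 + y ^ 2)) ≤ (1 - s) * (1 * (x ^ 2 + y ^ 2)) := by
      have : 0 ≤ 1 - s := by linarith
      gcongr
    simp only [ca, cb]; linarith
  hi p x y := by
    have h2 := mul_le_mul_of_nonneg_left (hA.hi p x y) h0
    have h3 : (1 - s) * (1 * (x ^ 2 + y ^ 2)) ≤ (1 - s) * (δ⁻¹ * (x ^ 2 + y ^ 2)) := by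
      have : 0 ≤ 1 - s := by linarith
      have : 1 ≤ δ⁻¹ := (one_le_inv₀ hδ).2 hδ1
      gcongr
    simp only [ca, cb]; linarith
  tr t x y x' y' := by
    have := hA.tr t x y x' y'
    simp only [ca]; linear_combination s * this

lemma N1_pos {δ : ℝ} (hδ : 0 < δ) : 0 < N1 δ := by unfold N1; positivity

lemma step_bound {δ s s' κ : ℝ} {a b c : E3 → ℝ} (hδ : 0 < δ) (hδ1 : δ ≤ 1) (hA : Coef δ a b c)
    (h0 : 0 ≤ s) (h1 : s ≤ 1) (h0' : 0 ≤ s') (h1' : s' ≤ 1) (hκ : 0 ≤ κ) {φ : E3 → ℝ} (hφ : Tst φ)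
    (hs : (s - s') ^ 2 * (4 * (δ⁻¹ + 1) ^ 2) * N1 δ ≤ 1 / 4) :
    ∫ p, (Pop (ca s a) (cb s b) (ca s c) κ φ p - Pop (ca s' a) (cb s' b) (ca s' c) κ φ p) ^ 2 ≤
    1 / 4 * ∫ p, Pop (ca s a) (cb s b) (ca s c) κ φ p ^ 2 := by
  have hAs := hA.interp hδ hδ1 h0 h1
  have hap := apriori hδ hδ1 hAs wt_one hκ hφ
  simp only [one_mul] at hap
  have cP := bc_Pop hδ hAs κ hφ
  have cP' := bc_Pop hδ (hA.interp hδ hδ1 h0' h1') κ hφ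
  have b0 := hφ.bc
  have b1 := (hφ.dv ee1).bc
  have b2 := (hφ.dv ee2).bc
  have b3 := (hφ.dv ee0).bc
  have b4 := ((hφ.dv ee1).dv ee1).bc
  have b5 := ((hφ.dv ee2).dv ee1).bc
  have b6 := ((hφ.dv ee2).dv ee2).bc
  have cJ : BC (Jq κ φ) := by unfold Jq; fun_prop
  have h2 : ∫ p, (Pop (ca s a) (cb s b) (ca s c) κ φ p - Pop (ca s' a) (cb s' b) (ca s' c) κ φ p) ^ 2 ≤
      ∫ p, ((s - s') ^ 2 * (4 * (δ⁻¹ + 1) ^ 2)) * Jq κ φ p := by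
    refine integral_mono (BC.int (by fun_prop)) (BC.int (by fun_prop)) fun p => ?_
    have e1 : Pop (ca s a) (cb s b) (ca s c) κ φ p - Pop (ca s' a) (cb s' b) (ca s' c) κ φ p
      = (s - s') * ((a p - 1) * dv ee1 (dv ee1 φ) p + 2 * b p * dv ee1 (dv ee2 φ) p
        + (c p - 1) * dv ee2 (dv ee2 φ) p) := by simp only [Pop, ca, cb]; ring
    have hi := inv_pos.2 hδ
    have k1 : (a p - 1) ^ 2 ≤ (δ⁻¹ + 1) ^ 2 := by
      have := hA.a_lo p; have := hA.a_hi p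
      exact sq_le_sq' (by linarith) (by linarith)
    have k2 : b p ^ 2 ≤ (δ⁻¹ + 1) ^ 2 := by
      have := abs_le.1 (hA.b_hi hδ p)
      exact sq_le_sq' (by linarith) (by linarith)
    have k3 : (c p - 1) ^ 2 ≤ (δ⁻¹ + 1) ^ 2 := by
      have := hA.c_lo p; have := hA.c_hi p
      exact sq_le_sq' (by linarith) (by linarith)
    beta_reduce
    rw [e1, mul_pow, mul_assoc ((s - s') ^ 2)]
    refine mul_le_mul_of_nonneg_left ?_ (sq_nonneg (s - s'))
    set X := dv ee1 (dv ee1 φ) p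
    set Y := dv ee1 (dv ee2 φ) p
    set Z := dv ee2 (dv ee2 φ) p
    have k4 : ((a p - 1) * X + 2 * b p * Y + (c p - 1) * Z) ^ 2 ≤
      ((a p - 1) ^ 2 + 2 * b p ^ 2 + (c p - 1) ^ 2) * (X ^ 2 + 2 * Y ^ 2 + Z ^ 2) := by
      nlinarith [sq_nonneg ((a p - 1) * Y - b p * X), sq_nonneg ((a p - 1) * Z - (c p - 1) * X),
        sq_nonneg (b p * Z - (c p - 1) * Y)]
    refine k4.trans ?_
    have k5 : X ^ 2 + 2 * Y ^ 2 + Z ^ 2 ≤ Jq κ φ p := by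
      unfold Jq
      have : 0 ≤ dv ee0 φ p ^ 2 + κ ^ 2 * φ p ^ 2 + κ * (dv ee1 φ p ^ 2 + dv ee2 φ p ^ 2) := by positivity
      linarith
    have k6 : (a p - 1) ^ 2 + 2 * b p ^ 2 + (c p - 1) ^ 2 ≤ 4 * (δ⁻¹ + 1) ^ 2 := by linarith
    gcongr
  rw [integral_const_mul] at h2
  refine h2.trans ((mul_le_mul_of_nonneg_left hap (by positivity)).trans ?_)
  rw [← mul_assoc]
  refine mul_le_mul_of_nonneg_right hs (integral_nonneg fun p => sq_nonneg _)

lemma dense_interp {δ κ : ℝ} {a b c : E3 → ℝ} (hδ : 0 < δ) (hδ1 : δ ≤ 1) (hA : Coef δ a b c)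
    (hκ : 0 < κ) : ∀ s (h0 : 0 ≤ s) (h1 : s ≤ 1),
    DenseRange (PL hδ (hA.interp hδ hδ1 h0 h1) κ) := by
  obtain ⟨n, hn⟩ := exists_nat_gt (4 * (4 * (δ⁻¹ + 1) ^ 2 * N1 δ))
  have hN := N1_pos hδ
  have hn0 : (0 : ℝ) < n := lt_trans (by positivity) hn
  have hn1 : (1 : ℝ) ≤ n := by exact_mod_cast Nat.one_le_iff_ne_zero.2 (by rintro rfl; simp at hn0)
  -- single step
  have step : ∀ s s' (h0 : 0 ≤ s) (h1 : s ≤ 1) (h0' : 0 ≤ s') (h1' : s' ≤ 1), |s - s'| ≤ 1 / (n : ℝ) →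
      DenseRange (PL hδ (hA.interp hδ hδ1 h0 h1) κ) → DenseRange (PL hδ (hA.interp hδ hδ1 h0' h1') κ) := by
    intro s s' h0 h1 h0' h1' hss hd
    refine dense_step _ _ (fun φ => ?_) hd
    have hb := step_bound hδ hδ1 hA h0 h1 h0' h1' hκ.le φ.2 (by
      have e1 : (s - s') ^ 2 ≤ 1 / (n : ℝ) := by
        rw [← sq_abs]
        calc |s - s'| ^ 2 ≤ (1 / (n : ℝ)) ^ 2 := by gcongr
          _ = 1 / (n : ℝ) * (1 / (n : ℝ)) := by ring
          _ ≤ 1 / (n : ℝ) * 1 := by gcongr; rw [div_le_one hn0]; exact hn1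
          _ = _ := by ring
      calc (s - s') ^ 2 * (4 * (δ⁻¹ + 1) ^ 2) * N1 δ ≤ 1 / (n : ℝ) * (4 * (δ⁻¹ + 1) ^ 2) * N1 δ := by gcongr
        _ = (4 * (δ⁻¹ + 1) ^ 2 * N1 δ) / (n : ℝ) := by ring
        _ ≤ 1 / 4 := by rw [div_le_div_iff₀ hn0 (by norm_num)]; linarith)
    refine le_of_abs_le (abs_le_of_sq_le_sq ?_ (by positivity))
    have c1 := bc_Pop hδ (hA.interp hδ hδ1 h0 h1) κ φ.2
    have c2 := bc_Pop hδ (hA.interp hδ hδ1 h0' h1') κ φ.2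
    have e2 : PL hδ (hA.interp hδ hδ1 h0 h1) κ φ - PL hδ (hA.interp hδ hδ1 h0' h1') κ φ
      = (c1.memLp.sub c2.memLp).toLp _ := (MemLp.toLp_sub c1.memLp c2.memLp).symm
    rw [e2, norm_toLp_sq, mul_pow]
    have e3 : ‖PL hδ (hA.interp hδ hδ1 h0 h1) κ φ‖ ^ 2 = _ := norm_toLp_sq c1.memLp
    rw [e3]
    norm_num at hb ⊢
    exact hb
  have ind : ∀ k : ℕ, ∀ s (h0 : 0 ≤ s) (h1 : s ≤ 1), s ≤ k * (1 / n : ℝ) →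
      DenseRange (PL hδ (hA.interp hδ hδ1 h0 h1) κ) := by
    intro k
    induction k with
    | zero =>
      intro s h0 h1 hs
      have hs0 : s = 0 := le_antisymm (by simpa using hs) h0
      subst hs0
      have hB : (LinearMap.range (PL hδ (hA.interp hδ hδ1 h0 h1) κ))ᗮ = ⊥ := by
        rw [Submodule.eq_bot_iff]
        intro x hx
        have e1 : ca 0 a = fun _ => 1 := by funext p; simp [ca]
        have e2 : cb 0 b = fun _ => 0 := by funext p; simp [cb]
        have e3 : ca 0 c = fun _ => 1 := by funext p; simp [ca]
        have := heat_dense hκ (Lp.memLp x) (by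
          intro φ hφ
          have h2 : inner ℝ (PL hδ (hA.interp hδ hδ1 h0 h1) κ ⟨φ, hφ⟩) x = 0 := hx _ ⟨_, rfl⟩
          rw [L2.inner_def] at h2
          refine Eq.trans (integral_congr_ae ?_) h2
          have hPeq : Pop (ca 0 a) (cb 0 b) (ca 0 c) κ φ = Pop (fun _ => 1) (fun _ => 0) (fun _ => 1) κ φ := by
            rw [e1, e2, e3]
          have hm := (bc_Pop hδ (hA.interp hδ hδ1 h0 h1) κ hφ).memLp (μ := (volume : Measure E3))
          filter_upwards [hm.coeFn_toLp] with p hp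
          change _ = inner ℝ ((hm.toLp (Pop (ca 0 a) (cb 0 b) (ca 0 c) κ φ) : E3 → ℝ) p) (x p)
          rw [hp, hPeq]
          simp)
        exact (Lp.eq_zero_iff_ae_eq_zero).2 this
      have := (Submodule.topologicalClosure_eq_top_iff (K := LinearMap.range (PL hδ (hA.interp hδ hδ1 h0 h1) κ))).2 hB
      rw [← Submodule.dense_iff_topologicalClosure_eq_top] at this
      exact this
    | succ k ih =>
      intro s h0 h1 hs
      by_cases hk : s ≤ k * (1 / n : ℝ)
      · exact ih s h0 h1 hk
      · push Not at hk
        have q0 : (0 : ℝ) ≤ k * (1 / n : ℝ) := by positivity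
        refine step (k * (1 / n : ℝ)) s q0 (hk.le.trans h1) h0 h1 ?_ (ih _ q0 (hk.le.trans h1) le_rfl)
        push_cast at hs
        rw [abs_le]; constructor <;> linarith
  intro s h0 h1
  exact ind n s h0 h1 (by rw [mul_one_div_cancel hn0.ne']; exact h1)

theorem dense_approx {δ κ : ℝ} {a b c : E3 → ℝ} (hδ : 0 < δ) (hδ1 : δ ≤ 1) (hA : Coef δ a b c)
    (hκ : 0 < κ) {g : E3 → ℝ} (hg : BC g) {ε : ℝ} (hε : 0 < ε) :
    ∃ φ, Tst φ ∧ ∫ p, (Pop a b c κ φ p - g p) ^ 2 < ε := by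
  have hd := dense_interp hδ hδ1 hA hκ 1 zero_le_one le_rfl
  have hgm := hg.memLp (μ := (volume : Measure E3))
  obtain ⟨φ, hφ⟩ := hd.exists_dist_lt (hgm.toLp g) (Real.sqrt_pos.2 hε)
  refine ⟨φ.1, φ.2, ?_⟩
  have e1 : ca 1 a = a := by funext p; simp [ca]
  have e2 : cb 1 b = b := by funext p; simp [cb]
  have e3 : ca 1 c = c := by funext p; simp [ca]
  have c1 := bc_Pop hδ (hA.interp hδ hδ1 zero_le_one le_rfl) κ φ.2
  have e4 : PL hδ (hA.interp hδ hδ1 zero_le_one le_rfl) κ φ - hgm.toLp g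
      = (c1.memLp.sub hgm).toLp _ := (MemLp.toLp_sub c1.memLp hgm).symm
  rw [dist_comm, dist_eq_norm, e4, Real.lt_sqrt (norm_nonneg _), norm_toLp_sq] at hφ
  simp only [e1, e2, e3] at hφ
  exact hφ



lemma BC.max0 {f : E3 → ℝ} (h : BC f) : BC (fun p => max (f p) 0) := by
  obtain ⟨⟨h1, M, hM⟩, h2⟩ := h
  refine ⟨⟨h1.max measurable_const, M, fun p => ?_⟩, ?_⟩
  · have := abs_le.1 (hM p)
    have h0 : 0 ≤ M := (abs_nonneg _).trans (hM p)
    rw [abs_of_nonneg (le_max_right _ _)]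
    exact max_le this.2 h0
  · exact h2.comp_left (g := fun x => max x 0) (by simp)

lemma BC.absf {f : E3 → ℝ} (h : BC f) : BC (fun p => |f p|) := by
  obtain ⟨⟨h1, M, hM⟩, h2⟩ := h
  refine ⟨⟨measurable_abs.comp h1, M, fun p => by simpa using hM p⟩, ?_⟩
  exact h2.comp_left (g := fun x => |x|) (by simp)

def ex (μ : ℝ) : E3 → ℝ := fun p => Real.exp (μ * p.1)

lemma ex_smooth (μ : ℝ) : ContDiff ℝ (⊤ : ℕ∞) (ex μ) := by
  unfold ex; fun_prop

lemma dv_ex (μ : ℝ) (v : E3) : dv v (ex μ) = fun p => (μ * v.1) * ex μ p := by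
  funext p
  have h1 : HasFDerivAt (fun p : E3 => μ * p.1) (μ • ContinuousLinearMap.fst ℝ ℝ (ℝ × ℝ)) p :=
    (ContinuousLinearMap.fst ℝ ℝ (ℝ × ℝ)).hasFDerivAt.const_mul μ
  have := h1.exp
  have h2 : fderiv ℝ (ex μ) p = _ := this.fderiv
  simp only [dv]
  rw [h2]
  simp [ex]; ring

lemma Pop_ex {a b c : E3 → ℝ} {κ μ : ℝ} {z : E3 → ℝ} (hz : Tst z) :
    Pop a b c (κ + μ) (fun p => ex (-μ) p * z p) = fun p => ex (-μ) p * Pop a b c κ z p := by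
  have hd : ∀ ν, Differentiable ℝ (ex ν) := fun ν => (ex_smooth ν).differentiable (by simp)
  have e1 : dv ee1 (fun p => ex (-μ) p * z p) = fun p => ex (-μ) p * dv ee1 z p := by
    rw [dv_mul (hd _) hz.diff, dv_ex]; funext p; simp [ee1]
  have e2 : dv ee2 (fun p => ex (-μ) p * z p) = fun p => ex (-μ) p * dv ee2 z p := by
    rw [dv_mul (hd _) hz.diff, dv_ex]; funext p; simp [ee2]
  have f1 : ∀ y : E3 → ℝ, Tst y → dv ee1 (fun p => ex (-μ) p * y p) = fun p => ex (-μ) p * dv ee1 y p := by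
    intro y hy
    rw [dv_mul (hd _) hy.diff, dv_ex]; funext p; simp [ee1]
  have f2 : ∀ y : E3 → ℝ, Tst y → dv ee2 (fun p => ex (-μ) p * y p) = fun p => ex (-μ) p * dv ee2 y p := by
    intro y hy
    rw [dv_mul (hd _) hy.diff, dv_ex]; funext p; simp [ee2]
  have f0 : dv ee0 (fun p => ex (-μ) p * z p) = fun p => (-μ) * ex (-μ) p * z p + ex (-μ) p * dv ee0 z p := by
    rw [dv_mul (hd _) hz.diff, dv_ex]; funext p; simp [ee0]
  funext p
  simp only [Pop, f0, f1 _ hz, f2 _ hz, f1 _ (hz.dv ee1), f1 _ (hz.dv ee2), f2 _ (hz.dv ee2)]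
  ring

def th (μ T : ℝ) : ℝ → ℝ := fun t => (1 + Real.exp (2 * μ * (t - T)))⁻¹
def th' (μ T : ℝ) : ℝ → ℝ := fun t =>
  -(Real.exp (2 * μ * (t - T)) * (2 * μ)) / (1 + Real.exp (2 * μ * (t - T))) ^ 2

lemma th_wt {μ : ℝ} (hμ : 0 ≤ μ) (T : ℝ) : Wt (fun p => th μ T p.1) (fun p => th' μ T p.1) := by
  have hp : ∀ t, 0 < Real.exp (2 * μ * (t - T)) := fun t => Real.exp_pos _
  refine wt_mk (fun t => ?_) (fun t => ?_) (fun t => ?_) (fun t => ?_) ?_ ⟨2 * μ, fun t => ?_⟩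
  · have h1 : HasDerivAt (fun t => 2 * μ * (t - T)) (2 * μ) t := by
      simpa using ((hasDerivAt_id t).sub_const T).const_mul (2 * μ)
    exact (h1.exp.const_add 1).inv (by have := hp t; positivity)
  · have := hp t; unfold th; positivity
  · unfold th; exact inv_le_one_of_one_le₀ (by have := hp t; linarith)
  · have := hp t; unfold th'
    rw [neg_div, neg_nonpos]; positivity
  · unfold th'
    refine Continuous.div (by fun_prop) (by fun_prop) fun t => ?_
    have := hp t; positivity
  · have := hp t
    unfold th'
    rw [neg_div, abs_neg, abs_of_nonneg (by positivity), div_le_iff₀ (by positivity)]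
    set q := Real.exp (2 * μ * (t - T))
    nlinarith [mul_nonneg hμ this.le, mul_nonneg hμ (sq_nonneg q)]

lemma th_le (μ T t : ℝ) : th μ T t ≤ Real.exp (2 * μ * T) * Real.exp (-μ * t) ^ 2 := by
  unfold th
  have hp := Real.exp_pos (2 * μ * (t - T))
  calc (1 + Real.exp (2 * μ * (t - T)))⁻¹ ≤ (Real.exp (2 * μ * (t - T)))⁻¹ :=
        inv_anti₀ hp (by linarith)
    _ = _ := by rw [← Real.exp_neg, ← Real.exp_nat_mul, ← Real.exp_add]; congr 1; push_cast; ring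

lemma th_half {μ T t : ℝ} (hμ : 0 ≤ μ) (ht : t ≤ T) : 1 ≤ 2 * th μ T t := by
  unfold th
  have hp := Real.exp_pos (2 * μ * (t - T))
  have : Real.exp (2 * μ * (t - T)) ≤ 1 := Real.exp_le_one_iff.2 (by nlinarith)
  rw [← div_eq_mul_inv, le_div_iff₀ (by positivity)]; linarith

theorem lem3 {δ C κ : ℝ} {a b c a1 b1 b2 c2 : E3 → ℝ} (hδ : 0 < δ) (hδ1 : δ ≤ 1)
    (hA : SCoef δ C a b c a1 b1 b2 c2) (hκ : 0 ≤ κ)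
    {z g : E3 → ℝ} (hz : Tst z) (hg : BC g) (hP : ∀ p, - g p ≤ Pop a b c κ z p) :
    κ ^ 2 * ∫ p, (max (z p) 0) ^ 2 ≤ 8 * N1 δ * ∫ p, g p ^ 2 := by
  obtain ⟨μ, hμ⟩ : ∃ μ : ℝ, μ = C ^ 2 / (2 * δ) + 1 := ⟨_, rfl⟩
  have hμ0 : 0 < μ := by rw [hμ]; positivity
  obtain ⟨T, hT⟩ : ∃ T : ℝ, ∀ p, z p ≠ 0 → p.1 ≤ T := by
    obtain ⟨R, hR⟩ := hz.2.isBounded.exists_norm_le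
    refine ⟨R, fun p hp => ?_⟩
    exact ((le_abs_self _).trans (norm_fst_le p)).trans (hR p (subset_tsupport _ hp))
  have hexb : ∀ f : E3 → ℝ, BC f → BC (fun p => ex (-μ) p * f p) := by
    intro f hf
    obtain ⟨⟨h1, M, hM⟩, h2⟩ := hf
    refine ⟨⟨(ex_smooth _).continuous.measurable.mul h1, ?_⟩, h2.mul_left⟩
    obtain ⟨M2, hM2⟩ := h2.exists_bound_of_continuousOn (f := ex (-μ)) (ex_smooth _).continuous.continuousOn
    have hM0 : 0 ≤ M := (abs_nonneg _).trans (hM 0)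
    refine ⟨|M2| * M, fun p => ?_⟩
    by_cases hp : p ∈ tsupport f
    · rw [abs_mul]
      have := (hM2 p hp).trans (le_abs_self _)
      rw [Real.norm_eq_abs] at this
      gcongr
      exact hM p
    · beta_reduce
      rw [image_eq_zero_of_notMem_tsupport hp]; simp; positivity
  have W := th_wt hμ0.le T
  have wbm := W.bm
  set θ : E3 → ℝ := fun p => th μ T p.1 with hθ
  set B := Real.exp (2 * μ * T) with hB
  have hBp : 0 < B := Real.exp_pos _
  have hN := N1_pos hδ
  have key : ∀ ε : ℝ, 0 < ε → κ ^ 2 * ∫ p, (max (z p) 0) ^ 2 ≤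
      8 * N1 δ * (∫ p, g p ^ 2) + (8 * N1 δ + 4 * κ ^ 2) * B * ε := by
    intro ε hε
    obtain ⟨wh, hwh, hwe⟩ := dense_approx hδ hδ1 hA.toCoef (κ := κ + μ) (by positivity)
      (hexb g hg).neg hε
    -- w
    obtain ⟨w, hw⟩ : ∃ w : E3 → ℝ, w = fun p => ex μ p * wh p := ⟨_, rfl⟩
    have hwT : Tst w := by rw [hw]; exact Tst.smul (ex_smooth μ) hwh
    have hexm : ∀ p, ex (-μ) p * ex μ p = 1 := by
      intro p; simp only [ex]; rw [← Real.exp_add]; simp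
    have hwhw : wh = fun p => ex (-μ) p * w p := by
      funext p; rw [hw]; simp only; rw [← mul_assoc, hexm, one_mul]
    have hPwh : Pop a b c (κ + μ) wh = fun p => ex (-μ) p * Pop a b c κ w p := by
      rw [hwhw]; exact Pop_ex hwT
    have hzT : Tst (fun p => ex (-μ) p * z p) := Tst.smul (ex_smooth _) hz
    have hPz := Pop_ex (a := a) (b := b) (c := c) (κ := κ) (μ := μ) hz
    have bPw := bc_Pop hδ hA.toCoef κ hwT
    have bE : BC (fun p => ex (-μ) p * (Pop a b c κ w p + g p)) := hexb _ (by fun_prop)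
    have hexp : ∀ p, 0 < ex (-μ) p := fun p => Real.exp_pos _
    have hmax := maxp hδ hA (K := κ + μ) (by rw [hμ]; linarith) (hzT.sub hwh)
      (e := fun p => |ex (-μ) p * (Pop a b c κ w p + g p)|) bE.absf (by
        intro p
        rw [Pop_sub hzT hwh, hPz, hPwh]
        have h1 := neg_abs_le (ex (-μ) p * (Pop a b c κ w p + g p))
        have h2 := le_abs_self (ex (-μ) p * (Pop a b c κ w p + g p))
        have h3 := mul_le_mul_of_nonneg_left (hP p) (hexp p).le
        simp only
        linarith)
    simp only [sq_abs] at hmax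
    have hEe : ∫ p, (ex (-μ) p * (Pop a b c κ w p + g p)) ^ 2 < ε := by
      refine lt_of_eq_of_lt (integral_congr_ae (ae_of_all _ fun p => ?_)) hwe
      simp only [hPwh]; ring
    have hap := apriori hδ hδ1 hA.toCoef W hκ hwT
    have bw := hwT.bc
    have bz := hz.bc
    have bz0 := bz.max0
    have byT := hzT.sub hwh
    have by0 := byT.bc.max0
    have b1 := (hwT.dv ee1).bc
    have b2 := (hwT.dv ee2).bc
    have b3 := (hwT.dv ee0).bc
    have b4 := ((hwT.dv ee1).dv ee1).bc
    have b5 := ((hwT.dv ee2).dv ee1).bc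
    have b6 := ((hwT.dv ee2).dv ee2).bc
    have cJ : BC (Jq κ w) := by unfold Jq; fun_prop
    have bsq := by0.sq
    have bEs := bE.sq
    -- first
    have i1 : κ ^ 2 * ∫ p, (max (z p) 0) ^ 2 ≤ 4 * (∫ p, θ p * Jq κ w p) +
        (4 * κ ^ 2 * B) * ∫ p, (max (ex (-μ) p * z p - wh p) 0) ^ 2 := by
      rw [← integral_const_mul, ← integral_const_mul, ← integral_const_mul, ← integral_add]
      rotate_left
      · exact BC.int (by fun_prop)
      · exact BC.int (by fun_prop)
      refine integral_mono (BC.int (by fun_prop)) (BC.int (by fun_prop)) fun p => ?_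
      beta_reduce
      have t0 := W.pos p
      have j1 : κ ^ 2 * w p ^ 2 ≤ Jq κ w p := by
        unfold Jq
        have : 0 ≤ dv ee0 w p ^ 2 + κ * (dv ee1 w p ^ 2 + dv ee2 w p ^ 2)
          + (dv ee1 (dv ee1 w) p ^ 2 + 2 * dv ee1 (dv ee2 w) p ^ 2 + dv ee2 (dv ee2 w) p ^ 2) := by positivity
        linarith
      have j2 : max (z p) 0 ^ 2 ≤ 2 * θ p * max (z p) 0 ^ 2 := by
        by_cases hzp : z p = 0
        · simp [hzp]
        · have := th_half hμ0.le (hT p hzp)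
          exact le_mul_of_one_le_left (sq_nonneg _) this
      have j3 : max (ex (-μ) p * z p - wh p) 0 = ex (-μ) p * max (z p - w p) 0 := by
        rw [mul_max_of_nonneg _ _ (hexp p).le, mul_zero, mul_sub, congrFun hwhw p]
      have j4 : max (z p) 0 ^ 2 ≤ 2 * w p ^ 2 + 2 * max (z p - w p) 0 ^ 2 := by
        have k1 : max (z p) 0 ≤ |w p| + max (z p - w p) 0 := by
          refine max_le ?_ (by positivity)
          have := le_max_left (z p - w p) 0
          have := le_abs_self (w p)
          linarith
        have k2 : max (z p) 0 ^ 2 ≤ (|w p| + max (z p - w p) 0) ^ 2 :=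
          pow_le_pow_left₀ (le_max_right _ _) k1 2
        have k3 := sq_abs (w p)
        nlinarith [sq_nonneg (|w p| - max (z p - w p) 0)]
      have j5 : θ p ≤ B * ex (-μ) p ^ 2 := th_le μ T p.1
      rw [j3]
      set Y := max (z p - w p) 0
      calc κ ^ 2 * max (z p) 0 ^ 2 ≤ κ ^ 2 * (2 * θ p * (2 * w p ^ 2 + 2 * Y ^ 2)) := by
            refine mul_le_mul_of_nonneg_left (j2.trans ?_) (sq_nonneg _)
            exact mul_le_mul_of_nonneg_left j4 (by positivity)
        _ = 4 * (θ p * (κ ^ 2 * w p ^ 2)) + 4 * κ ^ 2 * (θ p * Y ^ 2) := by ring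
        _ ≤ 4 * (θ p * Jq κ w p) + 4 * κ ^ 2 * ((B * ex (-μ) p ^ 2) * Y ^ 2) := by gcongr
        _ = _ := by ring
    have i2 : ∫ p, θ p * Pop a b c κ w p ^ 2 ≤ 2 * (∫ p, g p ^ 2) +
        (2 * B) * ∫ p, (ex (-μ) p * (Pop a b c κ w p + g p)) ^ 2 := by
      rw [← integral_const_mul, ← integral_const_mul, ← integral_add]
      rotate_left
      · exact BC.int (by fun_prop)
      · exact BC.int (by fun_prop)
      refine integral_mono (BC.int (by fun_prop)) (BC.int (by fun_prop)) fun p => ?_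
      beta_reduce
      have t0 := W.pos p
      have t1 : θ p ≤ 1 := W.le p
      have j5 : θ p ≤ B * ex (-μ) p ^ 2 := th_le μ T p.1
      set P := Pop a b c κ w p
      calc θ p * P ^ 2 ≤ θ p * (2 * g p ^ 2 + 2 * (P + g p) ^ 2) := by
            refine mul_le_mul_of_nonneg_left ?_ t0
            nlinarith [sq_nonneg (P + 2 * g p)]
        _ = 2 * (θ p * g p ^ 2) + 2 * (θ p * (P + g p) ^ 2) := by ring
        _ ≤ 2 * (1 * g p ^ 2) + 2 * ((B * ex (-μ) p ^ 2) * (P + g p) ^ 2) := by gcongr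
        _ = _ := by ring
    have i3 : (4 * κ ^ 2 * B) * ∫ p, (max (ex (-μ) p * z p - wh p) 0) ^ 2 ≤ (4 * κ ^ 2 * B) * ε :=
      mul_le_mul_of_nonneg_left (hmax.trans hEe.le) (by positivity)
    have i4 : (2 * B) * ∫ p, (ex (-μ) p * (Pop a b c κ w p + g p)) ^ 2 ≤ 2 * B * ε :=
      mul_le_mul_of_nonneg_left hEe.le (by positivity)
    have i5 : N1 δ * ∫ p, θ p * Pop a b c κ w p ^ 2 ≤ N1 δ * (2 * (∫ p, g p ^ 2) + 2 * B * ε) := 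
      mul_le_mul_of_nonneg_left (i2.trans (by linarith)) hN.le
    linarith
  refine le_of_forall_pos_le_add fun η hη => ?_
  have := key (η / ((8 * N1 δ + 4 * κ ^ 2) * B)) (by positivity)
  rwa [mul_div_cancel₀ _ (by positivity)] at this



lemma Cv_swap (h g : E3 → ℝ) (x : E3) : Cv h g x = ∫ y, g y * h (x - y) := by
  unfold Cv
  rw [← integral_sub_left_eq_self (fun y => g y * h (x - y)) volume x]
  congr 1; funext y; simp [mul_comm]

lemma BM.locInt {h : E3 → ℝ} (hh : BM h) : LocallyIntegrable h volume := by
  obtain ⟨h1, M, hM⟩ := hh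
  exact (memLp_top_of_bound h1.aestronglyMeasurable M (ae_of_all _ hM)).locallyIntegrable le_top

lemma BM.int_mul_bc {h g : E3 → ℝ} (hh : BM h) (hg : BC g) (x : E3) :
    Integrable (fun y => g y * h (x - y)) volume := by
  refine BC.int (BC.rmul hg ?_)
  obtain ⟨h1, M, hM⟩ := hh
  exact ⟨h1.comp (measurable_const.sub measurable_id), M, fun p => hM _⟩

lemma Cv_bm {h g : E3 → ℝ} (hh : BM h) (hg : Tst g) : BM (Cv h g) := by
  refine ⟨(Cv_cont hh.locInt hg).measurable, ?_⟩
  have hh' := hh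
  obtain ⟨h1, M, hM⟩ := hh
  refine ⟨∫ y, |g y| * M, fun x => ?_⟩
  rw [Cv_swap]
  refine (abs_integral_le_integral_abs).trans ?_
  refine integral_mono (hh'.int_mul_bc hg.bc x).abs (hg.bc.absf.int.mul_const M) fun y => ?_
  beta_reduce
  rw [abs_mul]
  exact mul_le_mul_of_nonneg_left (hM _) (abs_nonneg _)

lemma Cv_form {a b c φ : E3 → ℝ} (ha : BM a) (hb : BM b) (hc : BM c) (hφ : Tst φ) (p : E3) (x y : ℝ) :
    Cv a φ p * x ^ 2 + 2 * Cv b φ p * x * y + Cv c φ p * y ^ 2 =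
    ∫ q, φ q * (a (p - q) * x ^ 2 + 2 * b (p - q) * x * y + c (p - q) * y ^ 2) := by
  have := int_lin4 (μ := volume) (x ^ 2) (2 * x * y) (y ^ 2) 0 (ha.int_mul_bc hφ.bc p) (hb.int_mul_bc hφ.bc p)
    (hc.int_mul_bc hφ.bc p) (hc.int_mul_bc hφ.bc p)
  rw [Cv_swap, Cv_swap, Cv_swap]
  refine Eq.trans ?_ (this.symm.trans ?_)
  · ring
  · congr 1; funext q; ring

lemma moll_scoef {δ : ℝ} {a b c φ : E3 → ℝ} (hδ : 0 < δ) (hA : Coef δ a b c) (hφ : Tst φ)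
    (h0 : ∀ p, 0 ≤ φ p) (h1 : ∫ p, φ p = 1) : ∃ C, SCoef δ C (Cv a φ) (Cv b φ) (Cv c φ)
      (Cv a (dv ee1 φ)) (Cv b (dv ee1 φ)) (Cv b (dv ee2 φ)) (Cv c (dv ee2 φ)) := by
  have ma := hA.bma hδ
  have mb := hA.bmb hδ
  have mc := hA.bmc hδ
  have k1 := Cv_bm ma (hφ.dv ee1)
  have k2 := Cv_bm mb (hφ.dv ee1)
  have k3 := Cv_bm mb (hφ.dv ee2)
  have k4 := Cv_bm mc (hφ.dv ee2)
  have k5 := k1.add k3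
  have k6 := k2.add k4
  obtain ⟨_, M, hM⟩ := k5
  obtain ⟨_, M', hM'⟩ := k6
  have hform : ∀ p x y, Integrable (fun q => φ q * (a (p - q) * x ^ 2 + 2 * b (p - q) * x * y + c (p - q) * y ^ 2)) volume := by
    intro p x y
    have := (((ma.int_mul_bc hφ.bc p).mul_const (x ^ 2)).add ((mb.int_mul_bc hφ.bc p).mul_const (2 * x * y))).add
      ((mc.int_mul_bc hφ.bc p).mul_const (y ^ 2))
    refine this.congr (ae_of_all _ fun q => ?_)
    simp only [Pi.add_apply]; ring
  have hcon : ∀ k : ℝ, ∫ q, φ q * k = k := by intro k; rw [integral_mul_const, h1, one_mul]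
  refine ⟨max M M', ⟨⟨(Cv_cont ma.locInt hφ).measurable, (Cv_cont mb.locInt hφ).measurable,
    (Cv_cont mc.locInt hφ).measurable, ?_, ?_, ?_⟩, k1, k2, k3, k4, Cv_fderiv ma.locInt hφ _,
    Cv_fderiv mb.locInt hφ _, Cv_fderiv mb.locInt hφ _, Cv_fderiv mc.locInt hφ _,
    fun p => (hM p).trans (le_max_left _ _), fun p => (hM' p).trans (le_max_right _ _)⟩⟩
  · intro p x y
    rw [Cv_form ma mb mc hφ, ← hcon (δ * (x ^ 2 + y ^ 2))]
    refine integral_mono (hφ.bc.int.mul_const _) (hform p x y) fun q => ?_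
    exact mul_le_mul_of_nonneg_left (hA.lo _ _ _) (h0 q)
  · intro p x y
    rw [Cv_form ma mb mc hφ, ← hcon (δ⁻¹ * (x ^ 2 + y ^ 2))]
    refine integral_mono (hform p x y) (hφ.bc.int.mul_const _) fun q => ?_
    exact mul_le_mul_of_nonneg_left (hA.hi _ _ _) (h0 q)
  · intro t x y x' y'
    simp only [Cv_swap]
    rw [← integral_add (ma.int_mul_bc hφ.bc _) (mc.int_mul_bc hφ.bc _),
      ← integral_add (ma.int_mul_bc hφ.bc _) (mc.int_mul_bc hφ.bc _)]
    congr 1; funext q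
    obtain ⟨q1, q2, q3⟩ := q
    have := hA.tr (t - q1) (x - q2) (y - q3) (x' - q2) (y' - q3)
    simp only [Prod.mk_sub_mk]
    linear_combination φ (q1, q2, q3) * this

def bmp (n : ℕ) : ContDiffBump (0 : E3) :=
  ⟨1 / ((n : ℝ) + 1), 2 / ((n : ℝ) + 1), by positivity, by gcongr; norm_num⟩

def bmf (n : ℕ) : E3 → ℝ := (bmp n).normed volume

lemma bmf_tst (n) : Tst (bmf n) := ⟨(bmp n).contDiff_normed, (bmp n).hasCompactSupport_normed⟩

lemma bmf_tendsto {a : E3 → ℝ} (ha : BM a) :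
    ∀ᵐ p, Tendsto (fun n => Cv a (bmf n) p) atTop (nhds (a p)) := by
  have h := ContDiffBump.ae_convolution_tendsto_right_of_locallyIntegrable (μ := (volume : Measure E3))
    (φ := bmp) (l := atTop) (K := 2) (g := a) ?_ ?_ ha.locInt
  · filter_upwards [h] with p hp
    refine hp.congr fun n => ?_
    rw [Cv_swap, convolution_def]
    rfl
  · have := (tendsto_one_div_add_atTop_nhds_zero_nat (𝕜 := ℝ)).const_mul 2
    simp only [mul_zero] at this
    refine this.congr fun n => ?_
    simp only [bmp]; ring
  · refine Eventually.of_forall fun n => ?_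
    simp only [bmp]; apply le_of_eq; ring

theorem lem4 {δ κ : ℝ} {a b c : E3 → ℝ} (hδ : 0 < δ) (hδ1 : δ ≤ 1)
    (hA : Coef δ a b c) (hκ : 0 ≤ κ) {z g : E3 → ℝ} (hz : Tst z) (hg : BC g)
    (hP : ∀ p, - g p ≤ Pop a b c κ z p) (hg0 : ∀ p, 0 ≤ g p) :
    κ ^ 2 * ∫ p, (max (z p) 0) ^ 2 ≤ 8 * N1 δ * ∫ p, g p ^ 2 := by
  have hN := N1_pos hδ
  choose C hC using fun n => moll_scoef hδ hA (bmf_tst n) (fun p => (bmp n).nonneg_normed p)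
    ((bmp n).integral_normed (μ := volume))
  have h1 : ∀ n, κ ^ 2 * ∫ p, (max (z p) 0) ^ 2 ≤ 8 * N1 δ *
      ∫ p, (max (- Pop (Cv a (bmf n)) (Cv b (bmf n)) (Cv c (bmf n)) κ z p) 0) ^ 2 := by
    intro n
    refine lem3 hδ hδ1 (hC n) hκ hz (bc_Pop hδ (hC n).toCoef κ hz).neg.max0 fun p => ?_
    have := le_max_left (- Pop (Cv a (bmf n)) (Cv b (bmf n)) (Cv c (bmf n)) κ z p) 0
    linarith
  have b0 := hz.bc.absf
  have b3 := (hz.dv ee0).bc.absf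
  have b4 := ((hz.dv ee1).dv ee1).bc.absf
  have b5 := ((hz.dv ee2).dv ee1).bc.absf
  have b6 := ((hz.dv ee2).dv ee2).bc.absf
  have h2 : Tendsto (fun n => ∫ p, (max (- Pop (Cv a (bmf n)) (Cv b (bmf n)) (Cv c (bmf n)) κ z p) 0) ^ 2)
      atTop (nhds (∫ p, (max (- Pop a b c κ z p) 0) ^ 2)) := by
    refine tendsto_integral_of_dominated_convergence (fun p => (|dv ee0 z p| +
      (δ⁻¹ * |dv ee1 (dv ee1 z) p| + 2 * δ⁻¹ * |dv ee1 (dv ee2 z) p| + δ⁻¹ * |dv ee2 (dv ee2 z) p|)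
        + κ * |z p|) ^ 2) (fun n => ?_) (BC.int (by fun_prop)) (fun n => ae_of_all _ fun p => ?_) ?_
    · exact (bc_Pop hδ (hC n).toCoef κ hz).neg.max0.sq.1.1.aestronglyMeasurable
    · have hc := (hC n).toCoef
      have ha : |Cv a (bmf n) p| ≤ δ⁻¹ := abs_le.2 ⟨by have := hc.a_lo p; have := inv_pos.2 hδ; linarith, hc.a_hi p⟩
      have hb := hc.b_hi hδ p
      have hc' : |Cv c (bmf n) p| ≤ δ⁻¹ := abs_le.2 ⟨by have := hc.c_lo p; have := inv_pos.2 hδ; linarith, hc.c_hi p⟩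
      rw [Real.norm_eq_abs, abs_of_nonneg (by positivity)]
      refine pow_le_pow_left₀ (le_max_right _ _) (max_le ?_ (by have := inv_pos.2 hδ; positivity)) 2
      refine (neg_le_abs _).trans ?_
      unfold Pop
      set X := dv ee1 (dv ee1 z) p
      set Y := dv ee1 (dv ee2 z) p
      set Z := dv ee2 (dv ee2 z) p
      refine (abs_sub _ _).trans (add_le_add ((abs_add_le _ _).trans (add_le_add (by rw [abs_neg])
        ((abs_add_le _ _).trans (add_le_add ((abs_add_le _ _).trans (add_le_add ?_ ?_)) ?_)))) ?_)
      · rw [abs_mul]; gcongr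
      · rw [abs_mul, abs_mul, abs_two]; gcongr
      · rw [abs_mul]; gcongr
      · rw [abs_mul, abs_of_nonneg hκ]
    · filter_upwards [bmf_tendsto (hA.bma hδ), bmf_tendsto (hA.bmb hδ), bmf_tendsto (hA.bmc hδ)] with p h1 h2 h3
      unfold Pop
      exact (((((((h1.mul_const _).add ((h2.const_mul 2).mul_const _)).add (h3.mul_const _)).const_add _).sub_const _).neg).max
        tendsto_const_nhds).pow 2
  have h3 := ge_of_tendsto' (h2.const_mul (8 * N1 δ)) h1
  refine h3.trans (mul_le_mul_of_nonneg_left ?_ (by positivity))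
  refine integral_mono (bc_Pop hδ hA κ hz).neg.max0.sq.int hg.sq.int fun p => ?_
  exact pow_le_pow_left₀ (le_max_right _ _) (max_le (by linarith [hP p]) (hg0 p)) 2



structure XCoef (δ r : ℝ) (a b c β1 β2 γ : E3 → ℝ) : Prop extends Coef δ a b c where
  mβ1 : Measurable β1
  mβ2 : Measurable β2
  mγ : Measurable γ
  xlo : ∀ p x y s, δ * (x ^ 2 + y ^ 2 + s ^ 2 * r ^ 2) ≤
    a p * x ^ 2 + 2 * b p * x * y + c p * y ^ 2 + 2 * s * (β1 p * x + β2 p * y) + s ^ 2 * γ p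
  xhi : ∀ p x y s, a p * x ^ 2 + 2 * b p * x * y + c p * y ^ 2 + 2 * s * (β1 p * x + β2 p * y) + s ^ 2 * γ p
    ≤ δ⁻¹ * (x ^ 2 + y ^ 2 + s ^ 2 * r ^ 2)

def F1 (a b c β1 β2 γ : E3 → ℝ) (lam : ℝ) (v1 v2 : E3 → ℝ) : E3 → ℝ := fun p =>
  Pop a b c lam v1 p - 2 * (β1 p * dv ee1 v2 p + β2 p * dv ee2 v2 p) - γ p * v1 p
def F2 (a b c β1 β2 γ : E3 → ℝ) (lam : ℝ) (v1 v2 : E3 → ℝ) : E3 → ℝ := fun p =>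
  Pop a b c lam v2 p + 2 * (β1 p * dv ee1 v1 p + β2 p * dv ee2 v1 p) - γ p * v2 p

namespace XCoef
variable {δ r : ℝ} {a b c β1 β2 γ : E3 → ℝ}

lemma g_lo (hδ : 0 < δ) (h : XCoef δ r a b c β1 β2 γ) (p) : 0 ≤ γ p := by
  have := h.xlo p 0 0 1
  have : 0 ≤ δ * r ^ 2 := by positivity
  simp at *; linarith
lemma g_hi (h : XCoef δ r a b c β1 β2 γ) (p) : γ p ≤ δ⁻¹ * r ^ 2 := by
  have := h.xhi p 0 0 1
  simp at *; linarith
lemma b1_hi (hδ : 0 < δ) (hr : 0 ≤ r) (h : XCoef δ r a b c β1 β2 γ) (p) : |β1 p| ≤ δ⁻¹ * r := by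
  have hi := inv_pos.2 hδ
  rcases eq_or_lt_of_le hr with h0 | h0
  · subst h0
    have hg : γ p = 0 := le_antisymm (by simpa using h.g_hi p) (h.g_lo hδ p)
    have hb : β1 p = 0 := by
      by_contra hne
      have h1 := h.xlo p 1 0 (-(a p + 1) / (2 * β1 p))
      rw [hg] at h1
      have h2 : 2 * (-(a p + 1) / (2 * β1 p)) * (β1 p * 1 + β2 p * 0) = -(a p + 1) := by field_simp; ring
      rw [h2] at h1
      norm_num at h1
      linarith
    simp [hb]
  · have h1 := h.xhi p r 0 1
    have h2 := h.xhi p r 0 (-1)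
    have h3 := h.xlo p r 0 1
    have h4 := h.xlo p r 0 (-1)
    have h5 : 0 ≤ δ * r ^ 2 := by positivity
    rw [abs_le]
    constructor
    · refine le_of_mul_le_mul_right ?_ h0
      nlinarith
    · refine le_of_mul_le_mul_right ?_ h0
      nlinarith
lemma b2_hi (hδ : 0 < δ) (hr : 0 ≤ r) (h : XCoef δ r a b c β1 β2 γ) (p) : |β2 p| ≤ δ⁻¹ * r := by
  have hi := inv_pos.2 hδ
  rcases eq_or_lt_of_le hr with h0 | h0
  · subst h0
    have hg : γ p = 0 := le_antisymm (by simpa using h.g_hi p) (h.g_lo hδ p)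
    have hb : β2 p = 0 := by
      by_contra hne
      have h1 := h.xlo p 0 1 (-(c p + 1) / (2 * β2 p))
      rw [hg] at h1
      have h2 : 2 * (-(c p + 1) / (2 * β2 p)) * (β1 p * 0 + β2 p * 1) = -(c p + 1) := by field_simp; ring
      rw [h2] at h1
      norm_num at h1
      linarith
    simp [hb]
  · have h1 := h.xhi p 0 r 1
    have h2 := h.xhi p 0 r (-1)
    have h3 := h.xlo p 0 r 1
    have h4 := h.xlo p 0 r (-1)
    have h5 : 0 ≤ δ * r ^ 2 := by positivity
    rw [abs_le]
    constructor
    · refine le_of_mul_le_mul_right ?_ h0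
      nlinarith
    · refine le_of_mul_le_mul_right ?_ h0
      nlinarith
lemma bg (hδ : 0 < δ) (h : XCoef δ r a b c β1 β2 γ) : BM γ :=
  ⟨h.mγ, δ⁻¹ * r ^ 2, fun p => by rw [abs_of_nonneg (h.g_lo hδ p)]; exact h.g_hi p⟩
lemma bb1 (hδ : 0 < δ) (hr : 0 ≤ r) (h : XCoef δ r a b c β1 β2 γ) : BM β1 := ⟨h.mβ1, _, h.b1_hi hδ hr⟩
lemma bb2 (hδ : 0 < δ) (hr : 0 ≤ r) (h : XCoef δ r a b c β1 β2 γ) : BM β2 := ⟨h.mβ2, _, h.b2_hi hδ hr⟩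

lemma bcF1 (hδ : 0 < δ) (hr : 0 ≤ r) (h : XCoef δ r a b c β1 β2 γ) (lam : ℝ) {v1 v2 : E3 → ℝ}
    (h1 : Tst v1) (h2 : Tst v2) : BC (F1 a b c β1 β2 γ lam v1 v2) := by
  have := bc_Pop hδ h.toCoef lam h1
  have := h.bg hδ
  have := h.bb1 hδ hr
  have := h.bb2 hδ hr
  have := h1.bc
  have := (h2.dv ee1).bc
  have := (h2.dv ee2).bc
  unfold F1; fun_prop
lemma bcF2 (hδ : 0 < δ) (hr : 0 ≤ r) (h : XCoef δ r a b c β1 β2 γ) (lam : ℝ) {v1 v2 : E3 → ℝ}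
    (h1 : Tst v1) (h2 : Tst v2) : BC (F2 a b c β1 β2 γ lam v1 v2) := by
  have := bc_Pop hδ h.toCoef lam h2
  have := h.bg hδ
  have := h.bb1 hδ hr
  have := h.bb2 hδ hr
  have := h2.bc
  have := (h1.dv ee1).bc
  have := (h1.dv ee2).bc
  unfold F2; fun_prop
end XCoef

def Kz (η : ℝ) (v1 v2 : E3 → ℝ) : E3 → ℝ := fun p => √(v1 p * v1 p + v2 p * v2 p + η ^ 2) - η

lemma Kz_tst {η : ℝ} (hη : 0 < η) {v1 v2 : E3 → ℝ} (h1 : Tst v1) (h2 : Tst v2) : Tst (Kz η v1 v2) := by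
  constructor
  · unfold Kz
    refine ContDiff.sub (ContDiff.sqrt (((h1.1.mul h1.1).add (h2.1.mul h2.1)).add contDiff_const) fun p => ?_) contDiff_const
    nlinarith [mul_self_nonneg (v1 p), mul_self_nonneg (v2 p), sq_pos_of_pos hη]
  · have h3 := ((h1.mul h1).add (h2.mul h2)).2
    have := h3.comp_left (g := fun x => √(x + η ^ 2) - η) (by simp [Real.sqrt_sq hη.le])
    exact this

lemma Kz_nonneg {η : ℝ} (hη : 0 < η) (v1 v2 : E3 → ℝ) (p) : 0 ≤ Kz η v1 v2 p := by
  unfold Kz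
  rw [sub_nonneg]
  refine Real.le_sqrt_of_sq_le ?_
  nlinarith [mul_self_nonneg (v1 p), mul_self_nonneg (v2 p)]

lemma Kz_eq {η : ℝ} (hη : 0 < η) (v1 v2 : E3 → ℝ) :
    (fun p => Kz η v1 v2 p * Kz η v1 v2 p + (2 * η) * Kz η v1 v2 p) = fun p => v1 p * v1 p + v2 p * v2 p := by
  funext p
  unfold Kz
  have := Real.mul_self_sqrt (x := v1 p * v1 p + v2 p * v2 p + η ^ 2)
    (by nlinarith [mul_self_nonneg (v1 p), mul_self_nonneg (v2 p)])
  linear_combination this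

lemma Kz_d1 {η : ℝ} (hη : 0 < η) {v1 v2 : E3 → ℝ} (h1 : Tst v1) (h2 : Tst v2) (e : E3) :
    (fun p => Kz η v1 v2 p * dv e (Kz η v1 v2) p + η * dv e (Kz η v1 v2) p) =
      fun p => v1 p * dv e v1 p + v2 p * dv e v2 p := by
  have hz := Kz_tst hη h1 h2
  have h := congrArg (dv e) (Kz_eq hη v1 v2)
  rw [dv_add (hz.mul hz).diff (hz.cmul _).diff, dv_add (h1.mul h1).diff (h2.mul h2).diff,
    dv_mul hz.diff hz.diff, dv_mul h1.diff h1.diff, dv_mul h2.diff h2.diff, dv_cmul hz.diff] at h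
  funext p
  have := congrFun h p
  simp only at this
  linear_combination this / 2

lemma Kz_d2 {η : ℝ} (hη : 0 < η) {v1 v2 : E3 → ℝ} (h1 : Tst v1) (h2 : Tst v2) (e e' : E3) (p : E3) :
    (Kz η v1 v2 p + η) * dv e' (dv e (Kz η v1 v2)) p + dv e' (Kz η v1 v2) p * dv e (Kz η v1 v2) p =
      v1 p * dv e' (dv e v1) p + v2 p * dv e' (dv e v2) p + dv e' v1 p * dv e v1 p + dv e' v2 p * dv e v2 p := by
  have hz := Kz_tst hη h1 h2
  have h := congrArg (dv e') (Kz_d1 hη h1 h2 e)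
  rw [dv_add (hz.mul (hz.dv e)).diff ((hz.dv e).cmul _).diff,
    dv_add (h1.mul (h1.dv e)).diff (h2.mul (h2.dv e)).diff,
    dv_mul hz.diff (hz.dv e).diff, dv_mul h1.diff (h1.dv e).diff, dv_mul h2.diff (h2.dv e).diff,
    dv_cmul (hz.dv e).diff] at h
  have := congrFun h p
  simp only at this
  linear_combination this

/-- algebraic heart of the Kato inequality -/
lemma kato_alg {δ r a b c β1 β2 γ v1 v2 x1 y1 x2 y2 X Y ρ : ℝ} (hδ : 0 < δ)
    (xlo : ∀ x y s, δ * (x ^ 2 + y ^ 2 + s ^ 2 * r ^ 2) ≤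
      a * x ^ 2 + 2 * b * x * y + c * y ^ 2 + 2 * s * (β1 * x + β2 * y) + s ^ 2 * γ)
    (hρ : 0 < ρ) (hρ2 : v1 ^ 2 + v2 ^ 2 ≤ ρ ^ 2)
    (hX : ρ * X = v1 * x1 + v2 * x2) (hY : ρ * Y = v1 * y1 + v2 * y2) :
    δ * r ^ 2 * (v1 ^ 2 + v2 ^ 2) + (a * X ^ 2 + 2 * b * X * Y + c * Y ^ 2) ≤
      (a * x1 ^ 2 + 2 * b * x1 * y1 + c * y1 ^ 2 - 2 * v2 * (β1 * x1 + β2 * y1) + v2 ^ 2 * γ)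
      + (a * x2 ^ 2 + 2 * b * x2 * y2 + c * y2 ^ 2 + 2 * v1 * (β1 * x2 + β2 * y2) + v1 ^ 2 * γ) := by
  rcases eq_or_lt_of_le (show 0 ≤ v1 ^ 2 + v2 ^ 2 by positivity) with h0 | h0
  · have e1 : v1 = 0 := by nlinarith [sq_nonneg v1, sq_nonneg v2]
    have e2 : v2 = 0 := by nlinarith [sq_nonneg v1, sq_nonneg v2]
    subst e1; subst e2
    have eX : X = 0 := by simpa [hρ.ne'] using hX
    have eY : Y = 0 := by simpa [hρ.ne'] using hY
    subst eX; subst eY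
    have k1 := xlo x1 y1 0
    have k2 := xlo x2 y2 0
    have : 0 ≤ δ * (x1 ^ 2 + y1 ^ 2) := by positivity
    have : 0 ≤ δ * (x2 ^ 2 + y2 ^ 2) := by positivity
    norm_num at *
    linarith
  · refine le_of_mul_le_mul_left ?_ h0
    have k1 := xlo (-v2 * x1 + v1 * x2) (-v2 * y1 + v1 * y2) (v1 ^ 2 + v2 ^ 2)
    have k2 := xlo X Y 0
    have k3 : 0 ≤ a * X ^ 2 + 2 * b * X * Y + c * Y ^ 2 := by
      have : 0 ≤ δ * (X ^ 2 + Y ^ 2 + 0 ^ 2 * r ^ 2) := by positivity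
      linarith
    have k4 := mul_le_mul_of_nonneg_right hρ2 k3
    have k5 : 0 ≤ δ * ((-v2 * x1 + v1 * x2) ^ 2 + (-v2 * y1 + v1 * y2) ^ 2) := by positivity
    have k6 : ρ ^ 2 * (a * X ^ 2 + 2 * b * X * Y + c * Y ^ 2) =
      a * (v1 * x1 + v2 * x2) ^ 2 + 2 * b * (v1 * x1 + v2 * x2) * (v1 * y1 + v2 * y2)
        + c * (v1 * y1 + v2 * y2) ^ 2 := by rw [← hX, ← hY]; ring
    nlinarith

lemma kato_main {lam η a b c β1 β2 γ v1 v2 t1 t2 x1 y1 x2 y2 X Y T p1 q1 s1 p2 q2 s2 P Q S z f1 f2 : ℝ}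
    (d0 : z * T + η * T = v1 * t1 + v2 * t2)
    (d11 : (z + η) * P + X * X = v1 * p1 + v2 * p2 + x1 * x1 + x2 * x2)
    (d12 : (z + η) * Q + X * Y = v1 * q1 + v2 * q2 + x1 * y1 + x2 * y2)
    (d22 : (z + η) * S + Y * Y = v1 * s1 + v2 * s2 + y1 * y1 + y2 * y2)
    (hf1 : f1 = (-t1 + (a * p1 + 2 * b * q1 + c * s1) - lam * v1) - 2 * (β1 * x2 + β2 * y2) - γ * v1)
    (hf2 : f2 = (-t2 + (a * p2 + 2 * b * q2 + c * s2) - lam * v2) + 2 * (β1 * x1 + β2 * y1) - γ * v2) :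
    (z + η) * (-T + (a * P + 2 * b * Q + c * S)) =
      v1 * f1 + v2 * f2 + lam * (v1 ^ 2 + v2 ^ 2) +
      ((a * x1 ^ 2 + 2 * b * x1 * y1 + c * y1 ^ 2 - 2 * v2 * (β1 * x1 + β2 * y1) + v2 ^ 2 * γ)
      + (a * x2 ^ 2 + 2 * b * x2 * y2 + c * y2 ^ 2 + 2 * v1 * (β1 * x2 + β2 * y2) + v1 ^ 2 * γ))
      - (a * X ^ 2 + 2 * b * X * Y + c * Y ^ 2) := by
  linear_combination (-v1) * hf1 - v2 * hf2 - d0 + a * d11 + 2 * b * d12 + c * d22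

lemma kato_alg2 {δ r lam η a b c β1 β2 γ v1 v2 t1 t2 x1 y1 x2 y2 X Y T p1 q1 s1 p2 q2 s2 P Q S z f1 f2 : ℝ} (hδ : 0 < δ)
    (xlo : ∀ x y s, δ * (x ^ 2 + y ^ 2 + s ^ 2 * r ^ 2) ≤
      a * x ^ 2 + 2 * b * x * y + c * y ^ 2 + 2 * s * (β1 * x + β2 * y) + s ^ 2 * γ)
    (hlam : 0 ≤ lam) (hη : 0 < η) (hz0 : 0 ≤ z)
    (d0 : z * T + η * T = v1 * t1 + v2 * t2)
    (d1 : z * X + η * X = v1 * x1 + v2 * x2)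
    (d2 : z * Y + η * Y = v1 * y1 + v2 * y2)
    (d11 : (z + η) * P + X * X = v1 * p1 + v2 * p2 + x1 * x1 + x2 * x2)
    (d12 : (z + η) * Q + X * Y = v1 * q1 + v2 * q2 + x1 * y1 + x2 * y2)
    (d22 : (z + η) * S + Y * Y = v1 * s1 + v2 * s2 + y1 * y1 + y2 * y2)
    (hsq : z * z + (2 * η) * z = v1 * v1 + v2 * v2)
    (hf1 : f1 = (-t1 + (a * p1 + 2 * b * q1 + c * s1) - lam * v1) - 2 * (β1 * x2 + β2 * y2) - γ * v1)
    (hf2 : f2 = (-t2 + (a * p2 + 2 * b * q2 + c * s2) - lam * v2) + 2 * (β1 * x1 + β2 * y1) - γ * v2) :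
    -(|f1| + |f2|) ≤ -T + (a * P + 2 * b * Q + c * S) - (lam + δ * r ^ 2) * z := by
  obtain ⟨ρ, hρd⟩ : ∃ ρ, ρ = z + η := ⟨_, rfl⟩
  have hρ : 0 < ρ := by rw [hρd]; positivity
  have hv : v1 ^ 2 + v2 ^ 2 = z * (ρ + η) := by rw [hρd]; linear_combination -hsq
  have hle : v1 ^ 2 + v2 ^ 2 ≤ ρ ^ 2 := by
    have : ρ ^ 2 - z * (ρ + η) = η ^ 2 := by rw [hρd]; ring
    have := sq_nonneg η
    linarith
  have key := kato_alg hδ xlo hρ hle (X := X) (Y := Y)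
    (x1 := x1) (x2 := x2) (y1 := y1) (y2 := y2)
    (by rw [← d1, hρd]; ring) (by rw [← d2, hρd]; ring)
  have main := kato_main d0 d11 d12 d22 hf1 hf2
  rw [← hρd] at main
  clear hf1 hf2 d0 d1 d2 d11 d12 d22 xlo hsq
  generalize (a * x1 ^ 2 + 2 * b * x1 * y1 + c * y1 ^ 2 - 2 * v2 * (β1 * x1 + β2 * y1) + v2 ^ 2 * γ)
      + (a * x2 ^ 2 + 2 * b * x2 * y2 + c * y2 ^ 2 + 2 * v1 * (β1 * x2 + β2 * y2) + v1 ^ 2 * γ) = A1 at *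
  generalize a * X ^ 2 + 2 * b * X * Y + c * Y ^ 2 = A2 at *
  generalize -T + (a * P + 2 * b * Q + c * S) = A3 at *
  have a1 : |v1| ≤ ρ := abs_le_of_sq_le_sq (by linarith [sq_nonneg v2]) hρ.le
  have a2 : |v2| ≤ ρ := abs_le_of_sq_le_sq (by linarith [sq_nonneg v1]) hρ.le
  have g1 : -(ρ * |f1|) ≤ v1 * f1 := by
    have h3 := neg_abs_le (v1 * f1)
    rw [abs_mul] at h3
    have h4 := mul_le_mul_of_nonneg_right a1 (abs_nonneg f1)
    linarith
  have g2 : -(ρ * |f2|) ≤ v2 * f2 := by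
    have h3 := neg_abs_le (v2 * f2)
    rw [abs_mul] at h3
    have h4 := mul_le_mul_of_nonneg_right a2 (abs_nonneg f2)
    linarith
  have g3 : (lam + δ * r ^ 2) * (ρ * z) ≤ (lam + δ * r ^ 2) * (v1 ^ 2 + v2 ^ 2) := by
    refine mul_le_mul_of_nonneg_left ?_ (by positivity)
    rw [hv]
    have := mul_nonneg hz0 hη.le
    linarith
  refine le_of_mul_le_mul_left ?_ hρ
  linarith

lemma kato {δ r lam η : ℝ} {a b c β1 β2 γ : E3 → ℝ} (hδ : 0 < δ)
    (hA : XCoef δ r a b c β1 β2 γ) (hlam : 0 ≤ lam) (hη : 0 < η) {v1 v2 : E3 → ℝ} (h1 : Tst v1) (h2 : Tst v2) (p) :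
    -(|F1 a b c β1 β2 γ lam v1 v2 p| + |F2 a b c β1 β2 γ lam v1 v2 p|) ≤
      Pop a b c (lam + δ * r ^ 2) (Kz η v1 v2) p :=
  kato_alg2 hδ (hA.xlo p) hlam hη (Kz_nonneg hη v1 v2 p)
    (congrFun (Kz_d1 hη h1 h2 ee0) p) (congrFun (Kz_d1 hη h1 h2 ee1) p) (congrFun (Kz_d1 hη h1 h2 ee2) p)
    (Kz_d2 hη h1 h2 ee1 ee1 p) (Kz_d2 hη h1 h2 ee2 ee1 p) (Kz_d2 hη h1 h2 ee2 ee2 p)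
    (congrFun (Kz_eq hη v1 v2) p) rfl rfl

theorem lem5 {δ r lam : ℝ} {a b c β1 β2 γ : E3 → ℝ} (hδ : 0 < δ) (hδ1 : δ ≤ 1) (hr : 0 ≤ r)
    (hA : XCoef δ r a b c β1 β2 γ) (hlam : 0 ≤ lam) {v1 v2 : E3 → ℝ} (h1 : Tst v1) (h2 : Tst v2) :
    (lam + δ * r ^ 2) ^ 2 * ∫ p, (v1 p ^ 2 + v2 p ^ 2) ≤ 16 * N1 δ *
      ∫ p, (F1 a b c β1 β2 γ lam v1 v2 p ^ 2 + F2 a b c β1 β2 γ lam v1 v2 p ^ 2) := by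
  have hN := N1_pos hδ
  have c1 := hA.bcF1 hδ hr lam h1 h2
  have c2 := hA.bcF2 hδ hr lam h1 h2
  have c1a := c1.absf
  have c2a := c2.absf
  have b1 := h1.bc
  have b2 := h2.bc
  have k1 : ∀ n : ℕ, (lam + δ * r ^ 2) ^ 2 * ∫ p, (Kz (1 / ((n : ℝ) + 1)) v1 v2 p) ^ 2 ≤ 16 * N1 δ *
      ∫ p, (F1 a b c β1 β2 γ lam v1 v2 p ^ 2 + F2 a b c β1 β2 γ lam v1 v2 p ^ 2) := by
    intro n
    have hη : (0 : ℝ) < 1 / ((n : ℝ) + 1) := by positivity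
    have := lem4 hδ hδ1 hA.toCoef (κ := lam + δ * r ^ 2) (by positivity) (Kz_tst hη h1 h2)
      (c1a.add c2a) (kato hδ hA hlam hη h1 h2) (fun p => add_nonneg (abs_nonneg _) (abs_nonneg _))
    have hmx : ∀ p, max (Kz (1 / ((n : ℝ) + 1)) v1 v2 p) 0 = Kz (1 / ((n : ℝ) + 1)) v1 v2 p :=
      fun p => max_eq_left (Kz_nonneg hη v1 v2 p)
    simp only [hmx] at this
    refine this.trans ?_
    rw [show (16 : ℝ) * N1 δ = 8 * N1 δ * 2 by ring, mul_assoc (8 * N1 δ)]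
    refine mul_le_mul_of_nonneg_left ?_ (by positivity)
    rw [← integral_const_mul]
    refine integral_mono (BC.int (by fun_prop)) (BC.int (by fun_prop)) fun p => ?_
    beta_reduce
    set f1 := F1 a b c β1 β2 γ lam v1 v2 p
    set f2 := F2 a b c β1 β2 γ lam v1 v2 p
    nlinarith [sq_nonneg (|f1| - |f2|), sq_abs f1, sq_abs f2]
  have k2 : Tendsto (fun n : ℕ => ∫ p, (Kz (1 / ((n : ℝ) + 1)) v1 v2 p) ^ 2) atTop
      (nhds (∫ p, (v1 p ^ 2 + v2 p ^ 2))) := by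
    refine tendsto_integral_of_dominated_convergence (fun p => v1 p ^ 2 + v2 p ^ 2) (fun n => ?_)
      (BC.int (by fun_prop)) (fun n => ae_of_all _ fun p => ?_) (ae_of_all _ fun p => ?_)
    · exact (Kz_tst (by positivity) h1 h2).bc.sq.1.1.aestronglyMeasurable
    · have hη : (0 : ℝ) < 1 / ((n : ℝ) + 1) := by positivity
      have e1 := congrFun (Kz_eq hη v1 v2) p
      have e2 := Kz_nonneg hη v1 v2 p
      rw [Real.norm_eq_abs, abs_of_nonneg (by positivity)]
      beta_reduce at e1
      nlinarith [mul_nonneg hη.le e2]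
    · have e0 := tendsto_one_div_add_atTop_nhds_zero_nat (𝕜 := ℝ)
      have e1 : Continuous fun η : ℝ => (√(v1 p * v1 p + v2 p * v2 p + η ^ 2) - η) ^ 2 := by fun_prop
      have e2 := (e1.tendsto 0).comp e0
      have e3 : (√(v1 p * v1 p + v2 p * v2 p + 0 ^ 2) - 0) ^ 2 = v1 p ^ 2 + v2 p ^ 2 := by
        rw [sub_zero, Real.sq_sqrt (by nlinarith [mul_self_nonneg (v1 p), mul_self_nonneg (v2 p)])]; ring
      rw [e3] at e2
      exact e2
  exact le_of_tendsto' (k2.const_mul _) k1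



def N6 (δ : ℝ) : ℝ :=
  let A := 16 * N1 δ / δ ^ 2
  let e := δ ^ 2 / (96 * N1 δ)
  let B := 24 * N1 δ / δ ^ 2 / (4 * e) + 3 * N1 δ / δ ^ 2
  let C := 2 * (3 * N1 δ + B * A)
  C + (2 * e * C + A / (4 * e)) + A

lemma N6_pos {δ : ℝ} (hδ : 0 < δ) : 0 < N6 δ := by
  have := N1_pos hδ
  simp only [N6]; positivity

lemma grad_sq {v : E3 → ℝ} (hv : Tst v) {e : E3} (he : e.1 = 0) :
    ∫ p, dv e v p ^ 2 = - ∫ p, v p * dv e (dv e v) p := by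
  have h1 := null_x (m := fun _ => 1) (BM.const 1) (fun _ _ _ _ => rfl) he (hv.mul (hv.dv e))
  rw [dv_mul hv.diff (hv.dv e).diff] at h1
  simp only [one_mul] at h1
  have b0 := hv.bc
  have b1 := (hv.dv e).bc
  have b2 := ((hv.dv e).dv e).bc
  have c0 := b0.bm
  have c1 := b1.bm
  rw [integral_add (BC.int (by fun_prop)) (BC.int (by fun_prop))] at h1
  have : ∫ p, dv e v p ^ 2 = ∫ p, dv e v p * dv e v p := by congr 1; funext p; ring
  rw [this]; linarith

lemma interp {v : E3 → ℝ} (hv : Tst v) (lam : ℝ) (hl : 0 ≤ lam) {r e : ℝ} (he : 0 < e) :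
    r ^ 2 * ∫ p, (dv ee1 v p ^ 2 + dv ee2 v p ^ 2) ≤ 2 * e * (∫ p, Jq lam v p)
      + 1 / (4 * e) * (r ^ 4 * ∫ p, v p ^ 2) := by
  have b0 := hv.bc
  have b1 := (hv.dv ee1).bc
  have b2 := (hv.dv ee2).bc
  have b3 := (hv.dv ee0).bc
  have b4 := ((hv.dv ee1).dv ee1).bc
  have b5 := ((hv.dv ee2).dv ee1).bc
  have b6 := ((hv.dv ee2).dv ee2).bc
  have c0 := b0.bm
  have cJ : BC (Jq lam v) := by unfold Jq; fun_prop
  have e1 : ∫ p, (dv ee1 v p ^ 2 + dv ee2 v p ^ 2) = ∫ p, - (v p * (dv ee1 (dv ee1 v) p + dv ee2 (dv ee2 v) p)) := by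
    rw [integral_add (BC.int (by fun_prop)) (BC.int (by fun_prop)), grad_sq hv rfl, grad_sq hv rfl,
      ← integral_neg, ← integral_neg, ← integral_add (BC.int (by fun_prop)) (BC.int (by fun_prop))]
    congr 1; funext p; ring
  rw [e1, ← integral_const_mul, ← integral_const_mul, ← integral_const_mul, ← integral_const_mul,
    ← integral_add (BC.int (by fun_prop)) (BC.int (by fun_prop))]
  refine integral_mono (BC.int (by fun_prop)) (BC.int (by fun_prop)) fun p => ?_
  beta_reduce
  have j1 : dv ee1 (dv ee1 v) p ^ 2 + dv ee2 (dv ee2 v) p ^ 2 ≤ Jq lam v p := by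
    unfold Jq
    have : 0 ≤ dv ee0 v p ^ 2 + lam ^ 2 * v p ^ 2 + lam * (dv ee1 v p ^ 2 + dv ee2 v p ^ 2)
      + 2 * dv ee1 (dv ee2 v) p ^ 2 := by positivity
    linarith
  generalize Jq lam v p = J at *
  generalize dv ee1 (dv ee1 v) p = X at *
  generalize dv ee2 (dv ee2 v) p = Z at *
  have j2 : (X + Z) ^ 2 ≤ 2 * J := by nlinarith [sq_nonneg (X - Z)]
  have j3 : r ^ 2 * -(v p * (X + Z)) ≤ e * (X + Z) ^ 2 + 1 / (4 * e) * (r ^ 4 * v p ^ 2) := by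
    have : e * (X + Z) ^ 2 + 1 / (4 * e) * (r ^ 4 * v p ^ 2) - r ^ 2 * -(v p * (X + Z))
      = e * ((X + Z) + r ^ 2 * v p / (2 * e)) ^ 2 := by field_simp; ring
    have h2 : 0 ≤ e * ((X + Z) + r ^ 2 * v p / (2 * e)) ^ 2 := by positivity
    linarith
  have j4 := mul_le_mul_of_nonneg_left j2 he.le
  linarith

def JJ (r lam : ℝ) (v1 v2 : E3 → ℝ) : E3 → ℝ := fun p =>
  Jq lam v1 p + Jq lam v2 p + r ^ 2 * (dv ee1 v1 p ^ 2 + dv ee2 v1 p ^ 2 + dv ee1 v2 p ^ 2 + dv ee2 v2 p ^ 2)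
    + r ^ 4 * (v1 p ^ 2 + v2 p ^ 2)

lemma pert_alg {δ r β1 β2 γ f x y v P : ℝ} (hδ : 0 < δ) (h1 : |β1| ≤ δ⁻¹ * r) (h2 : |β2| ≤ δ⁻¹ * r)
    (h3 : 0 ≤ γ) (h4 : γ ≤ δ⁻¹ * r ^ 2) (h5 : |P| = |f + 2 * (β1 * x + β2 * y) + γ * v|) :
    P ^ 2 ≤ 3 * f ^ 2 + 24 / δ ^ 2 * (r ^ 2 * (x ^ 2 + y ^ 2)) + 3 / δ ^ 2 * (r ^ 4 * v ^ 2) := by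
  have k1 : β1 ^ 2 ≤ (δ⁻¹ * r) ^ 2 := sq_le_sq' (by linarith [abs_le.1 h1]) (abs_le.1 h1).2
  have k2 : β2 ^ 2 ≤ (δ⁻¹ * r) ^ 2 := sq_le_sq' (by linarith [abs_le.1 h2]) (abs_le.1 h2).2
  have k3 : γ ^ 2 ≤ (δ⁻¹ * r ^ 2) ^ 2 := pow_le_pow_left₀ h3 h4 2
  rw [← sq_abs P, h5, sq_abs]
  have m1 : (f + 2 * (β1 * x + β2 * y) + γ * v) ^ 2 ≤ 3 * f ^ 2 + 12 * (β1 * x + β2 * y) ^ 2 + 3 * (γ ^ 2 * v ^ 2) := by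
    nlinarith [sq_nonneg (f - 2 * (β1 * x + β2 * y)), sq_nonneg (f - γ * v), sq_nonneg (2 * (β1 * x + β2 * y) - γ * v)]
  have m2 : (β1 * x + β2 * y) ^ 2 ≤ 2 * (β1 ^ 2 * x ^ 2 + β2 ^ 2 * y ^ 2) := by
    nlinarith [sq_nonneg (β1 * x - β2 * y)]
  have m3 := mul_le_mul_of_nonneg_right k1 (sq_nonneg x)
  have m4 := mul_le_mul_of_nonneg_right k2 (sq_nonneg y)
  have m5 := mul_le_mul_of_nonneg_right k3 (sq_nonneg v)
  have m6 : 3 * f ^ 2 + 24 / δ ^ 2 * (r ^ 2 * (x ^ 2 + y ^ 2)) + 3 / δ ^ 2 * (r ^ 4 * v ^ 2)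
    = 3 * f ^ 2 + 24 * ((δ⁻¹ * r) ^ 2 * x ^ 2 + (δ⁻¹ * r) ^ 2 * y ^ 2) + 3 * ((δ⁻¹ * r ^ 2) ^ 2 * v ^ 2) := by
    field_simp
  rw [m6]; linarith

theorem lem6 {δ r lam : ℝ} {a b c β1 β2 γ : E3 → ℝ} (hδ : 0 < δ) (hδ1 : δ ≤ 1) (hr : 0 ≤ r)
    (hA : XCoef δ r a b c β1 β2 γ) (hlam : 0 ≤ lam) {v1 v2 : E3 → ℝ} (h1 : Tst v1) (h2 : Tst v2) :
    BC (JJ r lam v1 v2) ∧ ∫ p, JJ r lam v1 v2 p ≤ N6 δ *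
      ∫ p, (F1 a b c β1 β2 γ lam v1 v2 p ^ 2 + F2 a b c β1 β2 γ lam v1 v2 p ^ 2) := by
  have hN := N1_pos hδ
  have c1 := hA.bcF1 hδ hr lam h1 h2
  have c2 := hA.bcF2 hδ hr lam h1 h2
  have b0 := h1.bc
  have b1 := (h1.dv ee1).bc
  have b2 := (h1.dv ee2).bc
  have b3 := (h1.dv ee0).bc
  have b4 := ((h1.dv ee1).dv ee1).bc
  have b5 := ((h1.dv ee2).dv ee1).bc
  have b6 := ((h1.dv ee2).dv ee2).bc
  have d0 := h2.bc
  have d1 := (h2.dv ee1).bc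
  have d2 := (h2.dv ee2).bc
  have d3 := (h2.dv ee0).bc
  have d4 := ((h2.dv ee1).dv ee1).bc
  have d5 := ((h2.dv ee2).dv ee1).bc
  have d6 := ((h2.dv ee2).dv ee2).bc
  have cJ1 : BC (Jq lam v1) := by unfold Jq; fun_prop
  have cJ2 : BC (Jq lam v2) := by unfold Jq; fun_prop
  have cP1 := bc_Pop hδ hA.toCoef lam h1
  have cP2 := bc_Pop hδ hA.toCoef lam h2
  refine ⟨by unfold JJ; fun_prop, ?_⟩
  have ap1 := apriori hδ hδ1 hA.toCoef wt_one hlam h1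
  have ap2 := apriori hδ hδ1 hA.toCoef wt_one hlam h2
  simp only [one_mul] at ap1 ap2
  have l5 := lem5 hδ hδ1 hr hA hlam h1 h2
  set F := ∫ p, (F1 a b c β1 β2 γ lam v1 v2 p ^ 2 + F2 a b c β1 β2 γ lam v1 v2 p ^ 2) with hF
  have hF0 : 0 ≤ F := integral_nonneg fun p => by positivity
  have sV : ∫ p, (v1 p ^ 2 + v2 p ^ 2) = (∫ p, v1 p ^ 2) + ∫ p, v2 p ^ 2 :=
    integral_add (BC.int (by fun_prop)) (BC.int (by fun_prop))
  have sF : F = (∫ p, F1 a b c β1 β2 γ lam v1 v2 p ^ 2) + ∫ p, F2 a b c β1 β2 γ lam v1 v2 p ^ 2 :=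
    integral_add (BC.int (by fun_prop)) (BC.int (by fun_prop))
  have sJ : ∫ p, JJ r lam v1 v2 p = (∫ p, Jq lam v1 p) + (∫ p, Jq lam v2 p)
      + (r ^ 2 * (∫ p, (dv ee1 v1 p ^ 2 + dv ee2 v1 p ^ 2)) + r ^ 2 * (∫ p, (dv ee1 v2 p ^ 2 + dv ee2 v2 p ^ 2)))
      + (r ^ 4 * (∫ p, v1 p ^ 2) + r ^ 4 * ∫ p, v2 p ^ 2) := by
    rw [← integral_const_mul, ← integral_const_mul, ← integral_const_mul, ← integral_const_mul,
      ← integral_add (BC.int (by fun_prop)) (BC.int (by fun_prop)),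
      ← integral_add (BC.int (by fun_prop)) (BC.int (by fun_prop)),
      ← integral_add (BC.int (by fun_prop)) (BC.int (by fun_prop)),
      ← integral_add (BC.int (by fun_prop)) (BC.int (by fun_prop)),
      ← integral_add (BC.int (by fun_prop)) (BC.int (by fun_prop))]
    congr 1; funext p; unfold JJ; ring
  have q1 : ∫ p, Pop a b c lam v1 p ^ 2 ≤ 3 * (∫ p, F1 a b c β1 β2 γ lam v1 v2 p ^ 2) +
      24 / δ ^ 2 * (r ^ 2 * ∫ p, (dv ee1 v2 p ^ 2 + dv ee2 v2 p ^ 2)) + 3 / δ ^ 2 * (r ^ 4 * ∫ p, v1 p ^ 2) := by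
    simp only [← integral_const_mul]
    rw [← integral_add (BC.int (by fun_prop)) (BC.int (by fun_prop)),
      ← integral_add (BC.int (by fun_prop)) (BC.int (by fun_prop))]
    refine integral_mono (BC.int (by fun_prop)) (BC.int (by fun_prop)) fun p => ?_
    exact pert_alg hδ (hA.b1_hi hδ hr p) (hA.b2_hi hδ hr p) (hA.g_lo hδ p) (hA.g_hi p)
      (by congr 1; unfold F1; ring)
  have q2 : ∫ p, Pop a b c lam v2 p ^ 2 ≤ 3 * (∫ p, F2 a b c β1 β2 γ lam v1 v2 p ^ 2) +
      24 / δ ^ 2 * (r ^ 2 * ∫ p, (dv ee1 v1 p ^ 2 + dv ee2 v1 p ^ 2)) + 3 / δ ^ 2 * (r ^ 4 * ∫ p, v2 p ^ 2) := by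
    simp only [← integral_const_mul]
    rw [← integral_add (BC.int (by fun_prop)) (BC.int (by fun_prop)),
      ← integral_add (BC.int (by fun_prop)) (BC.int (by fun_prop))]
    refine integral_mono (BC.int (by fun_prop)) (BC.int (by fun_prop)) fun p => ?_
    have := pert_alg (f := - F2 a b c β1 β2 γ lam v1 v2 p) (x := dv ee1 v1 p) (y := dv ee2 v1 p)
      (v := - v2 p) (P := Pop a b c lam v2 p)
      hδ (hA.b1_hi hδ hr p) (hA.b2_hi hδ hr p) (hA.g_lo hδ p) (hA.g_hi p)
      (by rw [← abs_neg]; congr 1; unfold F2; ring)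
    simpa only [neg_sq] using this
  have hr4 : r ^ 4 * ((∫ p, v1 p ^ 2) + ∫ p, v2 p ^ 2) ≤ 16 * N1 δ / δ ^ 2 * F := by
    rw [sV] at l5
    set V := (∫ p, v1 p ^ 2) + ∫ p, v2 p ^ 2
    have hV : 0 ≤ V := add_nonneg (integral_nonneg fun p => sq_nonneg _) (integral_nonneg fun p => sq_nonneg _)
    have t1 : (δ * r ^ 2) ^ 2 * V ≤ (lam + δ * r ^ 2) ^ 2 * V := by gcongr; linarith
    have t2 := t1.trans l5
    rw [div_mul_eq_mul_div, le_div_iff₀ (by positivity)]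
    linarith
  obtain ⟨e, he⟩ : ∃ e, e = δ ^ 2 / (96 * N1 δ) := ⟨_, rfl⟩
  have he0 : 0 < e := by rw [he]; positivity
  have i1 := interp h1 lam hlam (r := r) he0
  have i2 := interp h2 lam hlam (r := r) he0
  obtain ⟨A, hAd⟩ : ∃ A, A = 16 * N1 δ / δ ^ 2 := ⟨_, rfl⟩
  obtain ⟨B, hBd⟩ : ∃ B, B = 24 * N1 δ / δ ^ 2 / (4 * e) + 3 * N1 δ / δ ^ 2 := ⟨_, rfl⟩
  have hB0 : 0 ≤ B := by rw [hBd]; positivity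
  have hN6 : N6 δ = 2 * (3 * N1 δ + B * A) + (2 * e * (2 * (3 * N1 δ + B * A)) + A / (4 * e)) + A := by
    simp only [N6, hBd, hAd, he]
  rw [sJ, hN6]
  rw [← hAd] at hr4
  rw [sF] at hr4 hF0 ⊢
  generalize (∫ p, F1 a b c β1 β2 γ lam v1 v2 p ^ 2) = FF1 at *
  generalize (∫ p, F2 a b c β1 β2 γ lam v1 v2 p ^ 2) = FF2 at *
  generalize (∫ p, Jq lam v1 p) = J1 at *
  generalize (∫ p, Jq lam v2 p) = J2 at *
  generalize (∫ p, v1 p ^ 2) = V1 at *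
  generalize (∫ p, v2 p ^ 2) = V2 at *
  generalize (∫ p, (dv ee1 v1 p ^ 2 + dv ee2 v1 p ^ 2)) = D1 at *
  generalize (∫ p, (dv ee1 v2 p ^ 2 + dv ee2 v2 p ^ 2)) = D2 at *
  generalize (∫ p, Pop a b c lam v1 p ^ 2) = P1 at *
  generalize (∫ p, Pop a b c lam v2 p ^ 2) = P2 at *
  clear sJ sF sV l5
  have n1 := mul_le_mul_of_nonneg_left q1 hN.le
  have n2 := mul_le_mul_of_nonneg_left q2 hN.le
  have hco : N1 δ * (24 / δ ^ 2) * (2 * e) = 1 / 2 := by rw [he]; field_simp; norm_num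
  have i3 := mul_le_mul_of_nonneg_left (add_le_add i1 i2) (show 0 ≤ N1 δ * (24 / δ ^ 2) by positivity)
  have i4 : N1 δ * (24 / δ ^ 2) * ((2 * e * J1 + 1 / (4 * e) * (r ^ 4 * V1)) + (2 * e * J2 + 1 / (4 * e) * (r ^ 4 * V2)))
     = 1 / 2 * (J1 + J2) + N1 δ * (24 / δ ^ 2) * (1 / (4 * e)) * (r ^ 4 * (V1 + V2)) := by
    rw [← hco]; ring
  rw [i4] at i3
  have hBe : N1 δ * (24 / δ ^ 2) * (1 / (4 * e)) * (r ^ 4 * (V1 + V2)) + N1 δ * (3 / δ ^ 2) * (r ^ 4 * (V1 + V2))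
      = B * (r ^ 4 * (V1 + V2)) := by rw [hBd]; ring
  have m1 := mul_le_mul_of_nonneg_left hr4 hB0
  have hJ : J1 + J2 ≤ 2 * (3 * N1 δ + B * A) * (FF1 + FF2) := by
    linarith
  have m2 := mul_le_mul_of_nonneg_left hJ (show 0 ≤ 2 * e by positivity)
  have m3 := mul_le_mul_of_nonneg_left hr4 (show 0 ≤ 1 / (4 * e) by positivity)
  have m4 : A / (4 * e) = 1 / (4 * e) * A := by ring
  rw [m4]
  linarith



section trans
variable {V Y : Type*} [NormedAddCommGroup V] [NormedSpace ℝ V]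
  [NormedAddCommGroup Y] [NormedSpace ℝ Y] [FiniteDimensional ℝ Y]
  [MeasurableSpace Y] [BorelSpace Y] {μ : Measure Y} [μ.IsAddHaarMeasure]

def TI (μ : Measure Y) (K : Y → ℝ) (g : V × Y → ℝ) (p : V) : ℝ := ∫ y, K y * g (p, y) ∂μ

lemma Tst.slice {g : V × Y → ℝ} (h : Tst g) (p : V) : Tst (fun y => g (p, y)) := by
  refine ⟨h.1.comp (contDiff_const.prodMk contDiff_id), ?_⟩
  refine HasCompactSupport.of_support_subset_isCompact (h.2.isCompact.image continuous_snd) ?_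
  intro y hy
  exact ⟨(p, y), subset_tsupport _ hy, rfl⟩

lemma slice_zero {g : V × Y → ℝ} (p : V) (y : Y) (hy : y ∉ Prod.snd '' tsupport g) :
    g (p, y) = 0 := by
  by_contra hne
  exact hy ⟨(p, y), subset_tsupport _ hne, rfl⟩

lemma TI_tst {K : Y → ℝ} (hK : Continuous K) {g : V × Y → ℝ} (h : Tst g) :
    Tst (TI μ K g) := by
  constructor
  · have hk : IsCompact (Neg.neg '' (Prod.snd '' tsupport g)) :=
      (h.2.isCompact.image continuous_snd).image continuous_neg
    have := contDiffOn_convolution_right_with_param_comp (𝕜 := ℝ) (n := (⊤ : ℕ∞)) (μ := μ)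
      (ContinuousLinearMap.mul ℝ ℝ) (s := (univ : Set V)) (v := fun _ => (0 : Y))
      contDiffOn_const (f := K) (g := fun p z => g (p, -z)) isOpen_univ hk
      (fun p x _ hx => slice_zero p _ (fun hh => hx ⟨-x, hh, by simp⟩))
      hK.locallyIntegrable
      ((h.1.comp (contDiff_fst.prodMk contDiff_snd.neg)).contDiffOn)
    rw [contDiffOn_univ] at this
    simp [convolution] at this
    exact this
  · refine HasCompactSupport.of_support_subset_isCompact (h.2.isCompact.image continuous_fst) ?_
    intro p hp
    by_contra hne
    apply hp
    have : ∀ y, K y * g (p, y) = 0 := by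
      intro y
      have : g (p, y) = 0 := by
        by_contra h'
        exact hne ⟨(p, y), subset_tsupport _ h', rfl⟩
      rw [this, mul_zero]
    simp [TI, this]

lemma TI_dv {K : Y → ℝ} (hK : Continuous K) {g : V × Y → ℝ} (h : Tst g) (e : V) :
    dv e (TI μ K g) = TI μ K (dv ((e, 0) : V × Y) g) := by
  funext p
  have h1 : HasDerivAt (fun s : ℝ => TI μ K g (p + s • e)) (dv e (TI μ K g) p) 0 :=
    hasLineDerivAt_dv (TI_tst (μ := μ) hK h).diff e p
  obtain ⟨M, hM⟩ := (h.dv (e, 0)).cont.bounded_above_of_compact_support (h.dv (e, 0)).2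
  set k := Prod.snd '' tsupport (dv ((e, 0) : V × Y) g) with hk
  have hkc : IsCompact k := (h.dv (e, 0)).2.isCompact.image continuous_snd
  have h2 := (hasDerivAt_integral_of_dominated_loc_of_deriv_le (μ := μ) (x₀ := (0 : ℝ))
    (F := fun s y => K y * g (p + s • e, y))
    (F' := fun s y => K y * dv ((e, 0) : V × Y) g (p + s • e, y)) (s := univ)
    (bound := k.indicator (fun y => |K y| * M)) univ_mem
    (Eventually.of_forall fun s => (hK.mul ((h.slice _).cont)).aestronglyMeasurable)
    ((hK.mul ((h.slice _).cont)).integrable_of_hasCompactSupport (h.slice _).2.mul_left)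
    (hK.mul (((h.dv _).slice _).cont)).aestronglyMeasurable
    (Eventually.of_forall fun y s _ => ?_) ?_
    (Eventually.of_forall fun y s _ => ?_)).2
  · have := h1.unique h2
    rw [this]; simp [TI]
  · by_cases hy : y ∈ k
    · rw [indicator_of_mem hy, norm_mul]
      exact mul_le_mul_of_nonneg_left (hM _) (abs_nonneg _)
    · rw [indicator_of_notMem hy, slice_zero _ y hy]; simp
  · rw [integrable_indicator_iff hkc.isClosed.measurableSet]
    exact ((hK.abs.mul continuous_const).continuousOn).integrableOn_compact hkc
  · apply HasDerivAt.const_mul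
    have h3 : HasDerivAt (fun s : ℝ => ((p + s • e, y) : V × Y)) (e, 0) s := by
      apply HasDerivAt.prodMk
      · simpa using ((hasDerivAt_id s).smul_const e).const_add p
      · exact hasDerivAt_const _ _
    exact (h.diff _).hasFDerivAt.comp_hasDerivAt s h3

lemma dv_slice {g : V × Y → ℝ} (h : Tst g) (e : Y) (p : V) :
    dv e (fun y => g (p, y)) = fun y => dv ((0, e) : V × Y) g (p, y) := by
  funext y
  have h3 : HasFDerivAt (fun y : Y => ((p, y) : V × Y)) (ContinuousLinearMap.inr ℝ V Y) y :=
    hasFDerivAt_prodMk_right p y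
  have := ((h.diff (p, y)).hasFDerivAt.comp y h3).fderiv
  simp only [dv]
  change fderiv ℝ (g ∘ fun y => (p, y)) y e = _
  rw [this]; simp

lemma TI_ibp {K K' : Y → ℝ} (hK : BM K) (hK' : BM K') {g : V × Y → ℝ} (h : Tst g) (e : Y)
    (hd : ∀ y, HasLineDerivAt ℝ K (K' y) y e) (p : V) :
    TI μ K (dv ((0, e) : V × Y) g) p = - TI μ K' g p := by
  have h1 := ibp (μ := μ) hK hK' (h.slice p).bc (((h.slice p).dv e).bc) hd
    (fun y => hasLineDerivAt_dv (h.slice p).diff e y)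
  rw [dv_slice h] at h1
  rw [integral_add] at h1
  · simp only [TI]; linarith
  · exact BC.int (BC.lmul hK ((h.dv (0, e)).slice p).bc)
  · exact BC.int (BC.lmul hK' (h.slice p).bc)

lemma TI_add {K : Y → ℝ} (hK : BM K) {f g : V × Y → ℝ} {p : V} (hf : BC (fun y => f (p, y)))
    (hg : BC (fun y => g (p, y))) :
    TI μ K (fun q => f q + g q) p = TI μ K f p + TI μ K g p := by
  simp only [TI, mul_add]
  exact integral_add (BC.lmul hK hf).int (BC.lmul hK hg).int

end trans

section four
variable {n : ℕ}

def cK (ξ y : EuclideanSpace ℝ (Fin n)) : ℝ := Real.cos (2 * π * inner ℝ y ξ)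
def sK (ξ y : EuclideanSpace ℝ (Fin n)) : ℝ := - Real.sin (2 * π * inner ℝ y ξ)

lemma cK_cont (ξ : EuclideanSpace ℝ (Fin n)) : Continuous (cK ξ) := by unfold cK; fun_prop
lemma sK_cont (ξ : EuclideanSpace ℝ (Fin n)) : Continuous (sK ξ) := by unfold sK; fun_prop
lemma cK_bm (ξ : EuclideanSpace ℝ (Fin n)) : BM (cK ξ) := ⟨(cK_cont ξ).measurable, 1, fun y => Real.abs_cos_le_one _⟩
lemma sK_bm (ξ : EuclideanSpace ℝ (Fin n)) : BM (sK ξ) := ⟨(sK_cont ξ).measurable, 1, fun y => by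
  unfold sK; rw [abs_neg]; exact Real.abs_sin_le_one _⟩

lemma cK_line (ξ y e : EuclideanSpace ℝ (Fin n)) :
    HasLineDerivAt ℝ (cK ξ) ((2 * π * inner ℝ e ξ) * sK ξ y) y e := by
  have h : HasDerivAt (fun s : ℝ => 2 * π * inner ℝ (y + s • e) ξ) (2 * π * inner ℝ e ξ) 0 := by
    simp only [inner_add_left, real_inner_smul_left]
    simpa using (((hasDerivAt_id (0:ℝ)).mul_const (inner ℝ e ξ)).const_add
      (inner ℝ y ξ)).const_mul (2 * π)
  have := h.cos
  simp only [zero_smul, add_zero] at this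
  have e2 : (2 * π * inner ℝ e ξ) * sK ξ y
      = -Real.sin (2 * π * inner ℝ y ξ) * (2 * π * inner ℝ e ξ) := by unfold sK; ring
  rw [e2]
  exact this

lemma sK_line (ξ y e : EuclideanSpace ℝ (Fin n)) :
    HasLineDerivAt ℝ (sK ξ) (-(2 * π * inner ℝ e ξ) * cK ξ y) y e := by
  have h : HasDerivAt (fun s : ℝ => 2 * π * inner ℝ (y + s • e) ξ) (2 * π * inner ℝ e ξ) 0 := by
    simp only [inner_add_left, real_inner_smul_left]
    simpa using (((hasDerivAt_id (0:ℝ)).mul_const (inner ℝ e ξ)).const_add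
      (inner ℝ y ξ)).const_mul (2 * π)
  have := h.sin.neg
  simp only [zero_smul, add_zero] at this
  have e2 : -(2 * π * inner ℝ e ξ) * cK ξ y
      = -(Real.cos (2 * π * inner ℝ y ξ) * (2 * π * inner ℝ e ξ)) := by unfold cK; ring
  rw [e2]
  exact this

variable {V : Type*} [NormedAddCommGroup V] [NormedSpace ℝ V]

def Cc (g : V × EuclideanSpace ℝ (Fin n) → ℝ) (ξ : EuclideanSpace ℝ (Fin n)) (p : V) : ℝ :=
  TI volume (cK ξ) g p
def Ss (g : V × EuclideanSpace ℝ (Fin n) → ℝ) (ξ : EuclideanSpace ℝ (Fin n)) (p : V) : ℝ :=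
  TI volume (sK ξ) g p

lemma TI_cmul (μ : Measure (EuclideanSpace ℝ (Fin n))) (K : EuclideanSpace ℝ (Fin n) → ℝ) (c : ℝ) (g : V × EuclideanSpace ℝ (Fin n) → ℝ) (p : V) :
    TI μ (fun y => c * K y) g p = c * TI μ K g p := by
  simp only [TI, mul_assoc, integral_const_mul]

lemma Cc_y {g : V × EuclideanSpace ℝ (Fin n) → ℝ} (h : Tst g) (e ξ : EuclideanSpace ℝ (Fin n)) (p : V) :
    Cc (dv ((0, e) : V × EuclideanSpace ℝ (Fin n)) g) ξ p = -(2 * π * inner ℝ e ξ) * Ss g ξ p := by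
  unfold Cc Ss
  rw [TI_ibp (cK_bm ξ) (BM.mul (BM.const (2 * π * inner ℝ e ξ)) (sK_bm ξ)) h e
    (fun y => cK_line ξ y e) p, TI_cmul]; ring
lemma Ss_y {g : V × EuclideanSpace ℝ (Fin n) → ℝ} (h : Tst g) (e ξ : EuclideanSpace ℝ (Fin n)) (p : V) :
    Ss (dv ((0, e) : V × EuclideanSpace ℝ (Fin n)) g) ξ p = (2 * π * inner ℝ e ξ) * Cc g ξ p := by
  unfold Cc Ss
  rw [TI_ibp (sK_bm ξ) (BM.mul (BM.const (-(2 * π * inner ℝ e ξ))) (cK_bm ξ)) h e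
    (fun y => sK_line ξ y e) p, TI_cmul]; ring
lemma Cc_x {g : V × EuclideanSpace ℝ (Fin n) → ℝ} (h : Tst g) (e : V) (ξ : EuclideanSpace ℝ (Fin n)) :
    Cc (dv ((e, 0) : V × EuclideanSpace ℝ (Fin n)) g) ξ = dv e (Cc g ξ) := (TI_dv (cK_cont ξ) h e).symm
lemma Ss_x {g : V × EuclideanSpace ℝ (Fin n) → ℝ} (h : Tst g) (e : V) (ξ : EuclideanSpace ℝ (Fin n)) :
    Ss (dv ((e, 0) : V × EuclideanSpace ℝ (Fin n)) g) ξ = dv e (Ss g ξ) := (TI_dv (sK_cont ξ) h e).symm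
lemma Cc_tst {g : V × EuclideanSpace ℝ (Fin n) → ℝ} (h : Tst g) (ξ : EuclideanSpace ℝ (Fin n)) : Tst (Cc g ξ) := TI_tst (cK_cont ξ) h
lemma Ss_tst {g : V × EuclideanSpace ℝ (Fin n) → ℝ} (h : Tst g) (ξ : EuclideanSpace ℝ (Fin n)) : Tst (Ss g ξ) := TI_tst (sK_cont ξ) h

lemma plancherel (g : V × EuclideanSpace ℝ (Fin n) → ℝ) (p : V) (h : Tst (fun y => g (p, y))) :
    Integrable (fun ξ => Cc g ξ p ^ 2 + Ss g ξ p ^ 2) ∧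
    ∫ ξ, (Cc g ξ p ^ 2 + Ss g ξ p ^ 2) = ∫ y, g (p, y) ^ 2 := by
  set f : EuclideanSpace ℝ (Fin n) → ℂ := fun y => (g (p, y) : ℂ) with hf
  have hc : HasCompactSupport f := h.2.comp_left (g := fun x : ℝ => (x : ℂ)) (by simp)
  have hs : ContDiff ℝ (⊤ : ℕ∞) f := Complex.ofRealCLM.contDiff.comp h.1
  set F := hc.toSchwartzMap hs with hF
  have hval : ∀ ξ, FourierTransform.fourier F ξ = (Cc g ξ p : ℂ) + (Ss g ξ p : ℂ) * Complex.I := by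
    intro ξ
    rw [SchwartzMap.fourier_coe, Real.fourier_eq']
    simp only [Cc, Ss, TI, ← integral_complex_ofReal]
    rw [← integral_mul_const, ← integral_add]
    · congr 1; funext y
      have hFy : F y = (g (p, y) : ℂ) := rfl
      simp only [cK, sK, hFy, smul_eq_mul, Complex.exp_mul_I]
      push_cast
      simp only [neg_mul, Complex.cos_neg, Complex.sin_neg]
      ring
    · exact (BC.int (BC.lmul (cK_bm ξ) h.bc)).ofReal
    · exact (BC.int (BC.lmul (sK_bm ξ) h.bc)).ofReal.mul_const _
  have hn : ∀ ξ, ‖FourierTransform.fourier F ξ‖ ^ 2 = Cc g ξ p ^ 2 + Ss g ξ p ^ 2 := by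
    intro ξ
    rw [hval, ← Complex.normSq_eq_norm_sq, Complex.normSq_add_mul_I]
  constructor
  · have := ((FourierTransform.fourier F).memLp 2 (μ := volume)).integrable_norm_pow (by norm_num)
    simpa [hn] using this
  · have := SchwartzMap.integral_norm_sq_fourier F
    simp only [hn] at this
    rw [this]
    congr 1; funext y
    simp [hF, hf]
end four


section fa
variable {n : ℕ}

instance volEY_haar : (volume : Measure (E3 × EuclideanSpace ℝ (Fin n))).IsAddHaarMeasure :=
  Measure.prod.instIsAddHaarMeasure (volume : Measure E3)
    (volume : Measure (EuclideanSpace ℝ (Fin n)))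

lemma planch2 {g : E3 × EuclideanSpace ℝ (Fin n) → ℝ} (hg : BC g)
    (hs : ∀ p, Tst (fun y => g (p, y))) :
    Integrable (fun z : EuclideanSpace ℝ (Fin n) × E3 => Cc g z.1 z.2 ^ 2 + Ss g z.1 z.2 ^ 2)
      (volume.prod volume) ∧
    ∫ z : EuclideanSpace ℝ (Fin n) × E3, (Cc g z.1 z.2 ^ 2 + Ss g z.1 z.2 ^ 2)
      ∂(volume.prod volume) = ∫ q, g q ^ 2 := by
  have mC : StronglyMeasurable
      (fun z : EuclideanSpace ℝ (Fin n) × E3 => Cc g z.1 z.2) := by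
    unfold Cc TI
    apply StronglyMeasurable.integral_prod_right (f := fun (z : EuclideanSpace ℝ (Fin n) × E3)
      (y : EuclideanSpace ℝ (Fin n)) => cK z.1 y * g (z.2, y))
    apply Measurable.stronglyMeasurable
    apply Measurable.mul
    · apply Continuous.measurable; simp only [cK]; fun_prop
    · exact hg.1.1.comp (by fun_prop)
  have mS : StronglyMeasurable
      (fun z : EuclideanSpace ℝ (Fin n) × E3 => Ss g z.1 z.2) := by
    unfold Ss TI
    apply StronglyMeasurable.integral_prod_right (f := fun (z : EuclideanSpace ℝ (Fin n) × E3)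
      (y : EuclideanSpace ℝ (Fin n)) => sK z.1 y * g (z.2, y))
    apply Measurable.stronglyMeasurable
    apply Measurable.mul
    · apply Continuous.measurable; simp only [sK]; fun_prop
    · exact hg.1.1.comp (by fun_prop)
  have hI : Integrable (fun z : EuclideanSpace ℝ (Fin n) × E3 =>
      Cc g z.1 z.2 ^ 2 + Ss g z.1 z.2 ^ 2) (volume.prod volume) := by
    have mm : AEStronglyMeasurable (fun z : EuclideanSpace ℝ (Fin n) × E3 =>
      Cc g z.1 z.2 ^ 2 + Ss g z.1 z.2 ^ 2) (volume.prod volume) :=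
      ((mC.pow 2).add (mS.pow 2)).aestronglyMeasurable
    rw [integrable_prod_iff' mm]
    refine ⟨Eventually.of_forall fun p => (plancherel g p (hs p)).1, ?_⟩
    have : ∀ p, ∫ ξ, ‖Cc g ξ p ^ 2 + Ss g ξ p ^ 2‖ = ∫ y, g (p, y) ^ 2 := by
      intro p
      rw [← (plancherel g p (hs p)).2]
      congr 1; funext ξ
      rw [Real.norm_of_nonneg (by positivity)]
    simp only [this]
    exact (hg.sq.int (μ := (volume : Measure E3).prod volume)).integral_prod_left
  refine ⟨hI, ?_⟩
  rw [integral_prod_symm _ hI]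
  simp only [(plancherel g _ (hs _)).2]
  exact (integral_prod _ (hg.sq.int (μ := (volume : Measure E3).prod volume))).symm

lemma sum2 (M : Fin (n + 2) → Fin (n + 2) → ℝ) :
    ∑ j, ∑ k, M j k = M 0 0 + M 0 1 + M 1 0 + M 1 1
      + ∑ k : Fin n, (M 0 k.succ.succ + M k.succ.succ 0)
      + ∑ k : Fin n, (M 1 k.succ.succ + M k.succ.succ 1)
      + ∑ k : Fin n, ∑ l : Fin n, M k.succ.succ l.succ.succ := by
  simp only [Fin.sum_univ_succ, Fin.succ_zero_eq_one, Finset.sum_add_distrib]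
  ring
lemma sum1 (M : Fin (n + 2) → ℝ) :
    ∑ j, M j = M 0 + M 1 + ∑ k : Fin n, M k.succ.succ := by
  simp only [Fin.sum_univ_succ, Fin.succ_zero_eq_one]
  ring

def bv (j : Fin (n + 2)) : E3 × EuclideanSpace ℝ (Fin n) :=
  Fin.cases (ee1, 0) (fun j' => Fin.cases (ee2, 0)
    (fun k => ((0 : E3), EuclideanSpace.single k (1 : ℝ))) j') j

lemma bv0 : bv (0 : Fin (n + 2)) = (ee1, 0) := rfl
lemma bv1 : bv (1 : Fin (n + 2)) = (ee2, 0) := rfl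
lemma bvk (k : Fin n) : bv k.succ.succ = ((0 : E3), EuclideanSpace.single k (1 : ℝ)) := rfl

def sv (ξ : EuclideanSpace ℝ (Fin n)) (k : Fin n) : ℝ := 2 * π * ξ k

variable {U : E3 × EuclideanSpace ℝ (Fin n) → ℝ} {ξ : EuclideanSpace ℝ (Fin n)}

lemma Cc_k (h : Tst U) (k : Fin n) :
    Cc (dv (bv k.succ.succ) U) ξ = fun p => -sv ξ k * Ss U ξ p := by
  funext p
  rw [bvk, Cc_y h, sv, EuclideanSpace.inner_single_left]; simp
lemma Ss_k (h : Tst U) (k : Fin n) :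
    Ss (dv (bv k.succ.succ) U) ξ = fun p => sv ξ k * Cc U ξ p := by
  funext p
  rw [bvk, Ss_y h, sv, EuclideanSpace.inner_single_left]; simp
lemma Cc_0 (h : Tst U) : Cc (dv (bv 0) U) ξ = dv ee1 (Cc U ξ) := Cc_x h ee1 ξ
lemma Cc_1 (h : Tst U) : Cc (dv (bv 1) U) ξ = dv ee2 (Cc U ξ) := Cc_x h ee2 ξ
lemma Ss_0 (h : Tst U) : Ss (dv (bv 0) U) ξ = dv ee1 (Ss U ξ) := Ss_x h ee1 ξ
lemma Ss_1 (h : Tst U) : Ss (dv (bv 1) U) ξ = dv ee2 (Ss U ξ) := Ss_x h ee2 ξ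

/-- the Fourier side of the quantity to be estimated -/
lemma first_id (h : Tst U) (p : E3) :
    ∑ j, (Cc (dv (bv j) U) ξ p ^ 2 + Ss (dv (bv j) U) ξ p ^ 2)
     = dv ee1 (Cc U ξ) p ^ 2 + dv ee2 (Cc U ξ) p ^ 2
       + dv ee1 (Ss U ξ) p ^ 2 + dv ee2 (Ss U ξ) p ^ 2
       + (∑ k, sv ξ k ^ 2) * (Cc U ξ p ^ 2 + Ss U ξ p ^ 2) := by
  rw [sum1]
  simp only [Cc_0 h, Cc_1 h, Ss_0 h, Ss_1 h, Cc_k h, Ss_k h, Finset.sum_mul]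
  have : ∀ k : Fin n, (-sv ξ k * Ss U ξ p) ^ 2 + (sv ξ k * Cc U ξ p) ^ 2
    = sv ξ k ^ 2 * (Cc U ξ p ^ 2 + Ss U ξ p ^ 2) := fun k => by ring
  simp only [this]; ring

lemma second_id (h : Tst U) (p : E3) :
    ∑ j, ∑ k, (Cc (dv (bv j) (dv (bv k) U)) ξ p ^ 2 + Ss (dv (bv j) (dv (bv k) U)) ξ p ^ 2)
     = (dv ee1 (dv ee1 (Cc U ξ)) p ^ 2 + 2 * dv ee1 (dv ee2 (Cc U ξ)) p ^ 2
          + dv ee2 (dv ee2 (Cc U ξ)) p ^ 2)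
       + (dv ee1 (dv ee1 (Ss U ξ)) p ^ 2 + 2 * dv ee1 (dv ee2 (Ss U ξ)) p ^ 2
          + dv ee2 (dv ee2 (Ss U ξ)) p ^ 2)
       + 2 * (∑ k, sv ξ k ^ 2) * (dv ee1 (Cc U ξ) p ^ 2 + dv ee2 (Cc U ξ) p ^ 2
       + dv ee1 (Ss U ξ) p ^ 2 + dv ee2 (Ss U ξ) p ^ 2)
       + (∑ k, sv ξ k ^ 2) ^ 2 * (Cc U ξ p ^ 2 + Ss U ξ p ^ 2) := by
  rw [sum2]
  have hd := fun j => h.dv (bv j)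
  have hC := Cc_tst h ξ
  have hS := Ss_tst h ξ
  simp only [Cc_0 (hd _), Cc_1 (hd _), Ss_0 (hd _), Ss_1 (hd _), Cc_k (hd _), Ss_k (hd _),
    Cc_0 h, Cc_1 h, Ss_0 h, Ss_1 h, Cc_k h, Ss_k h, dv_cmul hC.diff, dv_cmul hS.diff]
  rw [dv_comm hC.1 ee2 ee1, dv_comm hS.1 ee2 ee1]
  have e3 : (∑ k, sv ξ k ^ 2) ^ 2 = ∑ k, ∑ l, sv ξ k ^ 2 * sv ξ l ^ 2 := by
    rw [sq, Finset.sum_mul_sum]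
  rw [e3]
  simp only [Finset.sum_mul, Finset.mul_sum]
  have c1 : ∀ x y z w : ℝ, ∀ k : Fin n, (-sv ξ k * x) ^ 2 + (sv ξ k * y) ^ 2
     + ((-sv ξ k * z) ^ 2 + (sv ξ k * w) ^ 2)
    = sv ξ k ^ 2 * (x ^ 2 + y ^ 2 + z ^ 2 + w ^ 2) := fun x y z w k => by ring
  have c2 : ∀ k l : Fin n, (-sv ξ k * (sv ξ l * Cc U ξ p)) ^ 2
     + (sv ξ k * (-sv ξ l * Ss U ξ p)) ^ 2
    = sv ξ k ^ 2 * sv ξ l ^ 2 * (Cc U ξ p ^ 2 + Ss U ξ p ^ 2) := fun k l => by ring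
  have c3 : ∀ x : ℝ, ∀ k : Fin n, 2 * sv ξ k ^ 2 * x = sv ξ k ^ 2 * (2 * x) := fun x k => by ring
  simp only [c1, c2, c3, ← Finset.sum_mul]
  ring

def be (A : Fin (n + 2) → Fin (n + 2) → ℝ) (i : Fin (n + 2))
    (ξ : EuclideanSpace ℝ (Fin n)) : ℝ := ∑ k : Fin n, A i k.succ.succ * sv ξ k
def ga (A : Fin (n + 2) → Fin (n + 2) → ℝ) (ξ : EuclideanSpace ℝ (Fin n)) : ℝ :=
  ∑ k : Fin n, ∑ l : Fin n, A k.succ.succ l.succ.succ * (sv ξ k * sv ξ l)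

def Fop (A : E3 → Fin (n + 2) → Fin (n + 2) → ℝ) (lam : ℝ)
    (U : E3 × EuclideanSpace ℝ (Fin n) → ℝ) (q : E3 × EuclideanSpace ℝ (Fin n)) : ℝ :=
  - dv (ee0, 0) U q + (∑ j, ∑ k, A q.1 j k * dv (bv j) (dv (bv k) U) q) - lam * U q

lemma TI_Fop (A : E3 → Fin (n + 2) → Fin (n + 2) → ℝ) (lam : ℝ) (h : Tst U)
    {K : EuclideanSpace ℝ (Fin n) → ℝ} (hK : BM K) (p : E3) :
    TI volume K (Fop A lam U) p = - TI volume K (dv (ee0, 0) U) p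
      + (∑ j, ∑ k, A p j k * TI volume K (dv (bv j) (dv (bv k) U)) p)
      - lam * TI volume K U p := by
  have hi : ∀ {g : E3 × EuclideanSpace ℝ (Fin n) → ℝ}, Tst g →
    Integrable (fun y => K y * g (p, y)) := fun hg => BC.int (BC.lmul hK (hg.slice p).bc)
  simp only [TI]
  have e : ∀ y, K y * Fop A lam U (p, y) = - (K y * dv (ee0, 0) U (p, y))
      + (∑ j, ∑ k, A p j k * (K y * dv (bv j) (dv (bv k) U) (p, y)))
      - lam * (K y * U (p, y)) := by
    intro y
    simp only [Fop, mul_add, mul_sub, Finset.mul_sum]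
    congr 1
    · congr 1
      · ring
      · exact Finset.sum_congr rfl fun j _ => Finset.sum_congr rfl fun k _ => by ring
    · ring
  simp only [e]
  have i1 : ∀ j k, Integrable (fun y => A p j k * (K y * dv (bv j) (dv (bv k) U) (p, y))) :=
    fun j k => (hi ((h.dv _).dv _)).const_mul _
  have i2 : ∀ j, Integrable (fun y => ∑ k, A p j k * (K y * dv (bv j) (dv (bv k) U) (p, y))) :=
    fun j => integrable_finsetSum _ fun k _ => i1 j k
  have i3 : Integrable (fun y => ∑ j, ∑ k, A p j k * (K y * dv (bv j) (dv (bv k) U) (p, y))) :=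
    integrable_finsetSum _ fun j _ => i2 j
  have i0 : Integrable (fun y => -(K y * dv (ee0, 0) U (p, y))) := (hi (h.dv _)).neg
  have i4 : Integrable (fun y => -(K y * dv (ee0, 0) U (p, y))
    + ∑ j, ∑ k, A p j k * (K y * dv (bv j) (dv (bv k) U) (p, y))) := i0.add i3
  rw [integral_sub i4 ((hi h).const_mul lam),
    integral_add i0 i3, integral_neg, integral_const_mul,
    integral_finsetSum _ (fun j _ => i2 j)]
  congr 2
  refine Finset.sum_congr rfl fun j _ => ?_
  rw [integral_finsetSum _ (fun k _ => i1 j k)]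
  exact Finset.sum_congr rfl fun k _ => integral_const_mul _ _

variable {A : E3 → Fin (n + 2) → Fin (n + 2) → ℝ} {lam : ℝ}

lemma Cc_Fop (h : Tst U) (hs : ∀ p j k, A p j k = A p k j) (p : E3) :
    Cc (Fop A lam U) ξ p = F1 (fun p => A p 0 0) (fun p => A p 0 1) (fun p => A p 1 1)
      (fun p => be (A p) 0 ξ) (fun p => be (A p) 1 ξ) (fun p => ga (A p) ξ) lam
      (Cc U ξ) (Ss U ξ) p := by
  have hd := fun j => h.dv (bv j)
  have hC := Cc_tst h ξ
  have hS := Ss_tst h ξ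
  rw [show Cc (Fop A lam U) ξ p = _ from TI_Fop A lam h (cK_bm ξ) p]
  change -Cc (dv (ee0, 0) U) ξ p + (∑ j, ∑ k, A p j k * Cc (dv (bv j) (dv (bv k) U)) ξ p)
    - lam * Cc U ξ p = _
  rw [sum2, Cc_x h]
  simp only [Cc_0 (hd _), Cc_1 (hd _), Ss_0 (hd _), Ss_1 (hd _), Cc_k (hd _), Ss_k (hd _),
    Cc_0 h, Cc_1 h, Ss_0 h, Ss_1 h, Cc_k h, Ss_k h, dv_cmul hC.diff, dv_cmul hS.diff]
  rw [dv_comm hC.1 ee2 ee1, hs p 1 0]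
  simp only [hs p (Fin.succ (Fin.succ _)) 0, hs p (Fin.succ (Fin.succ _)) 1]
  simp only [F1, Pop, be, ga]
  have c1 : ∀ i : Fin (n + 2), ∀ x : ℝ, ∀ k : Fin n, A p i k.succ.succ * (-sv ξ k * x)
     + A p i k.succ.succ * (-sv ξ k * x)
    = A p i k.succ.succ * sv ξ k * (-2 * x) := fun i x k => by ring
  have c2 : ∀ k l : Fin n, A p k.succ.succ l.succ.succ * (-sv ξ k * (sv ξ l * Cc U ξ p))
    = A p k.succ.succ l.succ.succ * (sv ξ k * sv ξ l) * (-Cc U ξ p) := fun k l => by ring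
  simp only [c1, c2, ← Finset.sum_mul]
  ring

lemma Ss_Fop (h : Tst U) (hs : ∀ p j k, A p j k = A p k j) (p : E3) :
    Ss (Fop A lam U) ξ p = F2 (fun p => A p 0 0) (fun p => A p 0 1) (fun p => A p 1 1)
      (fun p => be (A p) 0 ξ) (fun p => be (A p) 1 ξ) (fun p => ga (A p) ξ) lam
      (Cc U ξ) (Ss U ξ) p := by
  have hd := fun j => h.dv (bv j)
  have hC := Cc_tst h ξ
  have hS := Ss_tst h ξ
  rw [show Ss (Fop A lam U) ξ p = _ from TI_Fop A lam h (sK_bm ξ) p]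
  change -Ss (dv (ee0, 0) U) ξ p + (∑ j, ∑ k, A p j k * Ss (dv (bv j) (dv (bv k) U)) ξ p)
    - lam * Ss U ξ p = _
  rw [sum2, Ss_x h]
  simp only [Cc_0 (hd _), Cc_1 (hd _), Ss_0 (hd _), Ss_1 (hd _), Cc_k (hd _), Ss_k (hd _),
    Cc_0 h, Cc_1 h, Ss_0 h, Ss_1 h, Cc_k h, Ss_k h, dv_cmul hC.diff, dv_cmul hS.diff]
  rw [dv_comm hS.1 ee2 ee1, hs p 1 0]
  simp only [hs p (Fin.succ (Fin.succ _)) 0, hs p (Fin.succ (Fin.succ _)) 1]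
  simp only [F2, Pop, be, ga]
  have c1 : ∀ i : Fin (n + 2), ∀ x : ℝ, ∀ k : Fin n, A p i k.succ.succ * (sv ξ k * x)
     + A p i k.succ.succ * (sv ξ k * x)
    = A p i k.succ.succ * sv ξ k * (2 * x) := fun i x k => by ring
  have c2 : ∀ k l : Fin n, A p k.succ.succ l.succ.succ * (sv ξ k * (-sv ξ l * Ss U ξ p))
    = A p k.succ.succ l.succ.succ * (sv ξ k * sv ξ l) * (-Ss U ξ p) := fun k l => by ring
  simp only [c1, c2, ← Finset.sum_mul]
  ring

end fa


lemma Tst.fsum {V ι : Type*} [NormedAddCommGroup V] [NormedSpace ℝ V] (s : Finset ι)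
    {f : ι → V → ℝ} (h : ∀ i, Tst (f i)) : Tst (fun p => ∑ i ∈ s, f i p) := by
  classical
  induction s using Finset.induction_on with
  | empty => simp only [Finset.sum_empty]; exact ⟨contDiff_const, HasCompactSupport.zero⟩
  | insert a s ha ih => simp only [Finset.sum_insert ha]; exact (h a).add ih

lemma BC.fsum {V ι : Type*} [NormedAddCommGroup V] [NormedSpace ℝ V] [MeasurableSpace V]
    (s : Finset ι) {f : ι → V → ℝ} (h : ∀ i, BC (f i)) : BC (fun p => ∑ i ∈ s, f i p) := by
  classical
  induction s using Finset.induction_on with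
  | empty => simpa using (BC.zero : BC (fun _ : V => (0:ℝ)))
  | insert a s ha ih => simp only [Finset.sum_insert ha]; exact (h a).add ih

lemma int_comb {α ι : Type*} [Fintype ι] [MeasurableSpace α] {μ : Measure α} {f0 f1 : α → ℝ}
    {g : ι → α → ℝ} {G : ι → ι → α → ℝ} (h0 : Integrable f0 μ) (h1 : Integrable f1 μ)
    (hg : ∀ j, Integrable (g j) μ) (hG : ∀ j k, Integrable (G j k) μ) (lam : ℝ) :
    Integrable (fun z => f0 z + lam ^ 2 * f1 z + lam * ∑ j, g j z + ∑ j, ∑ k, G j k z) μ ∧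
    ∫ z, (f0 z + lam ^ 2 * f1 z + lam * ∑ j, g j z + ∑ j, ∑ k, G j k z) ∂μ
      = ∫ z, f0 z ∂μ + lam ^ 2 * ∫ z, f1 z ∂μ + lam * ∑ j, ∫ z, g j z ∂μ
        + ∑ j, ∑ k, ∫ z, G j k z ∂μ := by
  have ig : Integrable (fun z => ∑ j, g j z) μ := integrable_finsetSum _ fun j _ => hg j
  have iG1 : ∀ j, Integrable (fun z => ∑ k, G j k z) μ :=
    fun j => integrable_finsetSum _ fun k _ => hG j k
  have iG : Integrable (fun z => ∑ j, ∑ k, G j k z) μ := integrable_finsetSum _ fun j _ => iG1 j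
  have i1 : Integrable (fun z => f0 z + lam ^ 2 * f1 z) μ := h0.add (h1.const_mul _)
  have i2 : Integrable (fun z => f0 z + lam ^ 2 * f1 z + lam * ∑ j, g j z) μ :=
    i1.add (ig.const_mul _)
  refine ⟨i2.add iG, ?_⟩
  rw [integral_add i2 iG, integral_add i1 (ig.const_mul _), integral_add h0 (h1.const_mul _),
    integral_const_mul, integral_const_mul, integral_finsetSum _ fun j _ => hg j,
    integral_finsetSum _ fun j _ => iG1 j]
  congr 1
  exact Finset.sum_congr rfl fun j _ => integral_finsetSum _ fun k _ => hG j k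

section fin
variable {n : ℕ} {δ : ℝ}

structure AHyp (δ : ℝ) (A : E3 → Fin (n + 2) → Fin (n + 2) → ℝ) : Prop where
  hm : ∀ j k, Measurable (fun p => A p j k)
  hs : ∀ p j k, A p j k = A p k j
  lo : ∀ p (ζ : Fin (n + 2) → ℝ), δ * (∑ j, ζ j ^ 2) ≤ ∑ j, ∑ k, A p j k * ζ j * ζ k
  hi : ∀ p (ζ : Fin (n + 2) → ℝ), ∑ j, ∑ k, A p j k * ζ j * ζ k ≤ δ⁻¹ * (∑ j, ζ j ^ 2)
  tr : ∀ t x y x' y', A (t, x, y) 0 0 + A (t, x, y) 1 1 = A (t, x', y') 0 0 + A (t, x', y') 1 1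

variable {A : E3 → Fin (n + 2) → Fin (n + 2) → ℝ} {lam : ℝ}
  {U : E3 × EuclideanSpace ℝ (Fin n) → ℝ}

def zv (x y s : ℝ) (ξ : EuclideanSpace ℝ (Fin n)) (j : Fin (n + 2)) : ℝ :=
  Fin.cases x (fun j' => Fin.cases y (fun k => s * sv ξ k) j') j
lemma zv0 (x y s : ℝ) (ξ : EuclideanSpace ℝ (Fin n)) : zv x y s ξ 0 = x := rfl
lemma zv1 (x y s : ℝ) (ξ : EuclideanSpace ℝ (Fin n)) : zv x y s ξ 1 = y := rfl
lemma zvk (x y s : ℝ) (ξ : EuclideanSpace ℝ (Fin n)) (k : Fin n) :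
    zv x y s ξ k.succ.succ = s * sv ξ k := rfl

lemma zv_sq (x y s : ℝ) (ξ : EuclideanSpace ℝ (Fin n)) :
    ∑ j, zv x y s ξ j ^ 2 = x ^ 2 + y ^ 2 + s ^ 2 * ∑ k, sv ξ k ^ 2 := by
  rw [sum1]; simp only [zv0, zv1, zvk, mul_pow, Finset.mul_sum]

lemma zv_quad (B : Fin (n + 2) → Fin (n + 2) → ℝ) (hs : ∀ j k, B j k = B k j) (x y s : ℝ)
    (ξ : EuclideanSpace ℝ (Fin n)) :
    ∑ j, ∑ k, B j k * zv x y s ξ j * zv x y s ξ k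
      = B 0 0 * x ^ 2 + 2 * B 0 1 * x * y + B 1 1 * y ^ 2
        + 2 * s * (be B 0 ξ * x + be B 1 ξ * y) + s ^ 2 * ga B ξ := by
  rw [sum2]
  simp only [zv0, zv1, zvk, be, ga]
  rw [hs 1 0]
  simp only [hs (Fin.succ (Fin.succ _)) 0, hs (Fin.succ (Fin.succ _)) 1]
  have c1 : ∀ i : Fin (n + 2), ∀ x : ℝ, ∀ k : Fin n, B i k.succ.succ * x * (s * sv ξ k)
     + B i k.succ.succ * (s * sv ξ k) * x
    = B i k.succ.succ * sv ξ k * (2 * s * x) := fun i x k => by ring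
  have c2 : ∀ k l : Fin n, B k.succ.succ l.succ.succ * (s * sv ξ k) * (s * sv ξ l)
    = B k.succ.succ l.succ.succ * (sv ξ k * sv ξ l) * s ^ 2 := fun k l => by ring
  simp only [c1, c2, ← Finset.sum_mul]
  ring

lemma AHyp.bm (hδ : 0 < δ) (h : AHyp δ A) (j k : Fin (n + 2)) : BM (fun p => A p j k) := by
  refine ⟨h.hm j k, 2 * δ⁻¹, fun p => ?_⟩
  have quad : ∀ c : ℝ, ∑ i, ∑ l, A p i l * ((Pi.single j 1 : Fin (n + 2) → ℝ) i
      + c * (Pi.single k 1 : Fin (n + 2) → ℝ) i) * ((Pi.single j 1 : Fin (n + 2) → ℝ) l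
      + c * (Pi.single k 1 : Fin (n + 2) → ℝ) l) = A p j j + 2 * c * A p j k + c ^ 2 * A p k k := by
    intro c
    simp only [Pi.single_apply, mul_add, add_mul, mul_ite, mul_one, mul_zero, ite_mul, zero_mul,
      Finset.sum_add_distrib, Finset.sum_ite_eq', Finset.mem_univ, if_true]
    rw [h.hs p k j]; ring
  have nn : ∀ ζ : Fin (n + 2) → ℝ, 0 ≤ ∑ j, ∑ k, A p j k * ζ j * ζ k := fun ζ =>
    (mul_nonneg hδ.le (Finset.sum_nonneg fun i _ => sq_nonneg _)).trans (h.lo p ζ)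
  have hsq : ∀ c : ℝ, c ^ 2 = 1 → ∑ i, ((Pi.single j 1 : Fin (n + 2) → ℝ) i
      + c * (Pi.single k 1 : Fin (n + 2) → ℝ) i) ^ 2 ≤ 4 := by
    intro c hc
    have : ∀ i, ((Pi.single j 1 : Fin (n + 2) → ℝ) i
      + c * (Pi.single k 1 : Fin (n + 2) → ℝ) i) ^ 2 ≤ 2 * (Pi.single j 1 : Fin (n + 2) → ℝ) i
       + 2 * (Pi.single k 1 : Fin (n + 2) → ℝ) i := by
      intro i
      simp only [Pi.single_apply]
      split_ifs <;> nlinarith [sq_nonneg (c - 1)]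
    refine (Finset.sum_le_sum fun i _ => this i).trans ?_
    rw [Finset.sum_add_distrib, ← Finset.mul_sum, ← Finset.mul_sum]
    simp; norm_num
  have hd := inv_pos.2 hδ
  have up : ∀ c : ℝ, c ^ 2 = 1 → A p j j + 2 * c * A p j k + A p k k ≤ 4 * δ⁻¹ := by
    intro c hc
    have h1 := h.hi p (fun i => (Pi.single j 1 : Fin (n + 2) → ℝ) i
      + c * (Pi.single k 1 : Fin (n + 2) → ℝ) i)
    rw [quad, hc] at h1
    nlinarith [hsq c hc]
  have dj : ∀ i, 0 ≤ A p i i := by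
    intro i
    have := nn (Pi.single i 1)
    simpa [Pi.single_apply] using this
  have u1 := up 1 (by norm_num)
  have u2 := up (-1) (by norm_num)
  have := dj j
  have := dj k
  rw [abs_le]; constructor <;> linarith

lemma AHyp.xcoef (hδ : 0 < δ) (h : AHyp δ A) (ξ : EuclideanSpace ℝ (Fin n)) :
    XCoef δ (√(∑ k, sv ξ k ^ 2)) (fun p => A p 0 0) (fun p => A p 0 1) (fun p => A p 1 1)
      (fun p => be (A p) 0 ξ) (fun p => be (A p) 1 ξ) (fun p => ga (A p) ξ) where
  ma := h.hm _ _
  mb := h.hm _ _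
  mc := h.hm _ _
  lo := fun p x y => by
    have := h.lo p (zv x y 0 ξ)
    rw [zv_quad _ (h.hs p), zv_sq] at this
    linarith
  hi := fun p x y => by
    have := h.hi p (zv x y 0 ξ)
    rw [zv_quad _ (h.hs p), zv_sq] at this
    linarith
  tr := h.tr
  mβ1 := by
    unfold be
    exact Finset.measurable_fun_sum _ fun k _ => (h.hm _ _).mul_const _
  mβ2 := by
    unfold be
    exact Finset.measurable_fun_sum _ fun k _ => (h.hm _ _).mul_const _
  mγ := by
    unfold ga
    exact Finset.measurable_fun_sum _ fun k _ => Finset.measurable_fun_sum _ fun l _ =>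
      (h.hm _ _).mul_const _
  xlo := fun p x y s => by
    have := h.lo p (zv x y s ξ)
    rw [zv_quad _ (h.hs p), zv_sq] at this
    rw [Real.sq_sqrt (Finset.sum_nonneg fun i _ => sq_nonneg _)]
    exact this
  xhi := fun p x y s => by
    have := h.hi p (zv x y s ξ)
    rw [zv_quad _ (h.hs p), zv_sq] at this
    rw [Real.sq_sqrt (Finset.sum_nonneg fun i _ => sq_nonneg _)]
    exact this

def Qq (lam : ℝ) (U : E3 × EuclideanSpace ℝ (Fin n) → ℝ) (q : E3 × EuclideanSpace ℝ (Fin n)) : ℝ :=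
  dv (ee0, 0) U q ^ 2 + lam ^ 2 * U q ^ 2 + lam * ∑ j, dv (bv j) U q ^ 2
    + ∑ j, ∑ k, dv (bv j) (dv (bv k) U) q ^ 2

lemma Fop_bc (hδ : 0 < δ) (h : AHyp δ A) (hU : Tst U) : BC (Fop A lam U) := by
  have h1 : ∀ j k, BM (fun q : E3 × EuclideanSpace ℝ (Fin n) => A q.1 j k) := by
    intro j k
    obtain ⟨m, M, hM⟩ := h.bm hδ j k
    exact ⟨m.comp measurable_fst, M, fun q => hM q.1⟩
  have := (((hU.dv (ee0, 0)).bc).neg.add (BC.fsum Finset.univ fun j => BC.fsum Finset.univ fun k =>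
    BC.lmul (h1 j k) ((hU.dv (bv k)).dv (bv j)).bc)).sub (hU.cmul lam).bc
  exact this

lemma Fop_slice (hU : Tst U) (p : E3) : Tst (fun y => Fop A lam U (p, y)) :=
  ((((hU.dv (ee0, 0)).slice p)).neg.add (Tst.fsum Finset.univ fun j => Tst.fsum Finset.univ
    fun k => ((((hU.dv (bv k)).dv (bv j)).slice p).cmul (A p j k)))).sub ((hU.slice p).cmul lam)

lemma alg7 {lam R v1 v2 a1 a2 b1 b2 t1 t2 s1 s2 s3 s4 s5 s6 : ℝ} (hlam : 0 ≤ lam) :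
    t1 ^ 2 + t2 ^ 2 + lam ^ 2 * (v1 ^ 2 + v2 ^ 2)
      + lam * (a1 ^ 2 + a2 ^ 2 + b1 ^ 2 + b2 ^ 2 + R * (v1 ^ 2 + v2 ^ 2))
      + (s1 ^ 2 + 2 * s2 ^ 2 + s3 ^ 2 + (s4 ^ 2 + 2 * s5 ^ 2 + s6 ^ 2)
        + 2 * R * (a1 ^ 2 + a2 ^ 2 + b1 ^ 2 + b2 ^ 2) + R ^ 2 * (v1 ^ 2 + v2 ^ 2))
    ≤ 2 * (t1 ^ 2 + lam ^ 2 * v1 ^ 2 + lam * (a1 ^ 2 + a2 ^ 2) + (s1 ^ 2 + 2 * s2 ^ 2 + s3 ^ 2)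
        + (t2 ^ 2 + lam ^ 2 * v2 ^ 2 + lam * (b1 ^ 2 + b2 ^ 2) + (s4 ^ 2 + 2 * s5 ^ 2 + s6 ^ 2))
        + R * (a1 ^ 2 + a2 ^ 2 + b1 ^ 2 + b2 ^ 2) + R ^ 2 * (v1 ^ 2 + v2 ^ 2)) := by
  have k1 := mul_nonneg (sq_nonneg (lam - R)) (add_nonneg (sq_nonneg v1) (sq_nonneg v2))
  have k2 := mul_nonneg hlam (add_nonneg (add_nonneg (sq_nonneg a1)
      (sq_nonneg a2)) (add_nonneg (sq_nonneg b1) (sq_nonneg b2)))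
  have k3 := mul_nonneg (sq_nonneg lam) (add_nonneg (sq_nonneg v1) (sq_nonneg v2))
  have k4 := mul_nonneg (sq_nonneg R) (add_nonneg (sq_nonneg v1) (sq_nonneg v2))
  linarith [sq_nonneg t1, sq_nonneg t2, sq_nonneg s1, sq_nonneg s2, sq_nonneg s3, sq_nonneg s4,
    sq_nonneg s5, sq_nonneg s6]

lemma lem7 (hδ : 0 < δ) (hδ1 : δ ≤ 1) (h : AHyp δ A) (hlam : 0 ≤ lam) (hU : Tst U) :
    Integrable (Qq lam U) ∧ ∫ q, Qq lam U q ≤ 2 * N6 δ * ∫ q, Fop A lam U q ^ 2 := by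
  have pl : ∀ {g : E3 × EuclideanSpace ℝ (Fin n) → ℝ}, Tst g → _ :=
    fun {g} hg => planch2 (n := n) hg.bc (fun p => hg.slice p)
  have c1 := int_comb (μ := volume) ((hU.dv (ee0, 0)).bc.sq.int) hU.bc.sq.int
    (fun j => (hU.dv (bv j)).bc.sq.int) (fun j k => ((hU.dv (bv k)).dv (bv j)).bc.sq.int) lam
  have c2 := int_comb (pl (hU.dv (ee0, 0))).1 (pl hU).1
    (fun j => (pl (hU.dv (bv j))).1) (fun j k => (pl ((hU.dv (bv k)).dv (bv j))).1) lam
  have cF := planch2 (Fop_bc (lam := lam) hδ h hU) (Fop_slice hU)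
  refine ⟨c1.1, ?_⟩
  unfold Qq
  rw [c1.2, ← (pl (hU.dv (ee0, 0))).2, ← (pl hU).2, ← cF.2]
  simp only [← (pl (hU.dv (bv _))).2, ← (pl ((hU.dv (bv _)).dv (bv _))).2]
  rw [← c2.2, integral_prod _ c2.1, integral_prod _ cF.1, ← integral_const_mul]
  refine integral_mono c2.1.integral_prod_left (cF.1.integral_prod_left.const_mul _) fun ξ => ?_
  have hX := h.xcoef hδ ξ
  obtain ⟨l1, l2⟩ := lem6 hδ hδ1 (Real.sqrt_nonneg _) hX hlam (Cc_tst hU ξ) (Ss_tst hU ξ)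
  simp only [Cc_Fop hU h.hs, Ss_Fop hU h.hs]
  refine le_trans ?_ (le_of_le_of_eq (mul_le_mul_of_nonneg_left l2 zero_le_two) (by ring))
  rw [← integral_const_mul]
  refine integral_mono_of_nonneg (Eventually.of_forall fun p => ?_) (l1.int.const_mul _)
    (Eventually.of_forall fun p => ?_)
  · simp only [Pi.zero_apply]
    have a1 : 0 ≤ ∑ j, (Cc (dv (bv j) U) ξ p ^ 2 + Ss (dv (bv j) U) ξ p ^ 2) :=
      Finset.sum_nonneg fun j _ => by positivity
    have a2 : 0 ≤ ∑ j, ∑ k, (Cc (dv (bv j) (dv (bv k) U)) ξ p ^ 2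
        + Ss (dv (bv j) (dv (bv k) U)) ξ p ^ 2) :=
      Finset.sum_nonneg fun j _ => Finset.sum_nonneg fun k _ => by positivity
    positivity
  · simp only [first_id hU, second_id hU, Cc_x hU, Ss_x hU]
    have hr : √(∑ k, sv ξ k ^ 2) ^ 2 = ∑ k, sv ξ k ^ 2 :=
      Real.sq_sqrt (Finset.sum_nonneg fun i _ => sq_nonneg _)
    have hr4 : √(∑ k, sv ξ k ^ 2) ^ 4 = (∑ k, sv ξ k ^ 2) ^ 2 := by
      rw [show ∀ x : ℝ, x ^ 4 = (x ^ 2) ^ 2 from fun x => by ring, hr]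
    simp only [JJ, Jq, hr, hr4]
    have hR : 0 ≤ ∑ k, sv ξ k ^ 2 := Finset.sum_nonneg fun i _ => sq_nonneg _
    exact alg7 hlam
end fin

section transfer
variable {n : ℕ}

def PhiL : (E3 × EuclideanSpace ℝ (Fin n)) ≃ₗ[ℝ] (ℝ × (Fin (n + 2) → ℝ)) where
  toFun q := (q.1.1, fun j => Fin.cases q.1.2.1 (fun j' => Fin.cases q.1.2.2 (fun k => q.2 k) j') j)
  invFun p := ((p.1, p.2 0, p.2 1), WithLp.toLp 2 (fun k => p.2 k.succ.succ))
  map_add' q q' := by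
    refine Prod.ext rfl (funext fun j => ?_)
    refine Fin.cases rfl (fun j' => ?_) j
    exact Fin.cases rfl (fun k => rfl) j'
  map_smul' c q := by
    refine Prod.ext rfl (funext fun j => ?_)
    refine Fin.cases rfl (fun j' => ?_) j
    exact Fin.cases rfl (fun k => rfl) j'
  left_inv q := rfl
  right_inv p := by
    refine Prod.ext rfl (funext fun j => ?_)
    refine Fin.cases rfl (fun j' => ?_) j
    exact Fin.cases rfl (fun k => rfl) j'

def Phi : (E3 × EuclideanSpace ℝ (Fin n)) ≃L[ℝ] (ℝ × (Fin (n + 2) → ℝ)) :=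
  PhiL.toContinuousLinearEquiv

lemma Phi_apply (q : E3 × EuclideanSpace ℝ (Fin n)) : Phi q = (q.1.1, fun j =>
    Fin.cases q.1.2.1 (fun j' => Fin.cases q.1.2.2 (fun k => q.2 k) j') j) := rfl

lemma Phi_bv (j : Fin (n + 2)) : Phi (bv j) = (0, Pi.single j 1) := by
  rw [Phi_apply]
  refine Fin.cases ?_ (fun j' => ?_) j
  · refine Prod.ext rfl (funext fun i => ?_)
    refine Fin.cases ?_ (fun i' => ?_) i
    · rfl
    · refine Fin.cases ?_ (fun k => ?_) i'
      · rfl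
      · simp [bv0, ee1]
  · refine Fin.cases ?_ (fun k => ?_) j'
    · refine Prod.ext rfl (funext fun i => ?_)
      refine Fin.cases ?_ (fun i' => ?_) i
      · rfl
      · refine Fin.cases ?_ (fun k => ?_) i'
        · rfl
        · simp [bv1, ee2, Pi.single_apply, Fin.ext_iff]
    · refine Prod.ext rfl (funext fun i => ?_)
      refine Fin.cases ?_ (fun i' => ?_) i
      · simp [bvk, Pi.single_apply, Fin.ext_iff]
      · refine Fin.cases ?_ (fun l => ?_) i'
        · simp only [bvk, Fin.cases_zero, Fin.cases_succ]
          rw [Pi.single_eq_of_ne]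
          · rfl
          · simp [Fin.ext_iff]
        · simp [bvk, Pi.single_apply, Fin.ext_iff]

lemma Phi_e0 : Phi ((ee0, 0) : E3 × EuclideanSpace ℝ (Fin n)) = (1, 0) := by
  rw [Phi_apply]
  refine Prod.ext rfl (funext fun i => ?_)
  refine Fin.cases rfl (fun i' => ?_) i
  exact Fin.cases rfl (fun k => rfl) i'

lemma dv_comp_Phi {u : ℝ × (Fin (n + 2) → ℝ) → ℝ} (hu : Differentiable ℝ u)
    (w : E3 × EuclideanSpace ℝ (Fin n)) :
    dv w (fun q => u (Phi q)) = fun q => dv (Phi w) u (Phi q) := by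
  funext q
  have := ((hu (Phi q)).hasFDerivAt.comp q (Phi (n := n)).hasFDerivAt).fderiv
  simp only [dv]
  change fderiv ℝ (u ∘ Phi) q w = _
  rw [this]; rfl

lemma pd_eq {d : ℕ} {u : ℝ × (Fin d → ℝ) → ℝ} (hu : Differentiable ℝ u) (j : Fin d) :
    pd j u = dv (0, Pi.single j 1) u := by
  funext p
  have h1 : HasDerivAt (fun s : ℝ => ((p.1, Function.update p.2 j s) : ℝ × (Fin d → ℝ)))
      (0, Pi.single j 1) (p.2 j) :=
    (hasDerivAt_const _ _).prodMk (hasDerivAt_update p.2 j (p.2 j))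
  have h2 : HasFDerivAt u (fderiv ℝ u p) (p.1, Function.update p.2 j (p.2 j)) := by
    simpa using (hu p).hasFDerivAt
  exact (h2.comp_hasDerivAt _ h1).deriv

lemma pt_eq {d : ℕ} {u : ℝ × (Fin d → ℝ) → ℝ} (hu : Differentiable ℝ u) :
    pt u = dv (1, 0) u := by
  funext p
  have h1 : HasDerivAt (fun s : ℝ => ((s, p.2) : ℝ × (Fin d → ℝ))) (1, 0) p.1 :=
    (hasDerivAt_id _).prodMk (hasDerivAt_const _ _)
  exact ((hu p).hasFDerivAt.comp_hasDerivAt _ h1).deriv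

lemma int_Phi : ∃ c : ℝ, 0 ≤ c ∧ ∀ F : ℝ × (Fin (n + 2) → ℝ) → ℝ,
    ∫ p, F p = c * ∫ q, F (Phi (n := n) q) := by
  have i1 : (volume : Measure (ℝ × (Fin (n + 2) → ℝ))).IsAddHaarMeasure :=
    Measure.prod.instIsAddHaarMeasure (volume : Measure ℝ) (volume : Measure (Fin (n + 2) → ℝ))
  have i2 : (Measure.map (Phi (n := n)) volume).IsAddHaarMeasure :=
    (Phi (n := n)).isAddHaarMeasure_map volume
  have h := Measure.isAddLeftInvariant_eq_smul (volume : Measure (ℝ × (Fin (n + 2) → ℝ)))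
    (Measure.map (Phi (n := n)) volume)
  refine ⟨_, NNReal.coe_nonneg (Measure.addHaarScalarFactor
    (volume : Measure (ℝ × (Fin (n + 2) → ℝ))) (Measure.map (Phi (n := n)) volume)), fun F => ?_⟩
  conv_lhs => rw [h]
  rw [integral_smul_nnreal_measure]
  have h3 : ∫ x, F x ∂(Measure.map (Phi (n := n)) volume) = ∫ q, F (Phi (n := n) q) :=
    (Phi (n := n)).toHomeomorph.measurableEmbedding.integral_map F
  rw [h3]
  rfl

lemma eL2 {α E : Type*} [MeasurableSpace α] {μ : Measure α} [NormedAddCommGroup E] {g : α → E}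
    (h : Integrable (fun x => ‖g x‖ ^ 2) μ) :
    eLpNorm g 2 μ = ENNReal.ofReal (√(∫ x, ‖g x‖ ^ 2 ∂μ)) := by
  rw [eLpNorm_eq_lintegral_rpow_enorm_toReal (by norm_num) (by norm_num)]
  have : ∫⁻ x, ‖g x‖ₑ ^ (2 : ℝ≥0∞).toReal ∂μ = ENNReal.ofReal (∫ x, ‖g x‖ ^ 2 ∂μ) := by
    rw [ofReal_integral_eq_lintegral_ofReal h (Eventually.of_forall fun x => by positivity)]
    congr 1; funext x
    rw [ENNReal.ofReal_pow (norm_nonneg _), ofReal_norm]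
    simp
  rw [this, Real.sqrt_eq_rpow, ENNReal.ofReal_rpow_of_nonneg (by positivity) (by norm_num)]
  simp

end transfer

/-- **Theorem 3.2**: dimension-independent a priori `L₂` estimate: for parabolic operators
`Lu = -u_t + a^{jk}(t,x')D_{jk}u` with `tr a` depending only on `t`, there is `N = N(δ)`
(independent of `d`) such that the `W^{1,2}_2(ℝ^{d+1})` estimate holds for every
`u ∈ C₀^∞(ℝ^{d+1})` and every `λ ≥ 0`. -/
theorem statement13 (δ : ℝ) (hδ0 : 0 < δ) (hδ1 : δ ≤ 1) :
    ∃ N : ℝ, 0 < N ∧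
      ∀ (d : ℕ) (hd : 2 ≤ d)
        (a : ℝ × (Fin d → ℝ) → Fin d → Fin d → ℝ),
        (∀ j k, Measurable fun q => a q j k) →
        Elliptic δ a →
        -- the coefficients depend only on (t, x')
        (∀ (j k : Fin d) (t : ℝ) (x y : Fin d → ℝ),
          (∀ i : Fin d, (i : ℕ) < 2 → x i = y i) → a (t, x) j k = a (t, y) j k) →
        -- tr a depends only on t
        (∀ (t : ℝ) (x y : Fin d → ℝ), trA hd a (t, x) = trA hd a (t, y)) →
        ∀ u : ℝ × (Fin d → ℝ) → ℝ,
          ContDiff ℝ (⊤ : ℕ∞) u → HasCompactSupport u →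
          ∀ lam : ℝ, 0 ≤ lam →
          ENNReal.ofReal lam * eLpNorm u 2 (volume : Measure (ℝ × (Fin d → ℝ)))
            + ENNReal.ofReal (Real.sqrt lam) *
                eLpNorm (sgrad u) 2 (volume : Measure (ℝ × (Fin d → ℝ)))
            + eLpNorm (shess u) 2 (volume : Measure (ℝ × (Fin d → ℝ)))
            + eLpNorm (pt u) 2 (volume : Measure (ℝ × (Fin d → ℝ)))
          ≤ ENNReal.ofReal N *
              eLpNorm (fun q => parOp a (fun _ _ => 0) (fun _ => 0) u q - lam * u q) 2
                (volume : Measure (ℝ × (Fin d → ℝ))) := by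
  have hN6 := N6_pos hδ0
  refine ⟨4 * √(2 * N6 δ), by positivity, ?_⟩
  intro d hd a hm hell hdep htr u hu hcu lam hlam
  obtain ⟨n, rfl⟩ : ∃ n, d = n + 2 := ⟨d - 2, by omega⟩
  have hT : Tst u := ⟨hu, hcu⟩
  have hPu : ∀ w, dv w (fun q => u (Phi (n := n) q)) = fun q => dv (Phi w) u (Phi q) :=
    fun w => dv_comp_Phi hT.diff w
  have hU : Tst (fun q => u (Phi (n := n) q)) :=
    ⟨hu.comp (Phi (n := n)).contDiff, hcu.comp_homeomorph (Phi (n := n)).toHomeomorph⟩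
  have hpd : ∀ j, pd j u = dv (0, Pi.single j 1) u := fun j => pd_eq hT.diff j
  have hpd2 : ∀ j k, pd2 j k u = dv (0, Pi.single j 1) (dv (0, Pi.single k 1) u) := by
    intro j k
    unfold pd2
    rw [hpd k, pd_eq (hT.dv _).diff]
  have hpt : pt u = dv (1, 0) u := pt_eq hT.diff
  set A : E3 → Fin (n + 2) → Fin (n + 2) → ℝ := fun p => a (Phi (p, 0)) with hA
  have hAa : ∀ q : E3 × EuclideanSpace ℝ (Fin n), ∀ j k, a (Phi q) j k = A q.1 j k := by
    intro q j k
    simp only [hA, Phi_apply]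
    apply hdep
    intro i hi
    have : i = 0 ∨ i = 1 := by
      rcases i with ⟨i, h⟩
      simp only [Fin.ext_iff, Fin.val_zero, Fin.val_one]
      simp only at hi
      omega
    rcases this with rfl | rfl <;> rfl
  have hAH : AHyp δ A :=
    { hm := fun j k => (hm j k).comp ((Phi (n := n)).continuous.measurable.comp (by fun_prop))
      hs := fun p j k => (hell _).1 j k
      lo := fun p ζ => ((hell _).2 ζ).1
      hi := fun p ζ => ((hell _).2 ζ).2
      tr := fun t x y x' y' => htr t _ _ }
  obtain ⟨l1, l2⟩ := lem7 hδ0 hδ1 hAH hlam hU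
  set f : ℝ × (Fin (n + 2) → ℝ) → ℝ :=
    fun q => parOp a (fun _ _ => 0) (fun _ => 0) u q - lam * u q with hf
  have hfF : ∀ q, f (Phi q) = Fop A lam (fun q => u (Phi (n := n) q)) q := by
    intro q
    simp only [hf, parOp, Fop, hPu, hpt, hpd2, zero_mul, Finset.sum_const_zero, add_zero, hAa,
      Phi_e0]
    congr 2
    refine Finset.sum_congr rfl fun j _ => Finset.sum_congr rfl fun k _ => ?_
    rw [dv_comp_Phi (hT.dv _).diff]
    simp only [Phi_bv]
  have hQ : ∀ q, Qq lam (fun q => u (Phi (n := n) q)) q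
      = (fun p => pt u p ^ 2 + lam ^ 2 * u p ^ 2 + lam * ∑ j, pd j u p ^ 2
        + ∑ j, ∑ k, pd2 j k u p ^ 2) (Phi q) := by
    intro q
    simp only [Qq, hPu, hpt, hpd, hpd2, Phi_e0, Phi_bv]
    congr 1
    refine Finset.sum_congr rfl fun j _ => Finset.sum_congr rfl fun k _ => ?_
    rw [dv_comp_Phi (hT.dv _).diff]
    simp only [Phi_bv]
  obtain ⟨c, hc, hint⟩ := int_Phi (n := n)
  have hfin : IsFiniteMeasureOnCompacts (volume : Measure (ℝ × (Fin (n + 2) → ℝ))) := by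
    have i1 : (volume : Measure (ℝ × (Fin (n + 2) → ℝ))).IsAddHaarMeasure :=
      Measure.prod.instIsAddHaarMeasure (volume : Measure ℝ) (volume : Measure (Fin (n + 2) → ℝ))
    infer_instance
  have hfbc : BC f := by
    obtain ⟨⟨b1, M, b2⟩, b3⟩ := Fop_bc (lam := lam) hδ0 hAH hU
    have e : f = fun p => Fop A lam (fun q => u (Phi (n := n) q)) (Phi.symm p) := by
      funext p; rw [← hfF]; simp
    rw [e]
    exact ⟨⟨b1.comp (Phi (n := n)).symm.continuous.measurable, M, fun p => b2 _⟩,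
      b3.comp_homeomorph (Phi (n := n)).symm.toHomeomorph⟩
  have key : ∫ p, (pt u p ^ 2 + lam ^ 2 * u p ^ 2 + lam * ∑ j, pd j u p ^ 2
        + ∑ j, ∑ k, pd2 j k u p ^ 2) ≤ 2 * N6 δ * ∫ p, f p ^ 2 := by
    rw [hint, hint (fun p => f p ^ 2)]
    simp only [hfF]
    simp only [hQ] at l2
    calc _ ≤ c * _ := mul_le_mul_of_nonneg_left l2 hc
      _ = _ := by ring
  have J0 : Integrable (fun p => pt u p ^ 2) := by rw [hpt]; exact (hT.dv _).bc.sq.int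
  have J1 : Integrable (fun p => u p ^ 2) := hT.bc.sq.int
  have J2 : ∀ j, Integrable (fun p => pd j u p ^ 2) := fun j => by
    rw [hpd]; exact (hT.dv _).bc.sq.int
  have J3 : ∀ j k, Integrable (fun p => pd2 j k u p ^ 2) := fun j k => by
    rw [hpd2]; exact ((hT.dv _).dv _).bc.sq.int
  rw [(int_comb J0 J1 J2 J3 lam).2] at key
  have ns : ∀ p, ‖sgrad u p‖ ^ 2 = ∑ j, pd j u p ^ 2 := by
    intro p
    rw [EuclideanSpace.norm_sq_eq]
    simp [sgrad]
  have nh : ∀ p, ‖shess u p‖ ^ 2 = ∑ j, ∑ k, pd2 j k u p ^ 2 := by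
    intro p
    rw [EuclideanSpace.norm_sq_eq, Fintype.sum_prod_type]
    simp [shess]
  have J2' : Integrable (fun p => ∑ j, pd j u p ^ 2) := integrable_finsetSum _ fun j _ => J2 j
  have J3'' : ∀ j, Integrable (fun p => ∑ k, pd2 j k u p ^ 2) :=
    fun j => integrable_finsetSum _ fun k _ => J3 j k
  have J3' : Integrable (fun p => ∑ j, ∑ k, pd2 j k u p ^ 2) :=
    integrable_finsetSum _ fun j _ => J3'' j
  have s2 : ∑ j, ∫ p, pd j u p ^ 2 = ∫ p, ∑ j, pd j u p ^ 2 :=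
    (integral_finsetSum _ fun j _ => J2 j).symm
  have s3 : ∑ j, ∑ k, ∫ p, pd2 j k u p ^ 2 = ∫ p, ∑ j, ∑ k, pd2 j k u p ^ 2 := by
    rw [integral_finsetSum _ fun j _ => J3'' j]
    exact Finset.sum_congr rfl fun j _ => (integral_finsetSum _ fun k _ => J3 j k).symm
  rw [s2, s3] at key
  rw [eL2 (g := u) (by simpa using J1), eL2 (g := sgrad u) (by simpa only [ns] using J2'),
    eL2 (g := shess u) (by simpa only [nh] using J3'), eL2 (g := pt u) (by simpa using J0),
    eL2 (g := f) (by simpa using (hfbc.sq.int (μ := volume)))]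
  simp only [ns, nh, Real.norm_eq_abs, sq_abs]
  have n0 : 0 ≤ ∫ p, pt u p ^ 2 := integral_nonneg fun p => sq_nonneg _
  have n1 : 0 ≤ ∫ p, u p ^ 2 := integral_nonneg fun p => sq_nonneg _
  have n2 : 0 ≤ ∫ p, ∑ j, pd j u p ^ 2 :=
    integral_nonneg fun p => Finset.sum_nonneg fun j _ => sq_nonneg _
  have n3 : 0 ≤ ∫ p, ∑ j, ∑ k, pd2 j k u p ^ 2 :=
    integral_nonneg fun p => Finset.sum_nonneg fun j _ => Finset.sum_nonneg fun k _ => sq_nonneg _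
  set X0 := ∫ p, pt u p ^ 2
  set X1 := ∫ p, u p ^ 2
  set X2 := ∫ p, ∑ j, pd j u p ^ 2
  set X3 := ∫ p, ∑ j, ∑ k, pd2 j k u p ^ 2
  set S := ∫ p, f p ^ 2
  have m1 := mul_nonneg (sq_nonneg lam) n1
  have m2 := mul_nonneg hlam n2
  have r0 : √X0 ≤ √(2 * N6 δ) * √S := by
    rw [← Real.sqrt_mul (by positivity)]; exact Real.sqrt_le_sqrt (by linarith)
  have r1 : lam * √X1 ≤ √(2 * N6 δ) * √S := by
    rw [← Real.sqrt_mul (by positivity)]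
    calc lam * √X1 = √(lam ^ 2 * X1) := by rw [Real.sqrt_mul (sq_nonneg _), Real.sqrt_sq hlam]
      _ ≤ _ := Real.sqrt_le_sqrt (by linarith)
  have r2 : √lam * √X2 ≤ √(2 * N6 δ) * √S := by
    rw [← Real.sqrt_mul hlam, ← Real.sqrt_mul (by positivity)]
    exact Real.sqrt_le_sqrt (by linarith)
  have r3 : √X3 ≤ √(2 * N6 δ) * √S := by
    rw [← Real.sqrt_mul (by positivity)]; exact Real.sqrt_le_sqrt (by linarith)
  rw [← ENNReal.ofReal_mul hlam, ← ENNReal.ofReal_mul (Real.sqrt_nonneg _),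
    ← ENNReal.ofReal_mul (by positivity), ← ENNReal.ofReal_add (by positivity) (by positivity),
    ← ENNReal.ofReal_add (by positivity) (by positivity),
    ← ENNReal.ofReal_add (by positivity) (by positivity)]
  apply ENNReal.ofReal_le_ofReal
  linarith


end
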